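/- arXiv:cs/0412108 — 4 statements merged into one kernel-verified Lean document; each statement's English description precedes it below -/
import Mathlib

section
/- For every probability distribution of X with E[X^2] < ∞, the mutual information I(snr) is a concave function of snr on [0, ∞). -/
open MeasureTheory ProbabilityTheory Real Filter
open scoped ENNReal NNReal Topology

noncomputable section

open scoped Classical in
/-- Kullback–Leibler divergence `D(μ ‖ ν)` in nats, with values in `[0, ∞]`. -/
def klDiv {α : Type*} [MeasurableSpace α] (μ ν : Measure α) : ℝ≥0∞ :=
  if μ ≪ ν ∧ Integrable (llr μ ν) μ then ENNReal.ofReal (∫ x, llr μ ν x ∂μ) else ⊤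

/-- Mutual information `I(A; B)` in nats: the KL divergence of the joint law of `(A, B)`
from the product of its marginals. -/
def mutualInfo {Ω α β : Type*} [MeasurableSpace Ω] [MeasurableSpace α] [MeasurableSpace β]
    (μ : Measure Ω) (A : Ω → α) (B : Ω → β) : ℝ≥0∞ :=
  klDiv (μ.map fun ω => (A ω, B ω)) ((μ.map A).prod (μ.map B))

/-- The tilting density. -/
def tiltE (s : ℝ≥0) (x z : ℝ) : ℝ≥0∞ := ENNReal.ofReal (Real.exp (x * z - s * x ^ 2 / 2))

lemma measurable_tiltE (s : ℝ≥0) : Measurable (fun p : ℝ × ℝ => tiltE s p.1 p.2) := by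
  unfold tiltE; fun_prop

lemma measurable_tiltE_comp {α : Type*} [MeasurableSpace α] (s : ℝ≥0) {f g : α → ℝ}
    (hf : Measurable f) (hg : Measurable g) : Measurable (fun a => tiltE s (f a) (g a)) :=
  (measurable_tiltE s).comp (hf.prodMk hg)

lemma measurable_tiltE_left (s : ℝ≥0) (z : ℝ) : Measurable (fun x => tiltE s x z) :=
  measurable_tiltE_comp s measurable_id measurable_const

lemma measurable_tiltE_right (s : ℝ≥0) (x : ℝ) : Measurable (fun z => tiltE s x z) :=
  measurable_tiltE_comp s measurable_const measurable_id

lemma tiltE_pos (s : ℝ≥0) (x z : ℝ) : 0 < tiltE s x z := by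
  unfold tiltE; simp [Real.exp_pos]

lemma tiltE_ne_top (s : ℝ≥0) (x z : ℝ) : tiltE s x z ≠ ⊤ := by
  unfold tiltE; simp

lemma tiltE_add (s t : ℝ≥0) (x u z : ℝ) :
    tiltE (s + t) x (u + z) = tiltE s x u * tiltE t x z := by
  unfold tiltE
  rw [← ENNReal.ofReal_mul (Real.exp_pos _).le, ← Real.exp_add]
  congr 2
  push_cast
  ring

lemma gaussian_withDensity_tiltE (s : ℝ≥0) (x : ℝ) :
    (gaussianReal 0 s).withDensity (tiltE s x) = gaussianReal (s * x) s := by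
  have hm : Measurable (tiltE s x) := measurable_tiltE_comp s measurable_const measurable_id
  by_cases hs : s = 0
  · subst hs
    simp only [gaussianReal_zero_var, NNReal.coe_zero, zero_mul]
    refine Measure.ext_of_lintegral _ fun φ hφ => ?_
    rw [lintegral_withDensity_eq_lintegral_mul _ hm hφ]
    rw [lintegral_dirac' _ (hm.mul hφ), lintegral_dirac' _ hφ]
    simp [tiltE]
  · rw [gaussianReal_of_var_ne_zero _ hs, gaussianReal_of_var_ne_zero _ hs,
      ← withDensity_mul _ (measurable_gaussianPDF _ _) hm]
    congr 1
    ext z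
    simp only [Pi.mul_apply, tiltE, gaussianPDF]
    rw [← ENNReal.ofReal_mul (gaussianPDFReal_nonneg _ _ _)]
    congr 1
    simp only [gaussianPDFReal]
    rw [mul_assoc, ← Real.exp_add]
    congr 2
    have : (s : ℝ) ≠ 0 := by exact_mod_cast hs
    field_simp
    ring

lemma lintegral_tiltE (t : ℝ≥0) (x : ℝ) : ∫⁻ z, tiltE t x z ∂(gaussianReal 0 t) = 1 := by
  have h := gaussian_withDensity_tiltE t x
  have h2 : ((gaussianReal 0 t).withDensity (tiltE t x)) Set.univ = 1 := by rw [h]; simp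
  rwa [withDensity_apply _ MeasurableSet.univ, Measure.restrict_univ] at h2

/-- The mixture likelihood ratio. -/
def mixE (P : Measure ℝ) (s : ℝ≥0) (z : ℝ) : ℝ≥0∞ := ∫⁻ x, tiltE s x z ∂P

section
variable (P : Measure ℝ) [IsProbabilityMeasure P]

lemma measurable_mixE (s : ℝ≥0) : Measurable (mixE P s) := by
  unfold mixE
  exact Measurable.lintegral_prod_right' (f := fun p : ℝ × ℝ => tiltE s p.2 p.1)
    (measurable_tiltE_comp s measurable_snd measurable_fst)

lemma mixE_pos (s : ℝ≥0) (z : ℝ) : 0 < mixE P s z := by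
  unfold mixE
  rw [lintegral_pos_iff_support (measurable_tiltE_left s z)]
  have : Function.support (fun x => tiltE s x z) = Set.univ := by
    ext x; simp [(tiltE_pos s x z).ne']
  rw [this]; simp

lemma lintegral_mixE_add (s t : ℝ≥0) (u : ℝ) :
    ∫⁻ z, mixE P (s + t) (u + z) ∂(gaussianReal 0 t) = mixE P s u := by
  unfold mixE
  rw [lintegral_lintegral_swap]
  · refine lintegral_congr fun x => ?_
    simp_rw [tiltE_add]
    rw [lintegral_const_mul _ (measurable_tiltE_right t x),
      lintegral_tiltE, mul_one]
  · exact (measurable_tiltE_comp (s + t) measurable_snd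
      (measurable_const.add measurable_fst)).aemeasurable

lemma lintegral_mixE (s : ℝ≥0) : ∫⁻ z, mixE P s z ∂(gaussianReal 0 s) = 1 := by
  have h := lintegral_mixE_add P 0 s 0
  simp only [zero_add] at h
  rw [h]
  simp [mixE, tiltE]

/-- The law of `s X + B_s`. -/
def mixLaw (s : ℝ≥0) : Measure ℝ := (gaussianReal 0 s).withDensity (mixE P s)

instance (s : ℝ≥0) : IsProbabilityMeasure (mixLaw P s) :=
  ⟨by rw [mixLaw, withDensity_apply _ MeasurableSet.univ, Measure.restrict_univ, lintegral_mixE]⟩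

lemma lintegral_mixLaw (s : ℝ≥0) {φ : ℝ → ℝ≥0∞} (hφ : Measurable φ) :
    ∫⁻ z, φ z ∂(mixLaw P s) = ∫⁻ z, mixE P s z * φ z ∂(gaussianReal 0 s) := by
  rw [mixLaw, lintegral_withDensity_eq_lintegral_mul _ (measurable_mixE P s) hφ]
  rfl

lemma lintegral_mixLaw' (s : ℝ≥0) {φ : ℝ → ℝ≥0∞} (hφ : Measurable φ) :
    ∫⁻ z, φ z ∂(mixLaw P s) = ∫⁻ x, ∫⁻ z, φ z ∂(gaussianReal (s * x) s) ∂P := by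
  rw [lintegral_mixLaw P s hφ]
  have : ∀ z, mixE P s z * φ z = ∫⁻ x, tiltE s x z * φ z ∂P := fun z => by
    rw [lintegral_mul_const _ (measurable_tiltE_left s z)]; rfl
  simp_rw [this]
  rw [lintegral_lintegral_swap]
  · refine lintegral_congr fun x => ?_
    rw [← gaussian_withDensity_tiltE, lintegral_withDensity_eq_lintegral_mul _
      (f := tiltE s x) (measurable_tiltE_right s x) hφ]
    rfl
  · exact ((measurable_tiltE_comp s measurable_snd measurable_fst).mul
      (hφ.comp measurable_fst)).aemeasurable

lemma mixE_ae_lt_top (s : ℝ≥0) : ∀ᵐ z ∂(gaussianReal 0 s), mixE P s z < ⊤ :=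
  ae_lt_top (measurable_mixE P s) (by rw [lintegral_mixE]; simp)

lemma mixE_ae_lt_top' (s : ℝ≥0) : ∀ᵐ z ∂(mixLaw P s), mixE P s z < ⊤ :=
  (withDensity_absolutelyContinuous _ _).ae_le (mixE_ae_lt_top P s)

/-- The log of the mixture likelihood ratio. -/
def logMix (s : ℝ≥0) (z : ℝ) : ℝ := Real.log (mixE P s z).toReal

lemma measurable_logMix (s : ℝ≥0) : Measurable (logMix P s) :=
  Real.measurable_log.comp (measurable_mixE P s).ennreal_toReal

lemma lintegral_sq_gaussian (m : ℝ) (s : ℝ≥0) :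
    ∫⁻ z, ENNReal.ofReal (z ^ 2) ∂(gaussianReal m s) = ENNReal.ofReal (m ^ 2 + s) := by
  have hL : MemLp (fun z : ℝ => z) 2 (gaussianReal m s) := memLp_id_gaussianReal 2
  rw [← ofReal_integral_eq_lintegral_ofReal hL.integrable_sq (ae_of_all _ fun z => sq_nonneg z)]
  congr 1
  have h := variance_eq_sub hL
  rw [variance_fun_id_gaussianReal] at h
  simp only [integral_id_gaussianReal, Pi.pow_apply] at h
  linarith

lemma lintegral_sq_mixLaw (hP : Integrable (fun x => x ^ 2) P) (s : ℝ≥0) :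
    ∫⁻ z, ENNReal.ofReal (z ^ 2) ∂(mixLaw P s) ≠ ⊤ := by
  rw [lintegral_mixLaw' P s (by fun_prop)]
  simp_rw [lintegral_sq_gaussian]
  have : Integrable (fun x : ℝ => (s * x) ^ 2 + (s : ℝ)) P := by
    simp_rw [mul_pow]
    exact (hP.const_mul _).add (integrable_const _)
  exact this.lintegral_lt_top.ne

lemma integrable_logMix (hP : Integrable (fun x => x ^ 2) P) (s : ℝ≥0) :
    Integrable (logMix P s) (mixLaw P s) := by
  by_cases hs : s = 0
  · subst hs
    have : Integrable (logMix P 0) ((gaussianReal 0 0)) := by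
      rw [gaussianReal_zero_var]
      exact integrable_dirac' (measurable_logMix P 0).stronglyMeasurable (by simp)
    have h2 : mixLaw P 0 = gaussianReal 0 0 := by
      rw [mixLaw, gaussianReal_zero_var]
      refine Measure.ext_of_lintegral _ fun φ hφ => ?_
      rw [lintegral_withDensity_eq_lintegral_mul _ (measurable_mixE P 0) hφ]
      rw [lintegral_dirac' _ ((measurable_mixE P 0).mul hφ), lintegral_dirac' _ hφ]
      simp [mixE, tiltE]
    rwa [h2]
  have hs' : 0 < (s : ℝ) := by exact_mod_cast pos_iff_ne_zero.mpr hs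
  refine ⟨(measurable_logMix P s).aestronglyMeasurable, ?_⟩
  rw [hasFiniteIntegral_iff_norm]
  have hmz : Measurable fun z : ℝ => ENNReal.ofReal (z ^ 2 / (2 * s)) := by fun_prop
  rw [lintegral_mixLaw P s ((measurable_logMix P s).norm.ennreal_ofReal)]
  have hb : ∀ z, mixE P s z * ENNReal.ofReal ‖logMix P s z‖
      ≤ 1 + mixE P s z * ENNReal.ofReal (z ^ 2 / (2 * s)) := by
    intro z
    have hle : mixE P s z ≤ ENNReal.ofReal (Real.exp (z ^ 2 / (2 * s))) := by
      unfold mixE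
      calc _ ≤ ∫⁻ x, ENNReal.ofReal (Real.exp (z ^ 2 / (2 * s))) ∂P := by
            refine lintegral_mono fun x => ?_
            refine ENNReal.ofReal_le_ofReal (Real.exp_le_exp.mpr ?_)
            rw [le_div_iff₀ (by positivity)]
            nlinarith [sq_nonneg (z - s * x)]
        _ = _ := by simp
    have htop : mixE P s z ≠ ⊤ := ne_top_of_le_ne_top ENNReal.ofReal_ne_top hle
    have hpos := ENNReal.toReal_pos (mixE_pos P s z).ne' htop
    unfold logMix
    set m := (mixE P s z).toReal with hm
    have hmE : mixE P s z = ENNReal.ofReal m := (ENNReal.ofReal_toReal htop).symm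
    rw [hmE] at hle ⊢
    rw [ENNReal.ofReal_le_ofReal_iff (Real.exp_pos _).le] at hle
    rw [← ENNReal.ofReal_mul hpos.le, ← ENNReal.ofReal_mul hpos.le, ← ENNReal.ofReal_one,
      ← ENNReal.ofReal_add (by norm_num) (by positivity)]
    refine ENNReal.ofReal_le_ofReal ?_
    rw [Real.norm_eq_abs]
    have h1 : Real.log m ≤ z ^ 2 / (2 * s) := by
      rw [Real.log_le_iff_le_exp hpos]; exact hle
    have h2 : 1 - m⁻¹ ≤ Real.log m := Real.one_sub_inv_le_log_of_pos hpos
    have h3 : m - 1 ≤ m * Real.log m := by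
      have := mul_le_mul_of_nonneg_left h2 hpos.le
      rwa [mul_sub, mul_one, mul_inv_cancel₀ hpos.ne'] at this
    have h4 : 0 ≤ z ^ 2 / (2 * s) := by positivity
    rcases abs_cases (Real.log m) with ⟨h, _⟩ | ⟨h, _⟩ <;> rw [h] <;>
      nlinarith [mul_le_mul_of_nonneg_left h1 hpos.le, mul_nonneg hpos.le h4]
  refine (lintegral_mono hb).trans_lt ?_
  rw [lintegral_add_left measurable_const, ← lintegral_mixLaw P s hmz]
  refine ENNReal.add_lt_top.mpr ⟨by simp, ?_⟩
  have : ∀ z : ℝ, ENNReal.ofReal (z ^ 2 / (2 * s))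
      = ENNReal.ofReal (1 / (2 * s)) * ENNReal.ofReal (z ^ 2) := fun z => by
    rw [← ENNReal.ofReal_mul (by positivity)]; congr 1; ring
  simp_rw [this]
  rw [lintegral_const_mul _ (by fun_prop)]
  exact ENNReal.mul_lt_top ENNReal.ofReal_lt_top (lintegral_sq_mixLaw P hP s).lt_top

/-- Entropy functional. -/
def entMix (s : ℝ≥0) : ℝ := ∫ z, logMix P s z ∂(mixLaw P s)

lemma lintegral_gaussian_add (s t : ℝ≥0) {φ : ℝ → ℝ≥0∞} (hφ : Measurable φ) :
    ∫⁻ u, ∫⁻ v, φ (u + v) ∂(gaussianReal 0 t) ∂(gaussianReal 0 s)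
      = ∫⁻ z, φ z ∂(gaussianReal 0 (s + t)) := by
  have h := gaussianReal_conv_gaussianReal (m₁ := 0) (m₂ := 0) (v₁ := s) (v₂ := t)
  rw [add_zero] at h
  rw [← h, Measure.lintegral_conv hφ]

/-- The joint law of three independent observations. -/
def tripleLaw (a b c : ℝ≥0) : Measure (ℝ × ℝ × ℝ) :=
  ((gaussianReal 0 a).prod ((gaussianReal 0 b).prod (gaussianReal 0 c))).withDensity
    (fun p => mixE P (a + b + c) (p.1 + p.2.1 + p.2.2))

lemma measurable_mixE_comp {α : Type*} [MeasurableSpace α] (s : ℝ≥0) {f : α → ℝ}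
    (hf : Measurable f) : Measurable (fun a => mixE P s (f a)) := (measurable_mixE P s).comp hf

lemma measurable_mixE_mul (s : ℝ≥0) {φ : ℝ → ℝ≥0∞} (hφ : Measurable φ) :
    Measurable (fun z => mixE P s z * φ z) := (measurable_mixE P s).mul hφ

lemma lintegral_tripleLaw (a b c : ℝ≥0) {φ : ℝ × ℝ × ℝ → ℝ≥0∞} (hφ : Measurable φ) :
    ∫⁻ p, φ p ∂(tripleLaw P a b c) = ∫⁻ u, ∫⁻ v, ∫⁻ w, mixE P (a + b + c) (u + v + w) * φ (u, v, w)
      ∂(gaussianReal 0 c) ∂(gaussianReal 0 b) ∂(gaussianReal 0 a) := by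
  have hm : Measurable (fun p : ℝ × ℝ × ℝ => mixE P (a + b + c) (p.1 + p.2.1 + p.2.2)) :=
    measurable_mixE_comp P _ (by fun_prop)
  rw [tripleLaw, lintegral_withDensity_eq_lintegral_mul _ hm hφ,
    lintegral_prod _ (hm.mul hφ).aemeasurable]
  refine lintegral_congr fun u => ?_
  exact lintegral_prod _ ((hm.mul hφ).comp measurable_prodMk_left).aemeasurable

lemma tripleLaw_map_uv (a b c : ℝ≥0) :
    (tripleLaw P a b c).map (fun p => p.1 + p.2.1) = mixLaw P (a + b) := by
  refine Measure.ext_of_lintegral _ fun φ hφ => ?_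
  rw [lintegral_map hφ (by fun_prop), lintegral_tripleLaw P a b c (by fun_prop),
    lintegral_mixLaw P _ hφ, ← lintegral_gaussian_add a b (measurable_mixE_mul P _ hφ)]
  refine lintegral_congr fun u => lintegral_congr fun v => ?_
  dsimp only
  rw [lintegral_mul_const _ (measurable_mixE_comp P _ (by fun_prop)), lintegral_mixE_add]

lemma tripleLaw_map_uvw (a b c : ℝ≥0) :
    (tripleLaw P a b c).map (fun p => p.1 + p.2.1 + p.2.2) = mixLaw P (a + b + c) := by
  refine Measure.ext_of_lintegral _ fun φ hφ => ?_
  rw [lintegral_map hφ (by fun_prop), lintegral_tripleLaw P a b c (by fun_prop),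
    lintegral_mixLaw P _ hφ, ← lintegral_gaussian_add (a + b) c (measurable_mixE_mul P _ hφ),
    ← lintegral_gaussian_add a b]
  · exact Measurable.lintegral_prod_right' (f := fun p : ℝ × ℝ =>
      mixE P (a + b + c) (p.1 + p.2) * φ (p.1 + p.2))
      ((measurable_mixE_mul P _ hφ).comp (measurable_fst.add measurable_snd))

lemma tripleLaw_map_u (a b c : ℝ≥0) :
    (tripleLaw P a b c).map (fun p => p.1) = mixLaw P a := by
  refine Measure.ext_of_lintegral _ fun φ hφ => ?_
  rw [lintegral_map hφ (by fun_prop), lintegral_tripleLaw P a b c (by fun_prop),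
    lintegral_mixLaw P _ hφ]
  refine lintegral_congr fun u => ?_
  rw [← lintegral_mixE_add P a b u, ← lintegral_mul_const _ (measurable_mixE_comp P _ (by fun_prop))]
  refine lintegral_congr fun v => ?_
  dsimp only
  rw [lintegral_mul_const _ (measurable_mixE_comp P _ (by fun_prop)), lintegral_mixE_add]

lemma tripleLaw_map_uw (a b c : ℝ≥0) :
    (tripleLaw P a b c).map (fun p => p.1 + p.2.2) = mixLaw P (a + c) := by
  refine Measure.ext_of_lintegral _ fun φ hφ => ?_
  rw [lintegral_map hφ (by fun_prop), lintegral_tripleLaw P a b c (by fun_prop),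
    lintegral_mixLaw P _ hφ, ← lintegral_gaussian_add a c (measurable_mixE_mul P _ hφ)]
  refine lintegral_congr fun u => ?_
  rw [lintegral_lintegral_swap]
  · refine lintegral_congr fun w => ?_
    have : ∀ v : ℝ, mixE P (a + b + c) (u + v + w) = mixE P (a + c + b) (u + w + v) := fun v => by
      congr 1 <;> ring
    simp_rw [this]
    rw [lintegral_mul_const _ (measurable_mixE_comp P _ (by fun_prop)), lintegral_mixE_add]
  · exact ((measurable_mixE_comp P _ (by fun_prop)).mul (by fun_prop)).aemeasurable

instance (a b c : ℝ≥0) : IsProbabilityMeasure (tripleLaw P a b c) := by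
  constructor
  have h : (tripleLaw P a b c).map (fun p => p.1) Set.univ = 1 := by rw [tripleLaw_map_u]; simp
  rwa [Measure.map_apply measurable_fst MeasurableSet.univ, Set.preimage_univ] at h

lemma entMix_submodular (hP : Integrable (fun x => x ^ 2) P) (a b c : ℝ≥0) :
    entMix P (a + b) + entMix P (a + c) ≤ entMix P (a + b + c) + entMix P a := by
  set ρ := tripleLaw P a b c with hρ
  let fuvw : ℝ × ℝ × ℝ → ℝ := fun p => p.1 + p.2.1 + p.2.2
  let fuv : ℝ × ℝ × ℝ → ℝ := fun p => p.1 + p.2.1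
  let fuw : ℝ × ℝ × ℝ → ℝ := fun p => p.1 + p.2.2
  let fu : ℝ × ℝ × ℝ → ℝ := fun p => p.1
  have key : ∀ (s : ℝ≥0) (f : ℝ × ℝ × ℝ → ℝ), Measurable f → ρ.map f = mixLaw P s →
      Integrable (fun p => logMix P s (f p)) ρ ∧ entMix P s = ∫ p, logMix P s (f p) ∂ρ ∧
      ∀ᵐ p ∂ρ, mixE P s (f p) < ⊤ := by
    intro s f hf hmap
    refine ⟨?_, ?_, ?_⟩
    · have := integrable_logMix P hP s
      rw [← hmap] at this
      exact this.comp_measurable hf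
    · rw [entMix, ← hmap, integral_map hf.aemeasurable
        (measurable_logMix P s).aestronglyMeasurable]
    · have := mixE_ae_lt_top' P s
      rw [← hmap] at this
      exact ae_of_ae_map hf.aemeasurable this
  obtain ⟨i1, e1, t1⟩ := key (a + b + c) fuvw (by fun_prop) (tripleLaw_map_uvw P a b c)
  obtain ⟨i2, e2, t2⟩ := key (a + b) fuv (by fun_prop) (tripleLaw_map_uv P a b c)
  obtain ⟨i3, e3, t3⟩ := key (a + c) fuw (by fun_prop) (tripleLaw_map_uw P a b c)
  obtain ⟨i4, e4, t4⟩ := key a fu (by fun_prop) (tripleLaw_map_u P a b c)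
  let R : ℝ × ℝ × ℝ → ℝ≥0∞ := fun p => (mixE P (a + b) (fuv p) * mixE P (a + c) (fuw p)) /
    (mixE P (a + b + c) (fuvw p) * mixE P a (fu p))
  have hRm : Measurable R :=
    ((measurable_mixE_comp P _ (by fun_prop)).mul (measurable_mixE_comp P _ (by fun_prop))).div
    ((measurable_mixE_comp P _ (by fun_prop)).mul (measurable_mixE_comp P _ (by fun_prop)))
  have hR : ∫⁻ p, R p ∂ρ ≤ 1 := by
    rw [hρ, lintegral_tripleLaw P a b c hRm]
    calc _ ≤ ∫⁻ u, ∫⁻ v, ∫⁻ w, (mixE P (a + b) (u + v) / mixE P a u) * mixE P (a + c) (u + w)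
          ∂(gaussianReal 0 c) ∂(gaussianReal 0 b) ∂(gaussianReal 0 a) := by
          refine lintegral_mono fun u => lintegral_mono fun v => lintegral_mono fun w => ?_
          simp only [R, fuvw, fuv, fuw, fu]
          set h := mixE P (a + b + c) (u + v + w)
          set q := mixE P (a + c) (u + w)
          set r := mixE P a u
          set p := mixE P (a + b) (u + v)
          rw [div_eq_mul_inv, div_eq_mul_inv,
            ENNReal.mul_inv (Or.inl (mixE_pos P _ _).ne') (Or.inr (mixE_pos P _ _).ne')]
          calc h * (p * q * (h⁻¹ * r⁻¹)) = (h * h⁻¹) * (p * r⁻¹ * q) := by ring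
            _ ≤ 1 * (p * r⁻¹ * q) := by gcongr; exact ENNReal.mul_inv_le_one h
            _ = _ := one_mul _
      _ ≤ ∫⁻ u, mixE P a u ∂(gaussianReal 0 a) := by
          refine lintegral_mono fun u => ?_
          simp only
          have : ∀ v : ℝ, ∫⁻ w, (mixE P (a + b) (u + v) / mixE P a u) * mixE P (a + c) (u + w)
              ∂(gaussianReal 0 c) = mixE P (a + b) (u + v) * ((mixE P a u)⁻¹ * mixE P a u) := by
            intro v
            rw [lintegral_const_mul _ (measurable_mixE_comp P _ (by fun_prop)),
              lintegral_mixE_add, div_eq_mul_inv, mul_assoc]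
          simp_rw [this]
          rw [lintegral_mul_const _ (measurable_mixE_comp P _ (by fun_prop)), lintegral_mixE_add]
          calc _ ≤ mixE P a u * 1 := by gcongr; exact ENNReal.inv_mul_le_one _
            _ = _ := mul_one _
      _ = 1 := lintegral_mixE P a
  have hRi : Integrable (fun p => (R p).toReal) ρ :=
    integrable_toReal_of_lintegral_ne_top hRm.aemeasurable (ne_top_of_le_ne_top (by simp) hR)
  have hRle : ∫ p, (R p).toReal ∂ρ ≤ 1 := by
    rw [integral_toReal hRm.aemeasurable (ae_lt_top hRm (ne_top_of_le_ne_top (by simp) hR))]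
    exact ENNReal.toReal_le_of_le_ofReal (by norm_num) (by simpa using hR)
  have hpt : ∀ᵐ p ∂ρ, 1 - (R p).toReal ≤ (logMix P (a + b + c) (fuvw p) + logMix P a (fu p))
      - (logMix P (a + b) (fuv p) + logMix P (a + c) (fuw p)) := by
    filter_upwards [t1, t2, t3, t4] with p h1 h2 h3 h4
    have p1 := ENNReal.toReal_pos (mixE_pos P _ _).ne' h1.ne
    have p2 := ENNReal.toReal_pos (mixE_pos P _ _).ne' h2.ne
    have p3 := ENNReal.toReal_pos (mixE_pos P _ _).ne' h3.ne
    have p4 := ENNReal.toReal_pos (mixE_pos P _ _).ne' h4.ne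
    simp only [logMix, R, ENNReal.toReal_div, ENNReal.toReal_mul]
    rw [← Real.log_mul p1.ne' p4.ne', ← Real.log_mul p2.ne' p3.ne',
      ← Real.log_div (by positivity) (by positivity)]
    refine le_trans (le_of_eq ?_) (Real.one_sub_inv_le_log_of_pos (by positivity))
    rw [inv_div]
  have hint := integral_mono_ae ((integrable_const 1).sub hRi) ((i1.add i4).sub (i2.add i3)) hpt
  have l : ∫ p, ((fun _ => (1 : ℝ)) - (fun p => (R p).toReal) : ℝ × ℝ × ℝ → ℝ) p ∂ρ = 1 - ∫ p, (R p).toReal ∂ρ := by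
    rw [integral_sub' (integrable_const 1) hRi]; simp
  rw [l, integral_sub' (i1.add i4) (i2.add i3), integral_add' i1 i4, integral_add' i2 i3,
    ← e1, ← e2, ← e3, ← e4] at hint
  linarith

end

lemma concaveOn_of_midpoint {f : ℝ → ℝ} (h0 : ∀ x, 0 ≤ f x)
    (hmid : ∀ a b, 0 ≤ a → 0 ≤ b → f a + f (a + 2 * b) ≤ 2 * f (a + b)) :
    ConcaveOn ℝ (Set.Ici 0) f := by
  have key : ∀ x y, 0 ≤ x → x ≤ y → ∀ t, 0 ≤ t → t ≤ 1 →
      (1 - t) * f x + t * f y ≤ f (x + t * (y - x)) := by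
    intro x y hx hxy
    let G : ℝ → ℝ := fun t => (1 - t) * f x + t * f y - f (x + t * (y - x))
    let C : ℝ := f x + f y
    have hC : 0 ≤ C := add_nonneg (h0 x) (h0 y)
    have hG : ∀ n : ℕ, ∀ t, 0 ≤ t → t ≤ 1 → G t ≤ C / 2 ^ n := by
      intro n
      induction n with
      | zero =>
        intro t ht0 ht1
        simp only [G, C, pow_zero, div_one]
        nlinarith [h0 x, h0 y, h0 (x + t * (y - x)), mul_nonneg ht0 (h0 x),
          mul_nonneg (sub_nonneg.mpr ht1) (h0 y)]
      | succ n ih =>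
        intro t ht0 ht1
        have hp : C / 2 ^ (n + 1) = (C / 2 ^ n) / 2 := by rw [pow_succ]; field_simp
        rw [hp]
        rcases le_total t (1 / 2) with h | h
        · have h1 := ih (2 * t) (by linarith) (by linarith)
          have h2 := hmid x (t * (y - x)) hx (mul_nonneg ht0 (sub_nonneg.mpr hxy))
          simp only [G] at h1 ⊢
          rw [show x + 2 * t * (y - x) = x + 2 * (t * (y - x)) by ring] at h1
          linarith
        · have h1 := ih (2 * t - 1) (by linarith) (by linarith)
          have h2 := hmid (x + (2 * t - 1) * (y - x)) ((1 - t) * (y - x))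
            (add_nonneg hx (mul_nonneg (by linarith) (sub_nonneg.mpr hxy)))
            (mul_nonneg (by linarith) (sub_nonneg.mpr hxy))
          simp only [G] at h1 ⊢
          rw [show x + (2 * t - 1) * (y - x) + 2 * ((1 - t) * (y - x)) = y by ring,
            show x + (2 * t - 1) * (y - x) + (1 - t) * (y - x) = x + t * (y - x) by ring] at h2
          linarith
    intro t ht0 ht1
    have hlim : Tendsto (fun n : ℕ => C / 2 ^ n) atTop (𝓝 0) := by
      have := (tendsto_pow_atTop_nhds_zero_of_lt_one (r := (1 / 2 : ℝ)) (by norm_num)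
        (by norm_num)).const_mul C
      rw [mul_zero] at this
      refine this.congr fun n => ?_
      rw [div_pow, one_pow]; ring
    have : G t ≤ 0 := ge_of_tendsto' hlim fun n => hG n t ht0 ht1
    simp only [G] at this
    linarith
  refine ⟨convex_Ici 0, fun x hx y hy a b ha hb hab => ?_⟩
  simp only [smul_eq_mul]
  rcases le_total x y with h | h
  · have := key x y hx h b hb (by linarith)
    have ea : a = 1 - b := by linarith
    rw [ea, show (1 - b) * x + b * y = x + b * (y - x) by ring]
    exact this
  · have := key y x hy h a ha (by linarith)
    have ea : b = 1 - a := by linarith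
    rw [ea, show a * x + (1 - a) * y = y + a * (x - y) by ring]
    linarith

section
variable (P : Measure ℝ) [IsProbabilityMeasure P]

lemma tiltE_sqrt (s : ℝ≥0) (x y : ℝ) :
    tiltE s x (Real.sqrt s * y) = tiltE 1 (Real.sqrt s * x) y := by
  unfold tiltE
  congr 2
  rw [mul_pow, Real.sq_sqrt s.coe_nonneg]
  push_cast
  ring

/-- The joint law of input and output. -/
def jointLaw (s : ℝ≥0) : Measure (ℝ × ℝ) :=
  (P.prod (gaussianReal 0 1)).map (fun p => (p.1, Real.sqrt s * p.1 + p.2))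

lemma jointLaw_eq (s : ℝ≥0) : jointLaw P s = (P.prod (gaussianReal 0 1)).withDensity
    (fun p => tiltE s p.1 (Real.sqrt s * p.2)) := by
  have hm : Measurable (fun p : ℝ × ℝ => tiltE s p.1 (Real.sqrt s * p.2)) :=
    measurable_tiltE_comp s (by fun_prop) (by fun_prop)
  refine Measure.ext_of_lintegral _ fun φ hφ => ?_
  rw [jointLaw, lintegral_map hφ (by fun_prop), lintegral_prod _ (by fun_prop),
    lintegral_withDensity_eq_lintegral_mul _ hm hφ, lintegral_prod _ (hm.mul hφ).aemeasurable]
  refine lintegral_congr fun x => ?_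
  simp only [Pi.mul_apply]
  simp_rw [tiltE_sqrt]
  have h1 := gaussian_withDensity_tiltE 1 (Real.sqrt s * x)
  have h2 := gaussianReal_map_const_add (μ := 0) (v := 1) (Real.sqrt s * x)
  have hφx : Measurable (fun y => φ (x, y)) := hφ.comp measurable_prodMk_left
  have h3 : ∫⁻ y, φ (x, y) ∂((gaussianReal 0 1).map (Real.sqrt s * x + ·)) =
      ∫⁻ y, φ (x, y) ∂((gaussianReal 0 1).withDensity (tiltE 1 (Real.sqrt s * x))) := by
    rw [h1, h2]; simp
  rw [lintegral_map hφx (by fun_prop), lintegral_withDensity_eq_lintegral_mul _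
    (f := tiltE 1 (Real.sqrt s * x)) (measurable_tiltE_right _ _) hφx] at h3
  exact h3

/-- The output law. -/
def outLaw (s : ℝ≥0) : Measure ℝ :=
  (gaussianReal 0 1).withDensity (fun y => mixE P s (Real.sqrt s * y))

lemma measurable_mixE_sqrt (s : ℝ≥0) : Measurable (fun y => mixE P s (Real.sqrt s * y)) :=
  measurable_mixE_comp P s (by fun_prop)

lemma jointLaw_map_snd (s : ℝ≥0) : (jointLaw P s).map Prod.snd = outLaw P s := by
  have hm : Measurable (fun p : ℝ × ℝ => tiltE s p.1 (Real.sqrt s * p.2)) :=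
    measurable_tiltE_comp s (by fun_prop) (by fun_prop)
  refine Measure.ext_of_lintegral _ fun φ hφ => ?_
  have hφ2 : Measurable (fun p : ℝ × ℝ => φ p.2) := hφ.comp measurable_snd
  rw [lintegral_map hφ (by fun_prop), jointLaw_eq,
    lintegral_withDensity_eq_lintegral_mul _ hm hφ2,
    lintegral_prod_symm _ (hm.mul hφ2).aemeasurable, outLaw,
    lintegral_withDensity_eq_lintegral_mul _ (measurable_mixE_sqrt P s) hφ]
  refine lintegral_congr fun y => ?_
  simp only [Pi.mul_apply]
  rw [lintegral_mul_const _ (measurable_tiltE_left s _)]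
  rfl

lemma gaussian_map_sqrt (s : ℝ≥0) :
    (gaussianReal 0 1).map (fun y => Real.sqrt s * y) = gaussianReal 0 s := by
  rw [gaussianReal_map_const_mul, mul_zero, mul_one]
  congr 1
  ext
  simp

lemma outLaw_map (s : ℝ≥0) : (outLaw P s).map (fun y => Real.sqrt s * y) = mixLaw P s := by
  refine Measure.ext_of_lintegral _ fun φ hφ => ?_
  have hφ2 : Measurable (fun y : ℝ => φ (Real.sqrt s * y)) := hφ.comp (by fun_prop)
  rw [lintegral_map hφ (by fun_prop), outLaw,
    lintegral_withDensity_eq_lintegral_mul _ (measurable_mixE_sqrt P s) hφ2,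
    lintegral_mixLaw P s hφ, ← gaussian_map_sqrt s,
    lintegral_map (measurable_mixE_mul P s hφ) (by fun_prop)]
  rfl

instance (s : ℝ≥0) : IsProbabilityMeasure (jointLaw P s) :=
  Measure.isProbabilityMeasure_map (by fun_prop)

instance (s : ℝ≥0) : IsProbabilityMeasure (outLaw P s) := by
  rw [← jointLaw_map_snd]
  exact Measure.isProbabilityMeasure_map (by fun_prop)

/-- The density of the joint law with respect to the product. -/
def ratioE (s : ℝ≥0) (p : ℝ × ℝ) : ℝ≥0∞ :=
  tiltE s p.1 (Real.sqrt s * p.2) / mixE P s (Real.sqrt s * p.2)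

lemma measurable_ratioE (s : ℝ≥0) : Measurable (ratioE P s) :=
  (measurable_tiltE_comp s (by fun_prop) (by fun_prop)).div
    (measurable_mixE_comp P s (by fun_prop))

lemma mixE_sqrt_ae_lt_top (s : ℝ≥0) :
    ∀ᵐ y ∂(gaussianReal 0 1), mixE P s (Real.sqrt s * y) < ⊤ := by
  have := mixE_ae_lt_top P s
  rw [← gaussian_map_sqrt s] at this
  exact ae_of_ae_map (f := fun y => Real.sqrt s * y) (by fun_prop) this

lemma prod_mixE_ae_lt_top (s : ℝ≥0) :
    ∀ᵐ p ∂(P.prod (gaussianReal 0 1)), mixE P s (Real.sqrt s * p.2) < ⊤ :=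
  (Measure.quasiMeasurePreserving_snd (μ := P) (ν := gaussianReal 0 1)).ae
    (mixE_sqrt_ae_lt_top P s)

lemma jointLaw_eq_ratio (s : ℝ≥0) :
    jointLaw P s = (P.prod (outLaw P s)).withDensity (ratioE P s) := by
  have hm : Measurable (fun p : ℝ × ℝ => mixE P s (Real.sqrt s * p.2)) :=
    measurable_mixE_comp P s (by fun_prop)
  rw [outLaw, prod_withDensity_right (measurable_mixE_sqrt P s),
    ← withDensity_mul _ hm (measurable_ratioE P s), jointLaw_eq]
  refine withDensity_congr_ae ?_
  filter_upwards [prod_mixE_ae_lt_top P s] with p hp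
  simp only [Pi.mul_apply, ratioE]
  rw [ENNReal.mul_div_cancel (mixE_pos P _ _).ne' hp.ne]

lemma jointLaw_ac (s : ℝ≥0) : jointLaw P s ≪ P.prod (outLaw P s) := by
  rw [jointLaw_eq_ratio]; exact withDensity_absolutelyContinuous _ _

lemma jointLaw_ac' (s : ℝ≥0) : jointLaw P s ≪ P.prod (gaussianReal 0 1) := by
  rw [jointLaw_eq]; exact withDensity_absolutelyContinuous _ _

lemma llr_ae (s : ℝ≥0) : llr (jointLaw P s) (P.prod (outLaw P s)) =ᵐ[jointLaw P s]
    fun p => (p.1 * (Real.sqrt s * p.2) - s * p.1 ^ 2 / 2) - logMix P s (Real.sqrt s * p.2) := by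
  have h := Measure.rnDeriv_withDensity (P.prod (outLaw P s)) (measurable_ratioE P s)
  rw [← jointLaw_eq_ratio] at h
  filter_upwards [(jointLaw_ac P s).ae_le h, (jointLaw_ac' P s).ae_le (prod_mixE_ae_lt_top P s)]
    with p hp ht
  have hpos := ENNReal.toReal_pos (mixE_pos P _ _).ne' ht.ne
  rw [llr, hp, ratioE, ENNReal.toReal_div, Real.log_div _ hpos.ne', logMix]
  · congr 1
    rw [tiltE, ENNReal.toReal_ofReal (Real.exp_pos _).le, Real.log_exp]
  · exact (ENNReal.toReal_pos (tiltE_pos _ _ _).ne' (tiltE_ne_top _ _ _)).ne'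

lemma klDiv_jointLaw (hP : Integrable (fun x => x ^ 2) P) (s : ℝ≥0) :
    (klDiv (jointLaw P s) (P.prod (outLaw P s))).toReal
      = s * (∫ x, x ^ 2 ∂P) / 2 - entMix P s := by
  have hl := llr_ae P s
  have hL : MemLp (fun z : ℝ => z) 2 (gaussianReal 0 1) := memLp_id_gaussianReal 2
  have hN1 : Integrable (fun z : ℝ => z) (gaussianReal 0 1) := hL.integrable (by norm_num)
  have hX1 : Integrable (fun x : ℝ => x) P :=
    ((memLp_two_iff_integrable_sq (by fun_prop)).mpr hP).integrable (by norm_num)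
  have hg : Measurable (fun p : ℝ × ℝ => p.1 * (Real.sqrt s * p.2) - s * p.1 ^ 2 / 2) := by
    fun_prop
  have hmap : Measurable (fun p : ℝ × ℝ => (p.1, Real.sqrt s * p.1 + p.2)) := by fun_prop
  have hfun : ∀ p : ℝ × ℝ, p.1 * (Real.sqrt s * (Real.sqrt s * p.1 + p.2)) - s * p.1 ^ 2 / 2
      = s / 2 * p.1 ^ 2 + Real.sqrt s * (p.1 * p.2) := fun p => by
    have := Real.mul_self_sqrt s.coe_nonneg
    linear_combination p.1 ^ 2 * this
  have hi1 : Integrable (fun p : ℝ × ℝ => (s / 2 : ℝ) * p.1 ^ 2) (P.prod (gaussianReal 0 1)) :=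
    (hP.comp_fst _).const_mul _
  have hi2 : Integrable (fun p : ℝ × ℝ => Real.sqrt s * (p.1 * p.2))
      (P.prod (gaussianReal 0 1)) := (hX1.mul_prod hN1).const_mul _
  have hgi : Integrable (fun p : ℝ × ℝ => p.1 * (Real.sqrt s * p.2) - s * p.1 ^ 2 / 2)
      (jointLaw P s) := by
    rw [jointLaw, integrable_map_measure hg.aestronglyMeasurable hmap.aemeasurable]
    refine (hi1.add hi2).congr (ae_of_all _ fun p => ?_)
    exact (hfun p).symm
  have hgint : ∫ p, (p.1 * (Real.sqrt s * p.2) - s * p.1 ^ 2 / 2) ∂(jointLaw P s)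
      = s * (∫ x, x ^ 2 ∂P) / 2 := by
    rw [jointLaw, integral_map hmap.aemeasurable hg.aestronglyMeasurable]
    simp only [hfun]
    rw [integral_add hi1 hi2, integral_const_mul, integral_const_mul,
      integral_prod_mul (fun x : ℝ => x) (fun z : ℝ => z), integral_id_gaussianReal,
      integral_fun_fst (fun x : ℝ => x ^ 2)]
    simp
    ring
  have hcomp : (jointLaw P s).map (fun p => Real.sqrt s * p.2) = mixLaw P s := by
    rw [← outLaw_map, ← jointLaw_map_snd, Measure.map_map (by fun_prop) (by fun_prop)]
    rfl
  have hms : Measurable (fun p : ℝ × ℝ => Real.sqrt s * p.2) := by fun_prop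
  have hli : Integrable (fun p : ℝ × ℝ => logMix P s (Real.sqrt s * p.2)) (jointLaw P s) := by
    have := integrable_logMix P hP s
    rw [← hcomp] at this
    exact this.comp_measurable hms
  have hlint : ∫ p, logMix P s (Real.sqrt s * p.2) ∂(jointLaw P s) = entMix P s := by
    rw [entMix, ← hcomp, integral_map hms.aemeasurable
      (measurable_logMix P s).aestronglyMeasurable]
  have hint : Integrable (llr (jointLaw P s) (P.prod (outLaw P s))) (jointLaw P s) :=
    (hgi.sub hli).congr hl.symm
  have hval : ∫ p, llr (jointLaw P s) (P.prod (outLaw P s)) p ∂(jointLaw P s)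
      = s * (∫ x, x ^ 2 ∂P) / 2 - entMix P s := by
    rw [integral_congr_ae hl, integral_sub hgi hli, hgint, hlint]
  have hnn := InformationTheory.integral_llr_add_sub_measure_univ_nonneg (jointLaw_ac P s) hint
  simp only [probReal_univ, add_sub_cancel_right] at hnn
  rw [klDiv, if_pos ⟨jointLaw_ac P s, hint⟩, ENNReal.toReal_ofReal hnn, hval]

end

/-- **Concavity of mutual information in SNR** (Corollary 1): for the scalar Gaussian channel
`Y = √snr · X + N` with `E[X²] < ∞`, `snr ↦ I(snr)` is concave on `[0, ∞)`. -/
theorem concaveOn_mutualInfo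
    {Ω : Type*} [MeasurableSpace Ω] (μ : Measure Ω) [IsProbabilityMeasure μ]
    (X N : Ω → ℝ) (hX : Measurable X) (hN : Measurable N)
    (hXN : IndepFun X N μ)
    (hN_law : μ.map N = gaussianReal 0 1)
    (hX2 : Integrable (fun ω => X ω ^ 2) μ) :
    ConcaveOn ℝ (Set.Ici 0)
      (fun snr : ℝ => (mutualInfo μ X (fun ω => Real.sqrt snr * X ω + N ω)).toReal) := by
  set P := μ.map X with hPdef
  have hPp : IsProbabilityMeasure P := Measure.isProbabilityMeasure_map hX.aemeasurable
  have hP : Integrable (fun x => x ^ 2) P := by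
    rw [hPdef, integrable_map_measure (by fun_prop) hX.aemeasurable]
    exact hX2
  have hI : ∀ s : ℝ≥0, (mutualInfo μ X (fun ω => Real.sqrt s * X ω + N ω)).toReal
      = s * (∫ x, x ^ 2 ∂P) / 2 - entMix P s := by
    intro s
    have hprod := (indepFun_iff_map_prod_eq_prod_map_map hX.aemeasurable hN.aemeasurable).mp hXN
    rw [hN_law, ← hPdef] at hprod
    have hJ : μ.map (fun ω => (X ω, Real.sqrt s * X ω + N ω)) = jointLaw P s := by
      rw [jointLaw, ← hprod, Measure.map_map (by fun_prop) (by fun_prop)]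
      rfl
    have hO : μ.map (fun ω => Real.sqrt s * X ω + N ω) = outLaw P s := by
      rw [← jointLaw_map_snd, ← hJ, Measure.map_map (by fun_prop) (by fun_prop)]
      rfl
    rw [mutualInfo, hJ, hO]
    exact klDiv_jointLaw P hP s
  refine concaveOn_of_midpoint (fun x => ENNReal.toReal_nonneg) fun a b ha hb => ?_
  lift a to ℝ≥0 using ha
  lift b to ℝ≥0 using hb
  have e1 : (a : ℝ) + 2 * b = ((a + b + b : ℝ≥0) : ℝ) := by push_cast; ring
  have e2 : (a : ℝ) + b = ((a + b : ℝ≥0) : ℝ) := by push_cast; ring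
  rw [e1, e2]
  simp only [hI]
  have := entMix_submodular P hP a b b
  push_cast
  linarith
end
end

section
/- For every probability distribution of X with E[X^2] < ∞ and every snr > 0, the mutual information is sandwiched as mmse(snr) ≤ (2/snr) · I(snr) ≤ Var(X), where Var(X) = mmse(0) is the variance of X. -/
open MeasureTheory ProbabilityTheory Real Filter
open scoped ENNReal NNReal Topology

noncomputable section

/-- Output `Y = √snr · X + N` of the scalar Gaussian channel at signal-to-noise ratio `snr`. -/
def chOut {Ω : Type*} (X N : Ω → ℝ) (snr : ℝ) : Ω → ℝ := fun ω => Real.sqrt snr * X ω + N ω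

/-- Minimum mean-square error `E[(X - E[X | Y])²]` of estimating `X` given `Y`. -/
def mmse {Ω : Type*} [MeasurableSpace Ω] (μ : Measure Ω) (X Y : Ω → ℝ) : ℝ :=
  ∫ ω, (X ω - (μ[X | MeasurableSpace.comap Y inferInstance]) ω) ^ 2 ∂μ

lemma cdf_density_sub {f : ℝ → ℝ} (hf : Continuous f) (hpos : ∀ x, 0 < f x)
    (ν : Measure ℝ) [IsProbabilityMeasure ν]
    (hν : ν = volume.withDensity (fun x => ENNReal.ofReal (f x))) {a b : ℝ} (hab : a ≤ b) :
    cdf ν b - cdf ν a = ∫ x in a..b, f x := by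
  have h1 : ν.real (Set.Ioc a b) = ∫ x in a..b, f x := by
    rw [intervalIntegral.integral_of_le hab, Measure.real, hν,
      withDensity_apply _ measurableSet_Ioc,
      integral_eq_lintegral_of_nonneg_ae (Eventually.of_forall fun x => (hpos x).le)
        hf.aestronglyMeasurable]
  have h2 : Set.Ioc a b = Set.Iic b \ Set.Iic a := by
    ext z; simp [and_comm]
  rw [← h1, cdf_eq_real, cdf_eq_real, h2,
    measureReal_sdiff (Set.Iic_subset_Iic.2 hab) measurableSet_Iic]

lemma cdf_density_hasDerivAt {f : ℝ → ℝ} (hf : Continuous f) (hpos : ∀ x, 0 < f x)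
    (ν : Measure ℝ) [IsProbabilityMeasure ν]
    (hν : ν = volume.withDensity (fun x => ENNReal.ofReal (f x))) (y : ℝ) :
    HasDerivAt (cdf ν) (f y) y := by
  have h : ∀ x, cdf ν x = cdf ν 0 + ∫ t in (0:ℝ)..x, f t := by
    intro x
    rcases le_total 0 x with hx | hx
    · rw [← cdf_density_sub hf hpos ν hν hx]; ring
    · rw [intervalIntegral.integral_symm, ← cdf_density_sub hf hpos ν hν hx]; ring
  have h2 : (cdf ν : ℝ → ℝ) = fun x => cdf ν 0 + ∫ t in (0:ℝ)..x, f t := funext h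
  rw [h2]
  exact (hf.integral_hasStrictDerivAt 0 y).hasDerivAt.const_add _

lemma cdf_density_strictMono {f : ℝ → ℝ} (hf : Continuous f) (hpos : ∀ x, 0 < f x)
    (ν : Measure ℝ) [IsProbabilityMeasure ν]
    (hν : ν = volume.withDensity (fun x => ENNReal.ofReal (f x))) :
    StrictMono (cdf ν) :=
  strictMono_of_hasDerivAt_pos (fun x => cdf_density_hasDerivAt hf hpos ν hν x) hpos

lemma cdf_density_surj {f g : ℝ → ℝ} (hf : Continuous f) (hfpos : ∀ x, 0 < f x)
    (hg : Continuous g) (hgpos : ∀ x, 0 < g x)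
    (ν ρ : Measure ℝ) [IsProbabilityMeasure ν] [IsProbabilityMeasure ρ]
    (hν : ν = volume.withDensity (fun x => ENNReal.ofReal (f x)))
    (hρ : ρ = volume.withDensity (fun x => ENNReal.ofReal (g x))) (y : ℝ) :
    ∃ t, cdf ρ t = cdf ν y := by
  have hm := cdf_density_strictMono hf hfpos ν hν
  have h0 : 0 < cdf ν y := (cdf_nonneg ν (y-1)).trans_lt (hm (by linarith))
  have h1 : cdf ν y < 1 := (hm (by linarith : y < y + 1)).trans_le (cdf_le_one ν _)
  have hc : Continuous (cdf ρ) := continuous_iff_continuousAt.2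
    fun x => (cdf_density_hasDerivAt hg hgpos ρ hρ x).continuousAt
  obtain ⟨a, ha⟩ := ((tendsto_cdf_atBot ρ).eventually_lt_const h0).exists
  obtain ⟨b, hb⟩ := ((tendsto_cdf_atTop ρ).eventually_const_lt h1).exists
  exact mem_range_of_exists_le_of_exists_ge hc ⟨a, ha.le⟩ ⟨b, hb.le⟩

lemma exists_transport {f g : ℝ → ℝ} (hf : Continuous f) (hfpos : ∀ x, 0 < f x)
    (hg : Continuous g) (hgpos : ∀ x, 0 < g x)
    (ν ρ : Measure ℝ) [IsProbabilityMeasure ν] [IsProbabilityMeasure ρ]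
    (hν : ν = volume.withDensity (fun x => ENNReal.ofReal (f x)))
    (hρ : ρ = volume.withDensity (fun x => ENNReal.ofReal (g x))) :
    ∃ T : ℝ → ℝ, Continuous T ∧ (∀ y, HasDerivAt T (f y / g (T y)) y) ∧ ν.map T = ρ := by
  choose T hT using cdf_density_surj hf hfpos hg hgpos ν ρ hν hρ
  have hmf := cdf_density_strictMono hf hfpos ν hν
  have hmg := cdf_density_strictMono hg hgpos ρ hρ
  have hTm : StrictMono T := by
    intro a b hab
    rw [← hmg.lt_iff_lt, hT, hT]
    exact hmf hab
  have hTs : Function.Surjective T := by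
    intro t
    obtain ⟨y, hy⟩ := cdf_density_surj hg hgpos hf hfpos ρ ν hρ hν t
    exact ⟨y, hmg.injective (by rw [hT, hy])⟩
  have hTc : Continuous T := hTm.monotone.continuous_of_surjective hTs
  refine ⟨T, hTc, fun y => ?_, ?_⟩
  · have hF := cdf_density_hasDerivAt hf hfpos ν hν y
    have hG := cdf_density_hasDerivAt hg hgpos ρ hρ (T y)
    rw [hasDerivAt_iff_tendsto_slope] at hF hG ⊢
    have hTt : Tendsto T (𝓝[≠] y) (𝓝[≠] (T y)) :=
      tendsto_nhdsWithin_iff.2 ⟨hTc.continuousAt.mono_left nhdsWithin_le_nhds, by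
        filter_upwards [self_mem_nhdsWithin] with z hz
        exact fun h => hz (hTm.injective h)⟩
    have := hF.div (hG.comp hTt) (hgpos _).ne'
    refine this.congr' ?_
    filter_upwards [self_mem_nhdsWithin] with z hz
    have hz1 : z - y ≠ 0 := sub_ne_zero.2 hz
    have hz2 : T z - T y ≠ 0 := sub_ne_zero.2 fun h => hz (hTm.injective h)
    have hz3 : cdf ν z - cdf ν y ≠ 0 := sub_ne_zero.2 fun h => hz (hmf.injective h)
    simp only [Pi.div_apply, Function.comp, slope_def_field, hT]
    field_simp
  · have : IsProbabilityMeasure (ν.map T) := Measure.isProbabilityMeasure_map hTc.aemeasurable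
    refine Measure.ext_of_Iic _ _ fun t => ?_
    obtain ⟨y, rfl⟩ := hTs t
    rw [Measure.map_apply hTc.measurable measurableSet_Iic]
    have : T ⁻¹' Set.Iic (T y) = Set.Iic y := by
      ext z; simp [hTm.le_iff_le]
    rw [this, ← ofReal_cdf, ← ofReal_cdf, hT]

def gphi (x : ℝ) : ℝ := (√(2 * π))⁻¹ * rexp (-x ^ 2 / 2)

lemma gphi_pos (x : ℝ) : 0 < gphi x := by unfold gphi; positivity

lemma gphi_continuous : Continuous gphi := by unfold gphi; fun_prop

lemma gphi_le (x : ℝ) : gphi x ≤ (√(2 * π))⁻¹ := by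
  unfold gphi
  have : rexp (-x ^ 2 / 2) ≤ 1 := Real.exp_le_one_iff.2 (by nlinarith [sq_nonneg x])
  have h2 : 0 ≤ (√(2 * π))⁻¹ := by positivity
  nlinarith

lemma gaussian_eq : gaussianReal 0 1 = volume.withDensity (fun x => ENNReal.ofReal (gphi x)) := by
  rw [gaussianReal_of_var_ne_zero _ one_ne_zero]
  congr 1
  ext x
  simp [gaussianPDF, gaussianPDFReal, gphi]

lemma log_gphi (x : ℝ) : Real.log (gphi x) = Real.log (√(2 * π))⁻¹ - x ^ 2 / 2 := by
  unfold gphi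
  rw [Real.log_mul (by positivity) (by positivity), Real.log_exp]; ring

lemma gphi_hasDerivAt (x : ℝ) : HasDerivAt gphi (-(x * gphi x)) x := by
  have h : HasDerivAt (fun x : ℝ => -x ^ 2 / 2) (-x) x := by
    have := ((hasDerivAt_pow 2 x).neg).div_const 2
    refine this.congr_deriv ?_
    simp
    ring
  have := (h.exp).const_mul ((√(2 * π))⁻¹)
  refine this.congr_deriv ?_
  unfold gphi; ring

lemma gphi_neg (x : ℝ) : gphi (-x) = gphi x := by simp [gphi]

lemma gphi_tendsto : Tendsto gphi atTop (𝓝 0) := by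
  have h : Tendsto (fun x : ℝ => -x ^ 2 / 2) atTop atBot := by
    have : Tendsto (fun x : ℝ => x ^ 2 / 2) atTop atTop :=
      (tendsto_pow_atTop two_ne_zero).atTop_div_const two_pos
    refine (tendsto_neg_atTop_atBot.comp this).congr fun x => by simp; ring
  have := (Real.tendsto_exp_atBot.comp h).const_mul ((√(2 * π))⁻¹)
  rw [mul_zero] at this
  exact this

lemma gphi_tail (u : ℝ) (hu : 0 ≤ u) :
    ∫⁻ n in Set.Ioi u, ENNReal.ofReal (n * gphi n) = ENNReal.ofReal (gphi u) := by
  have hd : ∀ x ∈ Set.Ioi u, HasDerivAt (fun x => - gphi x) (x * gphi x) x := by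
    intro x _
    exact (gphi_hasDerivAt x).neg.congr_deriv (neg_neg _)
  have hnn : ∀ x ∈ Set.Ioi u, 0 ≤ x * gphi x := fun x hx =>
    mul_nonneg (hu.trans (le_of_lt hx)) (gphi_pos x).le
  have ht : Tendsto (fun x => - gphi x) atTop (𝓝 (-0)) := gphi_tendsto.neg
  have hc : ContinuousWithinAt (fun x => - gphi x) (Set.Ici u) u :=
    gphi_continuous.neg.continuousWithinAt
  have hi := integrableOn_Ioi_deriv_of_nonneg hc hd hnn ht
  have he := integral_Ioi_of_hasDerivAt_of_tendsto hc hd hi ht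
  rw [← ofReal_integral_eq_lintegral_ofReal hi
    ((ae_restrict_iff' measurableSet_Ioi).2 (Eventually.of_forall hnn)), he]
  simp

lemma stein_half {T D : ℝ → ℝ} (hD : Continuous D) (hD0 : ∀ x, 0 ≤ D x)
    (hT : ∀ x, HasDerivAt T (D x) x) :
    ∫⁻ u in Set.Ioi 0, ENNReal.ofReal (D u * gphi u)
      = ∫⁻ n in Set.Ioi 0, ENNReal.ofReal (n * (T n - T 0) * gphi n) := by
  have h1 : ∀ n ∈ Set.Ioi (0:ℝ), ENNReal.ofReal (n * (T n - T 0) * gphi n)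
      = ∫⁻ u in Set.Ioi 0, (Set.Iio n).indicator
        (fun u => ENNReal.ofReal (D u) * ENNReal.ofReal (n * gphi n)) u := by
    intro n hn
    have hn' : (0:ℝ) < n := hn
    have h := intervalIntegral.integral_eq_sub_of_hasDerivAt (a := 0) (b := n)
      (fun x _ => hT x) (hD.intervalIntegrable _ _)
    rw [lintegral_indicator measurableSet_Iio, Measure.restrict_restrict measurableSet_Iio,
      Set.inter_comm, Set.Ioi_inter_Iio,
      lintegral_mul_const _ (by fun_prop), restrict_Ioo_eq_restrict_Ioc,
      ← ofReal_integral_eq_lintegral_ofReal (hD.integrableOn_Ioc)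
        (Eventually.of_forall hD0), ← intervalIntegral.integral_of_le hn'.le, h,
      ← ENNReal.ofReal_mul' (mul_nonneg hn'.le (gphi_pos n).le)]
    congr 1; ring
  have h2 : ∀ u ∈ Set.Ioi (0:ℝ), ENNReal.ofReal (D u * gphi u)
      = ∫⁻ n in Set.Ioi 0, (Set.Iio n).indicator
        (fun u => ENNReal.ofReal (D u) * ENNReal.ofReal (n * gphi n)) u := by
    intro u hu
    have hu' : (0:ℝ) < u := hu
    have : ∀ n, (Set.Iio n).indicator
        (fun u => ENNReal.ofReal (D u) * ENNReal.ofReal (n * gphi n)) u =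
        (Set.Ioi u).indicator (fun n => ENNReal.ofReal (D u) * ENNReal.ofReal (n * gphi n)) n := by
      intro n; simp [Set.indicator]
    simp_rw [this]
    rw [lintegral_indicator measurableSet_Ioi, Measure.restrict_restrict measurableSet_Ioi,
      Set.Ioi_inter_Ioi, max_eq_left hu'.le, lintegral_const_mul _ 
        (by have := gphi_continuous; fun_prop), gphi_tail u hu'.le, ENNReal.ofReal_mul (hD0 u)]
  rw [setLIntegral_congr_fun measurableSet_Ioi h1, setLIntegral_congr_fun measurableSet_Ioi h2]
  apply lintegral_lintegral_swap
  apply Measurable.aemeasurable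
  have : (Function.uncurry fun u n => (Set.Iio n).indicator
        (fun u => ENNReal.ofReal (D u) * ENNReal.ofReal (n * gphi n)) u) =
      {p : ℝ × ℝ | p.1 < p.2}.indicator
        (fun p => ENNReal.ofReal (D p.1) * ENNReal.ofReal (p.2 * gphi p.2)) := by
    ext ⟨u, n⟩; simp [Set.indicator]
  rw [this]
  refine Measurable.indicator ?_ (measurableSet_lt measurable_fst measurable_snd)
  have := gphi_continuous.measurable
  have := hD.measurable
  fun_prop

lemma stein_full {T D : ℝ → ℝ} (hD : Continuous D) (hD0 : ∀ x, 0 ≤ D x)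
    (hT : ∀ x, HasDerivAt T (D x) x) :
    ∫⁻ u, ENNReal.ofReal (D u * gphi u)
      = ∫⁻ n, ENNReal.ofReal (n * (T n - T 0) * gphi n) := by
  have h1 := stein_half hD hD0 hT
  have h2 := stein_half (T := fun y => - T (-y)) (D := fun y => D (-y))
    (by fun_prop) (fun x => hD0 _) (fun x => by
      have := ((hT (-x)).comp x (hasDerivAt_neg x)).neg
      exact this.congr_deriv (by ring))
  have hr : ∀ F : ℝ → ℝ≥0∞, ∫⁻ u in Set.Ioi 0, F (-u) = ∫⁻ u in Set.Iic 0, F u := by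
    intro F
    have := (Measure.measurePreserving_neg (volume : Measure ℝ)).setLIntegral_comp_preimage_emb
      (Homeomorph.neg ℝ).measurableEmbedding F (Set.Iio 0)
    rw [restrict_Iio_eq_restrict_Iic] at this
    rw [← this]
    simp
  rw [← lintegral_add_compl _ (measurableSet_Ioi (a := (0:ℝ))),
    ← lintegral_add_compl (fun n => ENNReal.ofReal (n * (T n - T 0) * gphi n))
      (measurableSet_Ioi (a := (0:ℝ))), h1]
  congr 1
  rw [Set.compl_Ioi, ← hr, ← hr]
  simp only [gphi_neg] at h2 ⊢
  rw [h2]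
  refine lintegral_congr fun n => ?_
  congr 1
  simp; ring

lemma stein_gauss {T D : ℝ → ℝ} (hD : Continuous D) (hD0 : ∀ x, 0 ≤ D x)
    (hT : ∀ x, HasDerivAt T (D x) x) 
    (hi : Integrable (fun n => n * T n) (gaussianReal 0 1)) :
    ∫⁻ u, ENNReal.ofReal (D u) ∂(gaussianReal 0 1)
      = ENNReal.ofReal (∫ n, n * T n ∂(gaussianReal 0 1)) ∧
      0 ≤ ∫ n, n * T n ∂(gaussianReal 0 1) := by
  have hTc : Continuous T := continuous_iff_continuousAt.2 fun x => (hT x).continuousAt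
  have hTm : Monotone T := monotone_of_hasDerivAt_nonneg hT hD0
  have hid : Integrable (fun n : ℝ => n) (gaussianReal 0 1) :=
    (memLp_id_gaussianReal 1).integrable (by simp)
  have hi2 : Integrable (fun n => n * (T n - T 0)) (gaussianReal 0 1) := by
    refine (hi.sub (hid.mul_const (T 0))).congr (Eventually.of_forall fun n => ?_)
    simp; ring
  have he : ∫ n, n * T n ∂(gaussianReal 0 1) = ∫ n, n * (T n - T 0) ∂(gaussianReal 0 1) := by
    simp_rw [mul_sub]
    rw [integral_sub hi (hid.mul_const (T 0)), integral_mul_const]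
    have : ∫ n : ℝ, n ∂(gaussianReal 0 1) = 0 := integral_id_gaussianReal
    rw [this]; simp
  have hnn : ∀ n, 0 ≤ n * (T n - T 0) := by
    intro n
    rcases le_total 0 n with h | h
    · exact mul_nonneg h (sub_nonneg.2 (hTm h))
    · exact mul_nonneg_of_nonpos_of_nonpos h (sub_nonpos.2 (hTm h))
  rw [he]
  refine ⟨?_, integral_nonneg hnn⟩
  rw [ofReal_integral_eq_lintegral_ofReal hi2 (Eventually.of_forall hnn), gaussian_eq]
  have hg := gphi_continuous.measurable
  rw [lintegral_withDensity_eq_lintegral_mul _ (by fun_prop) (by fun_prop),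
    lintegral_withDensity_eq_lintegral_mul _ (by fun_prop) (by fun_prop)]
  simp only [Pi.mul_apply]
  simp_rw [← ENNReal.ofReal_mul (gphi_pos _).le]
  simp_rw [mul_comm (gphi _)]
  exact stein_full hD hD0 hT

/-- density of the channel output -/
def outDens (P : Measure ℝ) (s y : ℝ) : ℝ := ∫ x, gphi (y - s * x) ∂P

lemma gphi_shift_integrable (P : Measure ℝ) [IsProbabilityMeasure P] (s y : ℝ) :
    Integrable (fun x => gphi (y - s * x)) P := by
  refine Integrable.of_bound (C := (√(2 * π))⁻¹) ?_ (Eventually.of_forall fun x => ?_)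
  · have := gphi_continuous
    exact Continuous.aestronglyMeasurable (by fun_prop)
  · rw [Real.norm_of_nonneg (gphi_pos _).le]; exact gphi_le _

lemma outDens_pos (P : Measure ℝ) [IsProbabilityMeasure P] (s y : ℝ) : 0 < outDens P s y := by
  unfold outDens
  rw [integral_pos_iff_support_of_nonneg (fun x => (gphi_pos _).le) (gphi_shift_integrable P s y)]
  have : Function.support (fun x => gphi (y - s * x)) = Set.univ := by
    ext x; simp [(gphi_pos _).ne']
  rw [this]; simp

lemma outDens_le (P : Measure ℝ) [IsProbabilityMeasure P] (s y : ℝ) :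
    outDens P s y ≤ (√(2 * π))⁻¹ := by
  unfold outDens
  refine (integral_mono (gphi_shift_integrable P s y) (integrable_const ((√(2 * π))⁻¹))
    (fun x => gphi_le _)).trans ?_
  simp

lemma outDens_continuous (P : Measure ℝ) [IsProbabilityMeasure P] (s : ℝ) :
    Continuous (outDens P s) := by
  have := gphi_continuous
  refine continuous_of_dominated (bound := fun _ => (√(2 * π))⁻¹) (fun y => ?_) (fun y => ?_)
    (integrable_const _) ?_
  · exact Continuous.aestronglyMeasurable (by fun_prop)
  · refine Eventually.of_forall fun x => ?_
    rw [Real.norm_of_nonneg (gphi_pos _).le]; exact gphi_le _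
  · exact Eventually.of_forall fun x => by fun_prop

lemma outDens_log_ge (P : Measure ℝ) [IsProbabilityMeasure P] (s y : ℝ)
    (hi : Integrable (fun x => (y - s * x) ^ 2) P) :
    Real.log (√(2 * π))⁻¹ - (∫ x, (y - s * x) ^ 2 ∂P) / 2 ≤ Real.log (outDens P s y) := by
  set m := (∫ x, (y - s * x) ^ 2 ∂P) / 2 with hm
  rw [Real.le_log_iff_exp_le (outDens_pos P s y), sub_eq_add_neg, Real.exp_add,
    Real.exp_log (by positivity)]
  have h : ∀ x, (√(2 * π))⁻¹ * rexp (-m) * (1 + m - (y - s * x) ^ 2 / 2) ≤ gphi (y - s * x) := by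
    intro x
    unfold gphi
    have := Real.add_one_le_exp (m - (y - s * x) ^ 2 / 2)
    have h2 : rexp (-(y - s * x) ^ 2 / 2) = rexp (-m) * rexp (m - (y - s * x) ^ 2 / 2) := by
      rw [← Real.exp_add]; congr 1; ring
    rw [h2, ← mul_assoc]
    refine mul_le_mul_of_nonneg_left (by linarith) (by positivity)
  have h3 : Integrable (fun x => 1 + m - (y - s * x) ^ 2 / 2) P :=
    (integrable_const _).sub (hi.div_const 2)
  have := integral_mono (h3.const_mul ((√(2 * π))⁻¹ * rexp (-m))) (gphi_shift_integrable P s y) h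
  rw [integral_const_mul, integral_sub (integrable_const _) (hi.div_const 2), integral_div, ← hm]
    at this
  simpa [outDens] using this

lemma joint_eq (P : Measure ℝ) [IsProbabilityMeasure P] (s : ℝ) :
    (P.prod (gaussianReal 0 1)).map (fun z => (z.1, s * z.1 + z.2))
      = (P.prod volume).withDensity (fun z => ENNReal.ofReal (gphi (z.2 - s * z.1))) := by
  have hg := gphi_continuous.measurable
  refine Measure.ext_of_lintegral _ fun f hf => ?_
  rw [lintegral_map hf (by fun_prop), lintegral_prod _ (by fun_prop),
    lintegral_withDensity_eq_lintegral_mul _ (by fun_prop) hf, lintegral_prod _ (by fun_prop)]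
  refine lintegral_congr fun x => ?_
  rw [gaussian_eq, lintegral_withDensity_eq_lintegral_mul _ (by fun_prop) (by fun_prop)]
  symm
  rw [← lintegral_add_left_eq_self _ (s * x)]
  simp

lemma out_eq (P : Measure ℝ) [IsProbabilityMeasure P] (s : ℝ) :
    (P.prod (gaussianReal 0 1)).map (fun z => s * z.1 + z.2)
      = volume.withDensity (fun y => ENNReal.ofReal (outDens P s y)) := by
  have hg := gphi_continuous.measurable
  have hp := (outDens_continuous P s).measurable
  have : (fun z : ℝ × ℝ => s * z.1 + z.2) = Prod.snd ∘ (fun z => (z.1, s * z.1 + z.2)) := by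
    ext z; simp
  rw [this, ← Measure.map_map measurable_snd (by fun_prop), joint_eq]
  refine Measure.ext_of_lintegral _ fun f hf => ?_
  rw [lintegral_map hf measurable_snd, lintegral_withDensity_eq_lintegral_mul _ (by fun_prop)
    (by fun_prop), lintegral_withDensity_eq_lintegral_mul _ (by fun_prop) (by fun_prop),
    lintegral_prod_symm _ (by fun_prop)]
  refine lintegral_congr fun y => ?_
  simp only [Pi.mul_apply]
  rw [lintegral_mul_const _ (by fun_prop), outDens,
    ofReal_integral_eq_lintegral_ofReal (gphi_shift_integrable P s y)
      (Eventually.of_forall fun x => (gphi_pos _).le)]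

lemma joint_eq_density (P ν : Measure ℝ) [IsProbabilityMeasure P] (s : ℝ)
    (hν : ν = volume.withDensity (fun y => ENNReal.ofReal (outDens P s y))) :
    (P.prod volume).withDensity (fun z => ENNReal.ofReal (gphi (z.2 - s * z.1)))
     = (P.prod ν).withDensity
      (fun z => ENNReal.ofReal (gphi (z.2 - s * z.1) / outDens P s z.2)) := by
  have hg := gphi_continuous.measurable
  have hp := (outDens_continuous P s).measurable
  rw [hν, prod_withDensity_right (by fun_prop), ← withDensity_mul _ (by fun_prop) (by fun_prop)]
  congr 1
  ext z
  simp only [Pi.mul_apply]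
  rw [← ENNReal.ofReal_mul (outDens_pos P s _).le, mul_div_cancel₀ _ (outDens_pos P s _).ne']

lemma llr_withDensity_ae {α : Type*} [MeasurableSpace α] (Q : Measure α) [IsProbabilityMeasure Q]
    (r : α → ℝ) (hr : Measurable r) (hr0 : ∀ x, 0 < r x) :
    llr (Q.withDensity fun x => ENNReal.ofReal (r x)) Q
      =ᵐ[Q.withDensity fun x => ENNReal.ofReal (r x)] fun x => Real.log (r x) := by
  have h := Measure.rnDeriv_withDensity Q (f := fun x => ENNReal.ofReal (r x)) (by fun_prop)
  filter_upwards [(withDensity_absolutelyContinuous Q _).ae_le h] with x hx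
  rw [llr, hx, ENNReal.toReal_ofReal (hr0 x).le]

/-- The conditional expectation minimises the mean-square error. -/
lemma condExp_min {Ω : Type*} [mΩ : MeasurableSpace Ω] (μ : Measure Ω) [IsProbabilityMeasure μ]
    (m : MeasurableSpace Ω) (hm : m ≤ mΩ) (X G : Ω → ℝ) (hX : MemLp X 2 μ) (hG : MemLp G 2 μ)
    (hGm : StronglyMeasurable[m] G) :
    ∫ ω, (X ω - (μ[X | m]) ω) ^ 2 ∂μ ≤ ∫ ω, (X ω - G ω) ^ 2 ∂μ := by
  have hZ : MemLp (μ[X | m]) 2 μ := hX.condExp (by norm_num)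
  set Z := μ[X | m] with hZd
  have hH : MemLp (Z - G) 2 μ := hZ.sub hG
  have hHm : StronglyMeasurable[m] (Z - G) := stronglyMeasurable_condExp.sub hGm
  have hXi : Integrable X μ := hX.integrable (by norm_num)
  have hHX : Integrable ((Z - G) * X) μ := hH.integrable_mul hX
  have hHZ : Integrable ((Z - G) * Z) μ := hH.integrable_mul hZ
  have h1 : ∫ ω, ((Z - G) * X) ω ∂μ = ∫ ω, ((Z - G) * Z) ω ∂μ := by
    rw [← integral_condExp hm]
    exact integral_congr_ae (condExp_mul_of_stronglyMeasurable_left hHm hHX hXi)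
  have h2 : ∫ ω, ((X - Z) ^ 2 + (Z - G) ^ 2) ω ∂μ + 2 * (∫ ω, ((Z - G) * X) ω ∂μ
      - ∫ ω, ((Z - G) * Z) ω ∂μ) = ∫ ω, (X ω - G ω) ^ 2 ∂μ := by
    have e1 : Integrable (fun ω => ((X - Z) ^ 2 + (Z - G) ^ 2) ω) μ :=
      (hX.sub hZ).integrable_sq.add hH.integrable_sq
    have e2 : Integrable (fun ω => 2 * (((Z - G) * X) ω - ((Z - G) * Z) ω)) μ :=
      (hHX.sub hHZ).const_mul 2
    rw [← integral_sub hHX hHZ, ← integral_const_mul, ← integral_add e1 e2]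
    refine integral_congr_ae (Eventually.of_forall fun ω => ?_)
    simp; ring
  rw [← h2, h1, sub_self, mul_zero, add_zero]
  refine integral_mono (hX.sub hZ).integrable_sq
    ((hX.sub hZ).integrable_sq.add hH.integrable_sq) fun ω => ?_
  simp; positivity

lemma stein_chan (P : Measure ℝ) [IsProbabilityMeasure P] (s : ℝ) {T D : ℝ → ℝ}
    (hD : Continuous D) (hD0 : ∀ x, 0 ≤ D x) (hT : ∀ x, HasDerivAt T (D x) x)
    (hi : Integrable (fun z : ℝ × ℝ => z.2 * T (s * z.1 + z.2)) (P.prod (gaussianReal 0 1))) :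
    ∫⁻ z, ENNReal.ofReal (D (s * z.1 + z.2)) ∂(P.prod (gaussianReal 0 1))
      = ENNReal.ofReal (∫ z, z.2 * T (s * z.1 + z.2) ∂(P.prod (gaussianReal 0 1))) ∧
    0 ≤ ∫ z, z.2 * T (s * z.1 + z.2) ∂(P.prod (gaussianReal 0 1)) := by
  have key : ∀ᵐ x ∂P, ∫⁻ u, ENNReal.ofReal (D (s * x + u)) ∂(gaussianReal 0 1)
      = ENNReal.ofReal (∫ n, n * T (s * x + n) ∂(gaussianReal 0 1)) ∧
      0 ≤ ∫ n, n * T (s * x + n) ∂(gaussianReal 0 1) := by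
    filter_upwards [hi.prod_right_ae] with x hx
    refine stein_gauss (T := fun n => T (s * x + n)) (D := fun n => D (s * x + n))
      (by fun_prop) (fun _ => hD0 _) (fun u => ?_) hx
    exact (hT (s * x + u)).comp_const_add (s * x) u
  rw [integral_prod _ hi]
  refine ⟨?_, integral_nonneg_of_ae (key.mono fun x hx => hx.2)⟩
  rw [lintegral_prod _ (by have := hD.measurable; fun_prop), ofReal_integral_eq_lintegral_ofReal hi.integral_prod_left
    (key.mono fun x hx => hx.2)]
  exact lintegral_congr_ae (key.mono fun x hx => hx.1)

section core
variable {Ω : Type*} [MeasurableSpace Ω] (μ : Measure Ω) [IsProbabilityMeasure μ]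
    (X N : Ω → ℝ) (s : ℝ)

lemma memLp_N (hN : Measurable N) (hN_law : μ.map N = gaussianReal 0 1) : MemLp N 2 μ := by
  have h := memLp_id_gaussianReal (μ := 0) (v := 1) 2
  rw [← hN_law] at h
  simpa using (memLp_map_measure_iff (by fun_prop) hN.aemeasurable).1 h

lemma integral_N (hN : Measurable N) (hN_law : μ.map N = gaussianReal 0 1) :
    ∫ ω, N ω ∂μ = 0 := by
  have h : ∫ x, x ∂(gaussianReal 0 1) = 0 := integral_id_gaussianReal
  rw [← hN_law, integral_map hN.aemeasurable (by fun_prop)] at h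
  exact h

lemma integral_sq_gauss : ∫ x, x ^ 2 ∂(gaussianReal 0 1) = 1 := by
  have h := variance_id_gaussianReal (μ := 0) (v := 1)
  rw [variance_eq_integral (by fun_prop)] at h
  simpa using h

lemma integral_sq_map {W : Ω → ℝ} (hW : Measurable W) (hl : μ.map W = gaussianReal 0 1) :
    ∫ ω, W ω ^ 2 ∂μ = 1 := by
  have h := integral_sq_gauss
  rw [← hl, integral_map hW.aemeasurable (by fun_prop)] at h
  exact h

lemma memLp_X (hX : Measurable X) (hX2 : Integrable (fun ω => X ω ^ 2) μ) : MemLp X 2 μ :=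
  (memLp_two_iff_integrable_sq hX.aestronglyMeasurable).2 hX2

lemma map_pair (hX : Measurable X) (hN : Measurable N) (hXN : IndepFun X N μ)
    (hN_law : μ.map N = gaussianReal 0 1) :
    μ.map (fun ω => (X ω, N ω)) = (μ.map X).prod (gaussianReal 0 1) := by
  rw [(indepFun_iff_map_prod_eq_prod_map_map hX.aemeasurable hN.aemeasurable).1 hXN, hN_law]

lemma map_out (hX : Measurable X) (hN : Measurable N) (hXN : IndepFun X N μ)
    (hN_law : μ.map N = gaussianReal 0 1) :
    μ.map (fun ω => s * X ω + N ω)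
      = volume.withDensity (fun y => ENNReal.ofReal (outDens (μ.map X) s y)) := by
  have := Measure.isProbabilityMeasure_map (μ := μ) hX.aemeasurable
  rw [← out_eq, ← map_pair μ X N hX hN hXN hN_law, Measure.map_map (by fun_prop) (by fun_prop)]
  rfl

lemma map_joint (hX : Measurable X) (hN : Measurable N) (hXN : IndepFun X N μ)
    (hN_law : μ.map N = gaussianReal 0 1) :
    μ.map (fun ω => (X ω, s * X ω + N ω))
      = ((μ.map X).prod (μ.map (fun ω => s * X ω + N ω))).withDensity
        (fun z => ENNReal.ofReal (gphi (z.2 - s * z.1) / outDens (μ.map X) s z.2)) := by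
  have := Measure.isProbabilityMeasure_map (μ := μ) hX.aemeasurable
  rw [← joint_eq_density _ _ _ (map_out μ X N s hX hN hXN hN_law), ← joint_eq,
    ← map_pair μ X N hX hN hXN hN_law, Measure.map_map (by fun_prop) (by fun_prop)]
  rfl

lemma integrable_logOut (hX : Measurable X) (hN : Measurable N) 
    (hN_law : μ.map N = gaussianReal 0 1) (hX2 : Integrable (fun ω => X ω ^ 2) μ) :
    Integrable (fun ω => Real.log (outDens (μ.map X) s (s * X ω + N ω))) μ := by
  have hP := Measure.isProbabilityMeasure_map (μ := μ) hX.aemeasurable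
  have hLX := memLp_X μ X hX hX2
  have hLY : MemLp (fun ω => s * X ω + N ω) 2 μ := (hLX.const_mul s).add (memLp_N μ N hN hN_law)
  have hpm := (outDens_continuous (μ.map X) s).measurable
  have hq : ∀ y, Integrable (fun x => (y - s * x) ^ 2) (μ.map X) ∧
      ∫ x, (y - s * x) ^ 2 ∂(μ.map X)
        = y ^ 2 - 2 * s * (∫ ω, X ω ∂μ) * y + s ^ 2 * ∫ ω, X ω ^ 2 ∂μ := by
    intro y
    have hXi : Integrable X μ := hLX.integrable (by norm_num)
    constructor
    · rw [integrable_map_measure (by fun_prop) hX.aemeasurable]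
      exact ((memLp_const y).sub (hLX.const_mul s)).integrable_sq
    · rw [integral_map hX.aemeasurable (by fun_prop)]
      have e1 : Integrable (fun ω => 2 * s * y * X ω) μ := hXi.const_mul _
      have e2 : Integrable (fun ω => s ^ 2 * X ω ^ 2) μ := hX2.const_mul _
      have e3 : Integrable (fun ω => y ^ 2 - 2 * s * y * X ω) μ := (integrable_const _).sub e1
      have : ∀ ω, (y - s * X ω) ^ 2 = (y ^ 2 - 2 * s * y * X ω) + s ^ 2 * X ω ^ 2 := by
        intro ω; ring
      simp_rw [this]
      rw [integral_add e3 e2, integral_sub (integrable_const _) e1, integral_const_mul,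
        integral_const_mul]
      simp; ring
  have hlow : Integrable (fun ω => Real.log (√(2 * π))⁻¹ -
      ((s * X ω + N ω) ^ 2 - 2 * s * (∫ ω, X ω ∂μ) * (s * X ω + N ω)
        + s ^ 2 * ∫ ω, X ω ^ 2 ∂μ) / 2) μ :=
    (integrable_const _).sub (((hLY.integrable_sq.sub
      ((hLY.integrable (by norm_num)).const_mul _)).add (integrable_const _)).div_const 2)
  refine integrable_of_le_of_le
    (Measurable.aestronglyMeasurable (by fun_prop)) (Eventually.of_forall fun ω => ?_)
    (Eventually.of_forall fun ω => ?_) hlow (integrable_const (Real.log (√(2 * π))⁻¹))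
  · have := outDens_log_ge (μ.map X) s (s * X ω + N ω) (hq _).1
    rw [(hq _).2] at this
    exact this
  · exact Real.log_le_log (outDens_pos _ _ _) (outDens_le _ _ _)

/-- the mutual information as a real number -/
def infoReal : ℝ := Real.log (√(2 * π))⁻¹ - 1 / 2
  - ∫ ω, Real.log (outDens (μ.map X) s (s * X ω + N ω)) ∂μ

lemma mutualInfo_eq (hX : Measurable X) (hN : Measurable N) (hXN : IndepFun X N μ)
    (hN_law : μ.map N = gaussianReal 0 1) (hX2 : Integrable (fun ω => X ω ^ 2) μ) :
    mutualInfo μ X (fun ω => s * X ω + N ω) = ENNReal.ofReal (infoReal μ X N s) := by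
  have hP := Measure.isProbabilityMeasure_map (μ := μ) hX.aemeasurable
  have hY : Measurable (fun ω => s * X ω + N ω) := by fun_prop
  have hPY := Measure.isProbabilityMeasure_map (μ := μ) hY.aemeasurable
  have hpm := (outDens_continuous (μ.map X) s).measurable
  have hg := gphi_continuous.measurable
  have hJ := map_joint μ X N s hX hN hXN hN_law
  have hllr := llr_withDensity_ae ((μ.map X).prod (μ.map (fun ω => s * X ω + N ω)))
    (fun z => gphi (z.2 - s * z.1) / outDens (μ.map X) s z.2) (by fun_prop)
    (fun z => div_pos (gphi_pos _) (outDens_pos _ _ _))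
  rw [← hJ] at hllr
  have hac : μ.map (fun ω => (X ω, s * X ω + N ω)) ≪
      (μ.map X).prod (μ.map (fun ω => s * X ω + N ω)) := by
    rw [hJ]; exact withDensity_absolutelyContinuous _ _
  have hfun : ∀ ω, Real.log (gphi ((s * X ω + N ω) - s * X ω) /
      outDens (μ.map X) s (s * X ω + N ω)) = (Real.log (√(2 * π))⁻¹ - N ω ^ 2 / 2)
        - Real.log (outDens (μ.map X) s (s * X ω + N ω)) := by
    intro ω
    rw [Real.log_div (gphi_pos _).ne' (outDens_pos _ _ _).ne', log_gphi]
    ring_nf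
  have hNi : Integrable (fun ω => N ω ^ 2) μ := (memLp_N μ N hN hN_law).integrable_sq
  have hi1 : Integrable (fun ω => Real.log (√(2 * π))⁻¹ - N ω ^ 2 / 2) μ :=
    (integrable_const _).sub (hNi.div_const 2)
  have hi2 := integrable_logOut μ X N s hX hN hN_law hX2
  have hmeas : AEStronglyMeasurable (fun z : ℝ × ℝ =>
      Real.log (gphi (z.2 - s * z.1) / outDens (μ.map X) s z.2))
      (μ.map (fun ω => (X ω, s * X ω + N ω))) := by
    refine Measurable.aestronglyMeasurable ?_
    fun_prop
  have hint : Integrable (llr (μ.map (fun ω => (X ω, s * X ω + N ω)))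
      ((μ.map X).prod (μ.map (fun ω => s * X ω + N ω)))) (μ.map (fun ω => (X ω, s * X ω + N ω))) := by
    rw [integrable_congr hllr, integrable_map_measure hmeas (by fun_prop)]
    simp only [Function.comp_def, hfun]
    exact hi1.sub hi2
  rw [mutualInfo, klDiv, if_pos ⟨hac, hint⟩, integral_congr_ae hllr,
    integral_map (by fun_prop) hmeas]
  simp only [hfun]
  rw [integral_sub hi1 hi2, integral_sub (integrable_const _) (hNi.div_const 2), integral_div,
    integral_sq_map μ hN hN_law, infoReal]
  simp

lemma info_le (hX : Measurable X) (hN : Measurable N) (hXN : IndepFun X N μ)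
    (hN_law : μ.map N = gaussianReal 0 1) (hX2 : Integrable (fun ω => X ω ^ 2) μ) :
    infoReal μ X N s ≤ s ^ 2 / 2 * variance X μ := by
  have hP := Measure.isProbabilityMeasure_map (μ := μ) hX.aemeasurable
  have hY : Measurable (fun ω => s * X ω + N ω) := by fun_prop
  have hpm := (outDens_continuous (μ.map X) s).measurable
  have hg := gphi_continuous.measurable
  have hLX := memLp_X μ X hX hX2
  have hLN := memLp_N μ N hN hN_law
  have hi2 := integrable_logOut μ X N s hX hN hN_law hX2
  set a := ∫ ω, X ω ∂μ with ha
  set p := outDens (μ.map X) s with hp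
  have hν := map_out μ X N s hX hN hXN hN_law
  rw [← hp] at hν
  -- the ratio integrates to one
  have hR : ∫⁻ ω, ENNReal.ofReal (gphi ((s * X ω + N ω) - s * a) / p (s * X ω + N ω)) ∂μ = 1 := by
    have h1 := lintegral_map (μ := μ) (f := fun y => ENNReal.ofReal (gphi (y - s * a) / p y))
      (by fun_prop) hY
    rw [← h1, hν, lintegral_withDensity_eq_lintegral_mul _ (by fun_prop) (by fun_prop)]
    have : ∀ y, ((fun y => ENNReal.ofReal (p y)) *
        fun y => ENNReal.ofReal (gphi (y - s * a) / p y)) y = ENNReal.ofReal (gphi (y - s * a)) := by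
      intro y
      simp only [Pi.mul_apply]
      rw [← ENNReal.ofReal_mul (outDens_pos _ s _).le, mul_div_cancel₀ _ (outDens_pos _ s _).ne']
    simp_rw [this]
    rw [lintegral_sub_right_eq_self (fun y => ENNReal.ofReal (gphi y)) (s * a),
      ← setLIntegral_univ, ← withDensity_apply _ MeasurableSet.univ, ← gaussian_eq]
    simp
  have hRpos : ∀ y, 0 < gphi (y - s * a) / p y := fun y => div_pos (gphi_pos _) (outDens_pos _ _ _)
  have hRi : Integrable (fun ω => gphi ((s * X ω + N ω) - s * a) / p (s * X ω + N ω)) μ := by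
    refine (lintegral_ofReal_ne_top_iff_integrable (Measurable.aestronglyMeasurable (by fun_prop))
      (Eventually.of_forall fun ω => (hRpos _).le)).1 ?_
    rw [hR]; simp
  have hRe : ∫ ω, gphi ((s * X ω + N ω) - s * a) / p (s * X ω + N ω) ∂μ = 1 := by
    rw [integral_eq_lintegral_of_nonneg_ae (Eventually.of_forall fun ω => (hRpos _).le)
      hRi.aestronglyMeasurable, hR]; simp
  have hqi : Integrable (fun ω => (s * X ω + N ω - s * a) ^ 2) μ :=
    (((hLX.const_mul s).add hLN).sub (memLp_const (s * a))).integrable_sq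
  have hq : ∫ ω, (s * X ω + N ω - s * a) ^ 2 ∂μ = s ^ 2 * variance X μ + 1 := by
    have hXa : MemLp (fun ω => X ω - a) 2 μ := hLX.sub (memLp_const a)
    have hind : IndepFun (fun ω => X ω - a) N μ := hXN.comp (φ := fun x => x - a) (ψ := id)
      (by fun_prop) measurable_id
    have hc : ∫ ω, (X ω - a) * N ω ∂μ = 0 := by
      have := hind.integral_fun_mul_eq_mul_integral hXa.aestronglyMeasurable
        hLN.aestronglyMeasurable
      rw [this, integral_N μ N hN hN_law, mul_zero]
    have hci : Integrable (fun ω => (X ω - a) * N ω) μ := hXa.integrable_mul hLN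
    have : ∀ ω, (s * X ω + N ω - s * a) ^ 2
        = s ^ 2 * (X ω - a) ^ 2 + 2 * s * ((X ω - a) * N ω) + N ω ^ 2 := by intro ω; ring
    simp_rw [this]
    have e1 : Integrable (fun ω => s ^ 2 * (X ω - a) ^ 2) μ := hXa.integrable_sq.const_mul _
    have e2 : Integrable (fun ω => 2 * s * ((X ω - a) * N ω)) μ := hci.const_mul _
    have e3 : Integrable (fun ω => s ^ 2 * (X ω - a) ^ 2 + 2 * s * ((X ω - a) * N ω)) μ := e1.add e2
    rw [integral_add e3 hLN.integrable_sq, integral_add e1 e2, integral_const_mul,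
      integral_const_mul, hc, integral_sq_map μ hN hN_law, variance_eq_integral hX.aemeasurable]
    ring
  have hmono : ∫ ω, ((Real.log (√(2 * π))⁻¹ - (s * X ω + N ω - s * a) ^ 2 / 2)
      - Real.log (p (s * X ω + N ω))) ∂μ ≤
      ∫ ω, (gphi ((s * X ω + N ω) - s * a) / p (s * X ω + N ω) - 1) ∂μ := by
    refine integral_mono (((integrable_const _).sub (hqi.div_const 2)).sub hi2)
      (hRi.sub (integrable_const 1)) fun ω => ?_
    have := Real.log_le_sub_one_of_pos (hRpos (s * X ω + N ω))
    rw [Real.log_div (gphi_pos _).ne' (outDens_pos _ _ _).ne', log_gphi] at this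
    exact this
  have e4 : Integrable (fun ω => Real.log (√(2 * π))⁻¹ - (s * X ω + N ω - s * a) ^ 2 / 2) μ :=
    (integrable_const _).sub (hqi.div_const 2)
  rw [integral_sub e4 hi2, integral_sub (integrable_const _) (hqi.div_const 2), integral_div, hq,
    integral_sub hRi (integrable_const 1), hRe] at hmono
  simp only [integral_const, probReal_univ, smul_eq_mul, one_mul] at hmono
  unfold infoReal
  linarith

lemma info_ge (hX : Measurable X) (hN : Measurable N) (hXN : IndepFun X N μ)
    (hN_law : μ.map N = gaussianReal 0 1) (hX2 : Integrable (fun ω => X ω ^ 2) μ) :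
    ∃ T : ℝ → ℝ, Measurable T ∧ MemLp (fun ω => T (s * X ω + N ω)) 2 μ ∧
      ∫ ω, (N ω - T (s * X ω + N ω)) ^ 2 ∂μ ≤ 2 * infoReal μ X N s := by
  have hP := Measure.isProbabilityMeasure_map (μ := μ) hX.aemeasurable
  have hY : Measurable (fun ω => s * X ω + N ω) := by fun_prop
  have hPY := Measure.isProbabilityMeasure_map (μ := μ) hY.aemeasurable
  have hLN := memLp_N μ N hN hN_law
  have hi2 := integrable_logOut μ X N s hX hN hN_law hX2
  have hν := map_out μ X N s hX hN hXN hN_law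
  obtain ⟨T, hTc, hTd, hTm⟩ := exists_transport (outDens_continuous (μ.map X) s)
    (outDens_pos (μ.map X) s) gphi_continuous gphi_pos _ _ hν gaussian_eq
  rw [Measure.map_map hTc.measurable hY] at hTm
  have hpc := outDens_continuous (μ.map X) s
  set p := outDens (μ.map X) s with hp
  set W : Ω → ℝ := fun ω => T (s * X ω + N ω) with hW
  have hWm : Measurable W := hTc.measurable.comp hY
  have hWl : μ.map W = gaussianReal 0 1 := hTm
  have hLW := memLp_N μ W hWm hWl
  refine ⟨T, hTc.measurable, hLW, ?_⟩
  have hDpos : ∀ y, 0 < p y / gphi (T y) := fun y => div_pos (outDens_pos _ _ _) (gphi_pos _)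
  have hDc : Continuous (fun y => p y / gphi (T y)) :=
    hpc.div (gphi_continuous.comp hTc) fun y => (gphi_pos _).ne'
  have hNW : Integrable (fun ω => N ω * W ω) μ := hLN.integrable_mul hLW
  have hpair := map_pair μ X N hX hN hXN hN_law
  have hTmeas := hTc.measurable
  have hst := stein_chan (μ.map X) s hDc (fun y => (hDpos y).le) hTd (by
    rw [← hpair, integrable_map_measure (Measurable.aestronglyMeasurable (by fun_prop))
      (by fun_prop)]
    exact hNW)
  have hDmeas := hDc.measurable
  have hg := gphi_continuous.measurable
  have hpm : Measurable (outDens (μ.map X) s) := hpc.measurable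
  rw [← hpair, lintegral_map (by fun_prop) (by fun_prop), integral_map (by fun_prop)
    (Measurable.aestronglyMeasurable (by fun_prop))] at hst
  obtain ⟨hst1, hst2⟩ := hst
  have hDi : Integrable (fun ω => p (s * X ω + N ω) / gphi (W ω)) μ := by
    refine (lintegral_ofReal_ne_top_iff_integrable
      (hDmeas.comp hY).aestronglyMeasurable
      (Eventually.of_forall fun ω => (hDpos _).le)).1 ?_
    exact hst1.trans_ne ENNReal.ofReal_ne_top
  have hDe : ∫ ω, p (s * X ω + N ω) / gphi (W ω) ∂μ = ∫ ω, N ω * W ω ∂μ := by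
    rw [integral_eq_lintegral_of_nonneg_ae (Eventually.of_forall fun ω => (hDpos _).le)
      hDi.aestronglyMeasurable]
    exact (congrArg ENNReal.toReal hst1).trans (ENNReal.toReal_ofReal hst2)
  have hWi : Integrable (fun ω => W ω ^ 2) μ := hLW.integrable_sq
  have e4 : Integrable (fun ω => Real.log (√(2 * π))⁻¹ - W ω ^ 2 / 2) μ :=
    (integrable_const _).sub (hWi.div_const 2)
  have hmono : ∫ ω, (Real.log (p (s * X ω + N ω)) - (Real.log (√(2 * π))⁻¹ - W ω ^ 2 / 2)) ∂μ ≤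
      ∫ ω, (p (s * X ω + N ω) / gphi (W ω) - 1) ∂μ := by
    refine integral_mono (hi2.sub e4) (hDi.sub (integrable_const 1)) fun ω => ?_
    have := Real.log_le_sub_one_of_pos (hDpos (s * X ω + N ω))
    rw [Real.log_div (outDens_pos _ _ _).ne' (gphi_pos _).ne', log_gphi] at this
    exact this
  rw [integral_sub hi2 e4, integral_sub (integrable_const _) (hWi.div_const 2), integral_div,
    integral_sq_map μ hWm hWl, integral_sub hDi (integrable_const 1), hDe] at hmono
  simp only [integral_const, probReal_univ, smul_eq_mul, one_mul] at hmono
  have hsq : ∫ ω, (N ω - W ω) ^ 2 ∂μ = 2 - 2 * ∫ ω, N ω * W ω ∂μ := by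
    have : ∀ ω, (N ω - W ω) ^ 2 = N ω ^ 2 + W ω ^ 2 - 2 * (N ω * W ω) := by intro ω; ring
    simp_rw [this]
    have e5 : Integrable (fun ω => N ω ^ 2 + W ω ^ 2) μ := hLN.integrable_sq.add hWi
    rw [integral_sub e5 (hNW.const_mul 2), integral_add hLN.integrable_sq hWi, integral_const_mul,
      integral_sq_map μ hN hN_law, integral_sq_map μ hWm hWl]
    ring
  rw [hsq]
  unfold infoReal
  linarith

lemma mmse_le (hs : 0 < s) (hX : Measurable X) (hN : Measurable N) (hXN : IndepFun X N μ)
    (hN_law : μ.map N = gaussianReal 0 1) (hX2 : Integrable (fun ω => X ω ^ 2) μ) :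
    s ^ 2 * mmse μ X (fun ω => s * X ω + N ω) ≤ 2 * infoReal μ X N s := by
  obtain ⟨T, hT, hTL, hTi⟩ := info_ge μ X N s hX hN hXN hN_law hX2
  have hY : Measurable (fun ω => s * X ω + N ω) := by fun_prop
  have hLX := memLp_X μ X hX hX2
  have hLN := memLp_N μ N hN hN_law
  have hLY : MemLp (fun ω => s * X ω + N ω) 2 μ := (hLX.const_mul s).add hLN
  have hmin := condExp_min μ (MeasurableSpace.comap (fun ω => s * X ω + N ω) inferInstance)
    hY.comap_le X (fun ω => s⁻¹ * ((s * X ω + N ω) - T (s * X ω + N ω))) hLX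
    ((hLY.sub hTL).const_mul _) (by
      have h : Measurable fun y : ℝ => s⁻¹ * (y - T y) := by fun_prop
      exact (h.comp (comap_measurable _)).stronglyMeasurable)
  have heq : s ^ 2 * ∫ ω, (X ω - s⁻¹ * ((s * X ω + N ω) - T (s * X ω + N ω))) ^ 2 ∂μ
      = ∫ ω, (N ω - T (s * X ω + N ω)) ^ 2 ∂μ := by
    rw [← integral_const_mul]
    congr 1
    ext ω
    field_simp
    ring
  unfold mmse
  calc _ ≤ s ^ 2 * ∫ ω, (X ω - s⁻¹ * ((s * X ω + N ω) - T (s * X ω + N ω))) ^ 2 ∂μ := by gcongr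
    _ ≤ _ := heq.trans_le hTi

end core

/-- **Bounds on mutual information** (Corollary 2): for the scalar Gaussian channel and every
`snr > 0`, `mmse(snr) ≤ (2/snr) · I(snr) ≤ Var(X)`. -/
theorem mmse_le_two_div_snr_mul_mutualInfo_le_var
    {Ω : Type*} [MeasurableSpace Ω] (μ : Measure Ω) [IsProbabilityMeasure μ]
    (X N : Ω → ℝ) (hX : Measurable X) (hN : Measurable N)
    (hXN : IndepFun X N μ)
    (hN_law : μ.map N = gaussianReal 0 1)
    (hX2 : Integrable (fun ω => X ω ^ 2) μ) :
    ∀ snr : ℝ, 0 < snr →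
      mmse μ X (chOut X N snr) ≤ (2 / snr) * (mutualInfo μ X (chOut X N snr)).toReal ∧
      (2 / snr) * (mutualInfo μ X (chOut X N snr)).toReal ≤ variance X μ := by
  intro snr hsnr
  have hs : 0 < √snr := Real.sqrt_pos.2 hsnr
  have hs2 : √snr ^ 2 = snr := Real.sq_sqrt hsnr.le
  have h1 := mmse_le μ X N (√snr) hs hX hN hXN hN_law hX2
  have h2 := info_le μ X N (√snr) hX hN hXN hN_law hX2
  have h3 := mutualInfo_eq μ X N (√snr) hX hN hXN hN_law hX2
  rw [hs2] at h1 h2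
  unfold chOut
  rw [h3, ENNReal.toReal_ofReal']
  constructor
  · rw [div_mul_eq_mul_div, le_div_iff₀ hsnr]
    have := le_max_left (infoReal μ X N (√snr)) 0
    linarith
  · rw [div_mul_eq_mul_div, div_le_iff₀ hsnr]
    have hv := variance_nonneg X μ
    have : max (infoReal μ X N (√snr)) 0 ≤ snr / 2 * variance X μ := max_le h2 (by positivity)
    linarith
end
end

section
/- For every input distribution P_X with E[X^2] < ∞, every snr > 0 and P_X-almost every x, the derivative with respect to snr of the Kullback–Leibler divergence D(P_{Y|X=x} ‖ P_Y) equals (1/2) · E[(X − X')^2 | X = x] − (1/(2√snr)) · E[X' · N | X = x], where X' is a random variable such that, conditioned on Y, X' is independent of X and has the same conditional distribution given Y as X. -/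
open MeasureTheory ProbabilityTheory Real Filter
open scoped ENNReal NNReal Topology

noncomputable section

/-- Unnormalised likelihood. -/
def lik (a y t : ℝ) : ℝ := Real.exp (-(y - a * t) ^ 2 / 2)

/-- Unnormalised output density. -/
def evid (P : Measure ℝ) (a y : ℝ) : ℝ := ∫ t, lik a y t ∂P

/-- Second moment. -/
def mom (P : Measure ℝ) (a y : ℝ) : ℝ := ∫ t, (y - a * t) ^ 2 ∂P

lemma lik_pos (a y t : ℝ) : 0 < lik a y t := Real.exp_pos _

lemma lik_le_one (a y t : ℝ) : lik a y t ≤ 1 := by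
  unfold lik
  apply Real.exp_le_one_iff.mpr
  nlinarith [sq_nonneg (y - a * t)]

lemma measurable_lik (a : ℝ) : Measurable (fun p : ℝ × ℝ => lik a p.1 p.2) := by
  unfold lik; fun_prop

lemma continuous_lik (a y : ℝ) : Continuous (lik a y) := by
  unfold lik; fun_prop

lemma integrable_lik (P : Measure ℝ) [IsProbabilityMeasure P] (a y : ℝ) :
    Integrable (lik a y) P := by
  refine Integrable.of_bound (C := 1) (continuous_lik a y).aestronglyMeasurable ?_
  filter_upwards with t
  rw [Real.norm_of_nonneg (lik_pos a y t).le]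
  exact lik_le_one a y t

lemma integrable_id' {P : Measure ℝ} [IsProbabilityMeasure P]
    (h2 : Integrable (fun t : ℝ => t ^ 2) P) : Integrable (fun t : ℝ => t) P := by
  refine (h2.add (integrable_const (1 : ℝ))).mono' (by fun_prop) ?_
  filter_upwards with t
  simp only [Pi.add_apply, Real.norm_eq_abs]
  exact abs_le.mpr ⟨by nlinarith [sq_nonneg (t + 1)], by nlinarith [sq_nonneg (t - 1)]⟩

lemma integrable_sq_affine {P : Measure ℝ} [IsProbabilityMeasure P]
    (h2 : Integrable (fun t : ℝ => t ^ 2) P) (a y : ℝ) :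
    Integrable (fun t : ℝ => (y - a * t) ^ 2) P := by
  have : (fun t : ℝ => (y - a * t) ^ 2) = fun t => y ^ 2 - 2 * a * y * t + a ^ 2 * t ^ 2 := by
    ext t; ring
  rw [this]
  exact ((integrable_const _).sub ((integrable_id' h2).const_mul _)).add (h2.const_mul _)

lemma exp_mom_le_evid {P : Measure ℝ} [IsProbabilityMeasure P]
    (h2 : Integrable (fun t : ℝ => t ^ 2) P) (a y : ℝ) :
    Real.exp (-(mom P a y) / 2) ≤ evid P a y := by
  have hq := integrable_sq_affine h2 a y
  have key : ∀ t, Real.exp (-(mom P a y) / 2) * (1 + (mom P a y / 2 - (y - a * t) ^ 2 / 2))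
      ≤ lik a y t := by
    intro t
    have : lik a y t = Real.exp (-(mom P a y) / 2) *
        Real.exp (mom P a y / 2 - (y - a * t) ^ 2 / 2) := by
      rw [← Real.exp_add]; unfold lik; congr 1; ring
    rw [this]
    have := Real.add_one_le_exp (mom P a y / 2 - (y - a * t) ^ 2 / 2)
    gcongr
    linarith
  have hi : Integrable (fun t => mom P a y / 2 - (y - a * t) ^ 2 / 2) P :=
    (integrable_const _).sub (hq.div_const 2)
  have hi2 : Integrable (fun t => 1 + (mom P a y / 2 - (y - a * t) ^ 2 / 2)) P :=
    (integrable_const (1 : ℝ)).add hi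
  have := integral_mono (hi2.const_mul _) (integrable_lik P a y) key
  have h0 : ∫ t, (1 + (mom P a y / 2 - (y - a * t) ^ 2 / 2)) ∂P = 1 := by
    rw [integral_add (integrable_const _) hi, integral_sub (integrable_const _) (hq.div_const 2)]
    simp [mom, integral_div]
  rw [integral_const_mul, h0, mul_one] at this
  exact this

lemma evid_pos {P : Measure ℝ} [IsProbabilityMeasure P]
    (h2 : Integrable (fun t : ℝ => t ^ 2) P) (a y : ℝ) : 0 < evid P a y :=
  (Real.exp_pos _).trans_le (exp_mom_le_evid h2 a y)

lemma evid_le_one (P : Measure ℝ) [IsProbabilityMeasure P] (a y : ℝ) : evid P a y ≤ 1 := by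
  have := integral_mono (integrable_lik P a y) (integrable_const (1 : ℝ)) (lik_le_one a y)
  simpa [evid] using this

lemma measurable_evid (P : Measure ℝ) [IsProbabilityMeasure P] (a : ℝ) :
    Measurable (evid P a) := by
  have : StronglyMeasurable (fun p : ℝ × ℝ => lik a p.1 p.2) :=
    (measurable_lik a).stronglyMeasurable
  exact (this.integral_prod_right (ν := P)).measurable

lemma mom_nonneg (P : Measure ℝ) (a y : ℝ) : 0 ≤ mom P a y :=
  integral_nonneg fun _ => sq_nonneg _

lemma abs_log_evid_le {P : Measure ℝ} [IsProbabilityMeasure P]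
    (h2 : Integrable (fun t : ℝ => t ^ 2) P) (a y : ℝ) :
    |Real.log (evid P a y)| ≤ mom P a y / 2 := by
  have h1 := Real.log_nonpos (evid_pos h2 a y).le (evid_le_one P a y)
  have h3 := Real.log_le_log (Real.exp_pos _) (exp_mom_le_evid h2 a y)
  rw [Real.log_exp] at h3
  rw [abs_of_nonpos h1]; linarith

lemma integrable_sq_lik (P : Measure ℝ) [IsProbabilityMeasure P]
    (h2 : Integrable (fun t : ℝ => t ^ 2) P) (a y : ℝ) :
    Integrable (fun t => (y - a * t) ^ 2 * lik a y t) P := by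
  refine (integrable_sq_affine h2 a y).mono'
    ((by fun_prop : Continuous fun t => (y - a * t) ^ 2).mul
      (continuous_lik a y)).aestronglyMeasurable ?_
  filter_upwards with t
  rw [Real.norm_of_nonneg (mul_nonneg (sq_nonneg _) (lik_pos _ _ _).le)]
  exact mul_le_of_le_one_right (sq_nonneg _) (lik_le_one _ _ _)

lemma post_sq_le (P : Measure ℝ) [IsProbabilityMeasure P]
    (h2 : Integrable (fun t : ℝ => t ^ 2) P) (a y : ℝ) :
    ∫ t, (y - a * t) ^ 2 * lik a y t ∂P ≤ 2 * mom P a y * evid P a y := by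
  have key : ∀ t, (y - a * t) ^ 2 * lik a y t ≤
      (y - a * t) ^ 2 * evid P a y + mom P a y * lik a y t := by
    intro t
    have hl := lik_pos a y t
    have he := evid_pos h2 a y
    have hm := mom_nonneg P a y
    rcases le_total ((y - a * t) ^ 2) (mom P a y) with h | h
    · have := mul_le_mul_of_nonneg_right h hl.le
      have := mul_nonneg (sq_nonneg (y - a * t)) he.le
      linarith
    · have : lik a y t ≤ evid P a y := by
        refine le_trans ?_ (exp_mom_le_evid h2 a y)
        unfold lik
        apply Real.exp_le_exp.mpr
        linarith
      have := mul_le_mul_of_nonneg_left this (sq_nonneg (y - a * t))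
      have := mul_nonneg hm hl.le
      linarith
  have hA := (integrable_sq_affine h2 a y).mul_const (evid P a y)
  have hB := (integrable_lik P a y).const_mul (mom P a y)
  have := integral_mono (integrable_sq_lik P h2 a y) (hA.add hB) key
  simp only [Pi.add_apply] at this
  rw [integral_add hA hB, integral_mul_const, integral_const_mul] at this
  change _ ≤ mom P a y * evid P a y + mom P a y * evid P a y at this
  linarith

/-- Minus derivative of the shifted evidence. -/
def dnum (P : Measure ℝ) (x a z : ℝ) : ℝ :=
  ∫ t, (a * x + z - a * t) * (x - t) * lik a (a * x + z) t ∂P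

lemma abs_dnum_le (P : Measure ℝ) [IsProbabilityMeasure P]
    (h2 : Integrable (fun t : ℝ => t ^ 2) P) (x z : ℝ) {a : ℝ} (ha : 0 < a) :
    |dnum P x a z| ≤ (3 * mom P a (a * x + z) + z ^ 2 / 2) / a * evid P a (a * x + z) := by
  set y := a * x + z with hy
  have hbi : Integrable (fun t => (3 / (2 * a)) * ((y - a * t) ^ 2 * lik a y t)
      + z ^ 2 / (2 * a) * lik a y t) P :=
    ((integrable_sq_lik P h2 a y).const_mul _).add ((integrable_lik P a y).const_mul _)
  have h := norm_integral_le_of_norm_le (μ := P)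
    (f := fun t => (a * x + z - a * t) * (x - t) * lik a (a * x + z) t) hbi (by
      filter_upwards with t
      rw [norm_mul, Real.norm_of_nonneg (lik_pos _ _ _).le, Real.norm_eq_abs, ← hy]
      have : |(y - a * t) * (x - t)| ≤ 3 / (2 * a) * (y - a * t) ^ 2 + z ^ 2 / (2 * a) := by
        have e : x - t = ((y - a * t) - z) / a := by rw [hy]; field_simp; ring
        rw [e]
        generalize y - a * t = u
        have : 3 / (2 * a) * u ^ 2 + z ^ 2 / (2 * a) = (3 / 2 * u ^ 2 + z ^ 2 / 2) / a := by
          field_simp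
        rw [this, ← mul_div_assoc, abs_div, abs_of_pos ha]
        gcongr
        exact abs_le.mpr ⟨by nlinarith [sq_nonneg (u + z), sq_nonneg (u - z)],
          by nlinarith [sq_nonneg (u + z), sq_nonneg (u - z)]⟩
      calc _ ≤ (3 / (2 * a) * (y - a * t) ^ 2 + z ^ 2 / (2 * a)) * lik a y t :=
            mul_le_mul_of_nonneg_right this (lik_pos _ _ _).le
        _ = _ := by ring)
  rw [integral_add ((integrable_sq_lik P h2 a y).const_mul _)
    ((integrable_lik P a y).const_mul _), integral_const_mul, integral_const_mul] at h
  change |dnum P x a z| ≤ _ * _ + _ * evid P a y at h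
  refine h.trans ?_
  have h3 := mul_le_mul_of_nonneg_left (post_sq_le P h2 a y) (by positivity : 0 ≤ 3 / (2 * a))
  refine (add_le_add_left h3 _).trans (le_of_eq ?_)
  field_simp

lemma measurable_dnum (P : Measure ℝ) [IsProbabilityMeasure P] (x a : ℝ) :
    Measurable (dnum P x a) := by
  have : StronglyMeasurable (fun p : ℝ × ℝ =>
      (a * x + p.1 - a * p.2) * (x - p.2) * lik a (a * x + p.1) p.2) := by
    apply Measurable.stronglyMeasurable
    unfold lik; fun_prop
  exact (this.integral_prod_right (ν := P)).measurable

lemma hasDerivAt_evid (P : Measure ℝ) [IsProbabilityMeasure P]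
    (h2 : Integrable (fun t : ℝ => t ^ 2) P) (x z a : ℝ) :
    HasDerivAt (fun a => evid P a (a * x + z)) (-dnum P x a z) a := by
  have := (hasDerivAt_integral_of_dominated_loc_of_deriv_le (μ := P) (x₀ := a) (s := Set.univ)
    (F := fun a t => lik a (a * x + z) t)
    (F' := fun a t => -((a * x + z - a * t) * (x - t) * lik a (a * x + z) t))
    (bound := fun t => |x - t|) Filter.univ_mem
    (Filter.Eventually.of_forall fun b => (continuous_lik _ _).aestronglyMeasurable)
    (integrable_lik P _ _) ?_ ?_ ?_ ?_).2
  · rw [integral_neg] at this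
    exact this
  · apply Continuous.aestronglyMeasurable
    unfold lik; fun_prop
  · filter_upwards with t b _
    rw [norm_neg, norm_mul, Real.norm_of_nonneg (lik_pos _ _ _).le, norm_mul, mul_comm ‖_‖,
      mul_assoc, Real.norm_eq_abs, Real.norm_eq_abs]
    refine mul_le_of_le_one_right (abs_nonneg _) ?_
    unfold lik
    generalize b * x + z - b * t = u
    have h1 : |u| ≤ Real.exp (u ^ 2 / 2) := by
      have := Real.add_one_le_exp (u ^ 2 / 2)
      refine le_trans ?_ this
      exact abs_le.mpr ⟨by nlinarith [sq_nonneg (u + 1)], by nlinarith [sq_nonneg (u - 1)]⟩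
    calc |u| * Real.exp (-u ^ 2 / 2) ≤ Real.exp (u ^ 2 / 2) * Real.exp (-u ^ 2 / 2) := by gcongr
      _ = 1 := by rw [← Real.exp_add]; simp; ring
  · exact ((integrable_const x).sub (integrable_id' h2)).abs
  · filter_upwards with t b _
    unfold lik
    have h1 : HasDerivAt (fun b : ℝ => b * x + z - b * t) (x - t) b := by
      have := (((hasDerivAt_id b).mul_const x).add_const z).sub ((hasDerivAt_id b).mul_const t)
      refine this.congr_deriv ?_
      simp
    have h3 := (((h1.pow 2).neg).div_const 2).exp
    refine h3.congr_deriv ?_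
    simp
    ring

lemma integrable_gauss_sq : Integrable (fun z : ℝ => z ^ 2) (gaussianReal 0 1) :=
  (memLp_id_gaussianReal (μ := 0) (v := 1) 2).integrable_sq

lemma mom_le {P : Measure ℝ} [IsProbabilityMeasure P]
    (h2 : Integrable (fun t : ℝ => t ^ 2) P) (x z a : ℝ) :
    mom P a (a * x + z) ≤ 2 * z ^ 2 + 2 * a ^ 2 * mom P 1 x := by
  have hi := integrable_sq_affine h2 1 x
  have : ∫ t, (2 * z ^ 2 + 2 * a ^ 2 * (x - 1 * t) ^ 2) ∂P = 2 * z ^ 2 + 2 * a ^ 2 * mom P 1 x := by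
    rw [integral_add (integrable_const _) (hi.const_mul _)]
    simp [mom, integral_const_mul]
  rw [← this]
  refine integral_mono (integrable_sq_affine h2 _ _)
    ((integrable_const _).add (hi.const_mul _)) fun t => ?_
  nlinarith [sq_nonneg (z - a * (x - t))]

lemma integrable_log_evid (P : Measure ℝ) [IsProbabilityMeasure P]
    (h2 : Integrable (fun t : ℝ => t ^ 2) P) (x a : ℝ) :
    Integrable (fun z => Real.log (evid P a (a * x + z))) (gaussianReal 0 1) := by
  refine Integrable.mono' (g := fun z => z ^ 2 + a ^ 2 * mom P 1 x)
    (integrable_gauss_sq.add (integrable_const _)) ?_ ?_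
  · exact (Real.measurable_log.comp
      ((measurable_evid P a).comp (by fun_prop))).aestronglyMeasurable
  · filter_upwards with z
    have h3 := abs_log_evid_le h2 a (a * x + z)
    have h4 := mom_le h2 x z a
    rw [Real.norm_eq_abs]; linarith

lemma hasDerivAt_D (P : Measure ℝ) [IsProbabilityMeasure P]
    (h2 : Integrable (fun t : ℝ => t ^ 2) P) (x : ℝ) {a : ℝ} (ha : 0 < a) :
    HasDerivAt (fun a => ∫ z, (-z ^ 2 / 2 - Real.log (evid P a (a * x + z))) ∂(gaussianReal 0 1))
      (∫ z, dnum P x a z / evid P a (a * x + z) ∂(gaussianReal 0 1)) a := by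
  have hmeas : ∀ b, AEStronglyMeasurable (fun z => -z ^ 2 / 2 - Real.log (evid P b (b * x + z)))
      (gaussianReal 0 1) := fun b =>
    ((by fun_prop : Measurable fun z : ℝ => -z ^ 2 / 2).sub (Real.measurable_log.comp
      ((measurable_evid P b).comp (by fun_prop)))).aestronglyMeasurable
  have hC := mom_nonneg P 1 x
  refine (hasDerivAt_integral_of_dominated_loc_of_deriv_le (μ := gaussianReal 0 1) (x₀ := a)
    (s := Set.Ioo (a / 2) (2 * a))
    (F := fun a z => -z ^ 2 / 2 - Real.log (evid P a (a * x + z)))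
    (F' := fun a z => dnum P x a z / evid P a (a * x + z))
    (bound := fun z => (7 * z ^ 2 + 24 * a ^ 2 * mom P 1 x) / (a / 2))
    (Ioo_mem_nhds (by linarith) (by linarith))
    (Filter.Eventually.of_forall hmeas) ?_ ?_ ?_ ?_ ?_).2
  · exact ((integrable_gauss_sq.neg).div_const 2).sub (integrable_log_evid P h2 x a)
  · exact ((measurable_dnum P x a).div
      ((measurable_evid P a).comp (by fun_prop))).aestronglyMeasurable
  · filter_upwards with z b hb
    have hb0 : 0 < b := by linarith [hb.1]
    have he := evid_pos h2 b (b * x + z)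
    rw [norm_div, Real.norm_of_nonneg he.le, div_le_iff₀ he, Real.norm_eq_abs]
    refine (abs_dnum_le P h2 x z hb0).trans ?_
    refine mul_le_mul_of_nonneg_right ?_ he.le
    have h4 := mom_le h2 x z b
    have hbb : b ^ 2 ≤ 4 * a ^ 2 := by nlinarith [hb.2]
    have h5 := mul_le_mul_of_nonneg_right hbb hC
    have := hb.1
    apply div_le_div₀ (by positivity) _ (by positivity) this.le
    nlinarith [sq_nonneg z]
  · exact ((integrable_gauss_sq.const_mul 7).add (integrable_const _)).div_const _
  · filter_upwards with z b hb
    have he := evid_pos h2 b (b * x + z)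
    have := ((hasDerivAt_evid P h2 x z b).log he.ne').const_sub (-z ^ 2 / 2)
    refine this.congr_deriv ?_
    ring

lemma gaussianPDFReal_lik (a x y : ℝ) :
    gaussianPDFReal (a * x) 1 y = lik a y x / √(2 * π) := by
  simp [gaussianPDFReal, lik]
  ring

lemma joint_lintegral {Ω : Type*} [MeasurableSpace Ω] (μ : Measure Ω) [IsProbabilityMeasure μ]
    {X N : Ω → ℝ} (hX : Measurable X) (hN : Measurable N) (hXN : IndepFun X N μ)
    (hN_law : μ.map N = gaussianReal 0 1) (s : ℝ) (g : ℝ × ℝ → ℝ≥0∞) (hg : Measurable g) :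
    ∫⁻ ω, g (chOut X N s ω, X ω) ∂μ =
      ∫⁻ y, ∫⁻ t, ENNReal.ofReal (lik (√s) y t / √(2 * π)) * g (y, t) ∂(μ.map X) := by
  have : IsProbabilityMeasure (μ.map X) := Measure.isProbabilityMeasure_map hX.aemeasurable
  have hprod : μ.map (fun ω => (X ω, N ω)) = (μ.map X).prod (gaussianReal 0 1) := by
    rw [(indepFun_iff_map_prod_eq_prod_map_map hX.aemeasurable hN.aemeasurable).mp hXN, hN_law]
  have h1 : ∫⁻ ω, g (chOut X N s ω, X ω) ∂μ =
      ∫⁻ p : ℝ × ℝ, g (√s * p.1 + p.2, p.1) ∂(μ.map (fun ω => (X ω, N ω))) := by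
    rw [lintegral_map (by fun_prop) (by fun_prop)]
    rfl
  rw [h1, hprod, lintegral_prod _ (by fun_prop)]
  have h2 : ∀ x, ∫⁻ z, g (√s * x + z, x) ∂(gaussianReal 0 1) =
      ∫⁻ y, ENNReal.ofReal (lik (√s) y x / √(2 * π)) * g (y, x) := by
    intro x
    have h3 : gaussianReal (√s * x) 1 = (gaussianReal 0 1).map (fun z => √s * x + z) := by
      rw [gaussianReal_map_const_add]; simp
    have h4 : ∫⁻ z, g (√s * x + z, x) ∂(gaussianReal 0 1) =
        ∫⁻ y, g (y, x) ∂(gaussianReal (√s * x) 1) := by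
      rw [h3, lintegral_map (by fun_prop) (by fun_prop)]
    rw [h4, gaussianReal_of_var_ne_zero _ one_ne_zero,
      lintegral_withDensity_eq_lintegral_mul _ (measurable_gaussianPDF _ _) (by fun_prop)]
    simp only [Pi.mul_apply, gaussianPDF, gaussianPDFReal_lik]
  simp_rw [h2]
  rw [lintegral_lintegral_swap]
  have := (measurable_lik (√s)).comp measurable_swap
  have h5 : Measurable (fun p : ℝ × ℝ => ENNReal.ofReal (lik (√s) p.2 p.1 / √(2 * π))
      * g (p.2, p.1)) :=
    (this.div_const _).ennreal_ofReal.mul (by fun_prop)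
  exact h5.aemeasurable

lemma lintegral_lik (P : Measure ℝ) [IsProbabilityMeasure P] (a y c : ℝ) (hc : 0 ≤ c) :
    ∫⁻ t, ENNReal.ofReal (lik a y t / c) ∂P = ENNReal.ofReal (evid P a y / c) := by
  rw [← ofReal_integral_eq_lintegral_ofReal ((integrable_lik P a y).div_const c)
    (Eventually.of_forall fun t => div_nonneg (lik_pos a y t).le hc), integral_div]
  rfl

lemma law_out {Ω : Type*} [MeasurableSpace Ω] (μ : Measure Ω) [IsProbabilityMeasure μ]
    {X N : Ω → ℝ} (hX : Measurable X) (hN : Measurable N) (hXN : IndepFun X N μ)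
    (hN_law : μ.map N = gaussianReal 0 1) (s : ℝ) :
    μ.map (chOut X N s) =
      volume.withDensity (fun y => ENNReal.ofReal (evid (μ.map X) (√s) y / √(2 * π))) := by
  have : IsProbabilityMeasure (μ.map X) := Measure.isProbabilityMeasure_map hX.aemeasurable
  have hY : Measurable (chOut X N s) := by unfold chOut; fun_prop
  have hl : ∀ y, Measurable fun t => ENNReal.ofReal (lik (√s) y t / √(2 * π)) := fun y => (((measurable_lik (√s)).comp (measurable_prodMk_left (x := y))).div_const
    √(2 * π)).ennreal_ofReal
  refine Measure.ext_of_lintegral _ fun g hg => ?_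
  rw [lintegral_map hg hY, lintegral_withDensity_eq_lintegral_mul _
    ((measurable_evid _ _).div_const _).ennreal_ofReal hg,
    joint_lintegral μ hX hN hXN hN_law s (fun p => g p.1) (by fun_prop)]
  refine lintegral_congr fun y => ?_
  dsimp only
  rw [lintegral_mul_const _ (hl y), lintegral_lik _ _ _ _ (by positivity)]
  rfl

lemma toReal_klDiv_eq {Ω : Type*} [MeasurableSpace Ω] (μ : Measure Ω) [IsProbabilityMeasure μ]
    {X N : Ω → ℝ} (hX : Measurable X) (hN : Measurable N) (hXN : IndepFun X N μ)
    (hN_law : μ.map N = gaussianReal 0 1)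
    (hX2 : Integrable (fun t : ℝ => t ^ 2) (μ.map X)) (s x : ℝ) :
    (klDiv (gaussianReal (√s * x) 1) (μ.map (chOut X N s))).toReal =
      ∫ z, (-z ^ 2 / 2 - Real.log (evid (μ.map X) (√s) (√s * x + z))) ∂(gaussianReal 0 1) := by
  have : IsProbabilityMeasure (μ.map X) := Measure.isProbabilityMeasure_map hX.aemeasurable
  have hY : Measurable (chOut X N s) := by unfold chOut; fun_prop
  have hPY : IsProbabilityMeasure (μ.map (chOut X N s)) :=
    Measure.isProbabilityMeasure_map hY.aemeasurable
  set P := μ.map X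
  set a := √s
  set ν := μ.map (chOut X N s) with hν
  have hlaw : ν = _ := law_out μ hX hN hXN hN_law s
  have hE := measurable_evid P a
  have hmr : Measurable (fun y => ENNReal.ofReal (lik a y x / evid P a y)) :=
    (((measurable_lik a).comp (measurable_prodMk_right (y := x))).div hE).ennreal_ofReal
  have hg : gaussianReal (a * x) 1 =
      ν.withDensity (fun y => ENNReal.ofReal (lik a y x / evid P a y)) := by
    rw [hlaw, ← withDensity_mul _ (hE.div_const _).ennreal_ofReal hmr,
      gaussianReal_of_var_ne_zero _ one_ne_zero]
    congr 1
    ext y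
    have he := evid_pos hX2 a y
    simp only [Pi.mul_apply, gaussianPDF, gaussianPDFReal_lik]
    rw [← ENNReal.ofReal_mul (by positivity)]
    congr 1
    field_simp
  have hac : gaussianReal (a * x) 1 ≪ ν := by
    rw [hg]; exact withDensity_absolutelyContinuous _ _
  have hllr : llr (gaussianReal (a * x) 1) ν =ᵐ[gaussianReal (a * x) 1]
      fun y => -(y - a * x) ^ 2 / 2 - Real.log (evid P a y) := by
    have h1 : (gaussianReal (a * x) 1).rnDeriv ν =ᵐ[ν]
        fun y => ENNReal.ofReal (lik a y x / evid P a y) := by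
      rw [hg]; exact Measure.rnDeriv_withDensity ν hmr
    filter_upwards [hac.ae_le h1] with y hy
    have he := evid_pos hX2 a y
    rw [llr, hy, ENNReal.toReal_ofReal (div_nonneg (lik_pos _ _ _).le he.le),
      Real.log_div (lik_pos _ _ _).ne' he.ne', lik, Real.log_exp]
  have h3 : gaussianReal (a * x) 1 = (gaussianReal 0 1).map (fun z => a * x + z) := by
    rw [gaussianReal_map_const_add]; simp
  have hme : Measurable fun y => -(y - a * x) ^ 2 / 2 - Real.log (evid P a y) :=
    (by fun_prop : Measurable fun y : ℝ => -(y - a * x) ^ 2 / 2).sub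
      (Real.measurable_log.comp hE)
  have hint : Integrable (llr (gaussianReal (a * x) 1) ν) (gaussianReal (a * x) 1) := by
    rw [integrable_congr hllr, h3, integrable_map_measure hme.aestronglyMeasurable
      (by fun_prop)]
    have := ((integrable_gauss_sq.neg).div_const 2).sub (integrable_log_evid P hX2 x a)
    refine this.congr (Eventually.of_forall fun z => ?_)
    simp
  have h0 : (klDiv (gaussianReal (a * x) 1) ν).toReal =
      ∫ y, llr (gaussianReal (a * x) 1) ν y ∂(gaussianReal (a * x) 1) := by
    rw [← InformationTheory.toReal_klDiv_of_measure_eq hac (by simp),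
      InformationTheory.klDiv_of_ac_of_integrable hac hint, klDiv, if_pos ⟨hac, hint⟩]
    simp
  rw [h0, integral_congr_ae hllr]
  nth_rewrite 1 [h3]
  rw [integral_map (by fun_prop) hme.aestronglyMeasurable]
  simp

/-- The explicit posterior kernel. -/
def postK (P : Measure ℝ) [IsProbabilityMeasure P] (a : ℝ) : Kernel ℝ ℝ :=
  Kernel.withDensity (Kernel.const ℝ P) (fun y t => ENNReal.ofReal (lik a y t / evid P a y))

lemma measurable_postdens (P : Measure ℝ) [IsProbabilityMeasure P] (a : ℝ) :
    Measurable (Function.uncurry fun y t => ENNReal.ofReal (lik a y t / evid P a y)) :=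
  ((measurable_lik a).div ((measurable_evid P a).comp measurable_fst)).ennreal_ofReal

lemma postK_apply (P : Measure ℝ) [IsProbabilityMeasure P] (a y : ℝ) :
    postK P a y = P.withDensity (fun t => ENNReal.ofReal (lik a y t / evid P a y)) := by
  rw [postK, Kernel.withDensity_apply _ (measurable_postdens P a), Kernel.const_apply]

lemma measurable_postdens' (P : Measure ℝ) [IsProbabilityMeasure P] (a y : ℝ) :
    Measurable fun t => ENNReal.ofReal (lik a y t / evid P a y) :=
  ((continuous_lik a y).measurable.div_const _).ennreal_ofReal

lemma isMarkov_postK (P : Measure ℝ) [IsProbabilityMeasure P]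
    (h2 : Integrable (fun t : ℝ => t ^ 2) P) (a : ℝ) : IsMarkovKernel (postK P a) := by
  refine ⟨fun y => ⟨?_⟩⟩
  have he := evid_pos h2 a y
  rw [postK_apply, withDensity_apply _ MeasurableSet.univ, Measure.restrict_univ,
    lintegral_lik _ _ _ _ he.le, div_self he.ne', ENNReal.ofReal_one]

lemma integral_postK (P : Measure ℝ) [IsProbabilityMeasure P]
    (h2 : Integrable (fun t : ℝ => t ^ 2) P) (a y : ℝ) (f : ℝ → ℝ) :
    ∫ t, f t ∂(postK P a y) = (∫ t, f t * lik a y t ∂P) / evid P a y := by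
  have he := evid_pos h2 a y
  have hd := measurable_postdens' P a y
  rw [postK_apply, integral_withDensity_eq_integral_toReal_smul hd
    (Eventually.of_forall fun _ => by simp), ← integral_div]
  refine integral_congr_ae (Eventually.of_forall fun t => ?_)
  simp only [smul_eq_mul]
  rw [ENNReal.toReal_ofReal (div_nonneg (lik_pos _ _ _).le he.le)]
  ring

lemma condDistrib_eq_postK {Ω : Type*} [MeasurableSpace Ω]
    (μ : Measure Ω) [IsProbabilityMeasure μ]
    {X N : Ω → ℝ} (hX : Measurable X) (hN : Measurable N) (hXN : IndepFun X N μ)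
    (hN_law : μ.map N = gaussianReal 0 1)
    (hX2 : Integrable (fun t : ℝ => t ^ 2) (μ.map X)) [IsProbabilityMeasure (μ.map X)] (s : ℝ) :
    condDistrib X (chOut X N s) μ =ᵐ[μ.map (chOut X N s)] postK (μ.map X) (√s) := by
  have hY : Measurable (chOut X N s) := by unfold chOut; fun_prop
  have := isMarkov_postK _ hX2 (√s)
  have : IsProbabilityMeasure (μ.map (chOut X N s)) :=
    Measure.isProbabilityMeasure_map hY.aemeasurable
  refine condDistrib_ae_eq_of_measure_eq_compProd _ hX.aemeasurable ?_
  refine Measure.ext_of_lintegral _ fun g hg => ?_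
  rw [lintegral_map hg (hY.prodMk hX), Measure.lintegral_compProd hg,
    joint_lintegral μ hX hN hXN hN_law s g hg, law_out μ hX hN hXN hN_law s,
    lintegral_withDensity_eq_lintegral_mul _
      ((measurable_evid _ _).div_const _).ennreal_ofReal (hg.lintegral_kernel_prod_right')]
  refine lintegral_congr fun y => ?_
  have he := evid_pos hX2 (√s) y
  have hd := measurable_postdens' (μ.map X) (√s) y
  have hgy : Measurable fun t => g (y, t) := by fun_prop
  rw [Pi.mul_apply, postK_apply, lintegral_withDensity_eq_lintegral_mul _ hd hgy,
    ← lintegral_const_mul _ (hd.mul hgy)]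
  refine lintegral_congr fun t => ?_
  simp only [Pi.mul_apply]
  rw [← mul_assoc, ← ENNReal.ofReal_mul (by positivity)]
  congr 2
  field_simp

lemma measurable_ratio (P : Measure ℝ) [IsProbabilityMeasure P] (a : ℝ) :
    Measurable (fun p : ℝ × ℝ => dnum P p.1 a p.2 / evid P a (a * p.1 + p.2)) := by
  have : StronglyMeasurable (fun p : (ℝ × ℝ) × ℝ =>
      (a * p.1.1 + p.1.2 - a * p.2) * (p.1.1 - p.2) * lik a (a * p.1.1 + p.1.2) p.2) := by
    apply Measurable.stronglyMeasurable
    unfold lik; fun_prop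
  exact (this.integral_prod_right (ν := P)).measurable.div
    ((measurable_evid P a).comp (by fun_prop))

lemma condExp_indep {Ω : Type*} [MeasurableSpace Ω]
    (μ : Measure Ω) [IsProbabilityMeasure μ]
    {X N : Ω → ℝ} (hX : Measurable X) (hN : Measurable N) (hXN : IndepFun X N μ)
    (hN_law : μ.map N = gaussianReal 0 1) (G : ℝ × ℝ → ℝ) (hG : Measurable G)
    (hGi : Integrable (fun ω => G (X ω, N ω)) μ) :
    μ[fun ω => G (X ω, N ω) | MeasurableSpace.comap X inferInstance] =ᵐ[μ]
      fun ω => ∫ z, G (X ω, z) ∂(gaussianReal 0 1) := by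
  have : IsProbabilityMeasure (μ.map X) := Measure.isProbabilityMeasure_map hX.aemeasurable
  have hprod : μ.map (fun ω => (X ω, N ω)) = μ.map X ⊗ₘ Kernel.const ℝ (gaussianReal 0 1) := by
    rw [(indepFun_iff_map_prod_eq_prod_map_map hX.aemeasurable hN.aemeasurable).mp hXN, hN_law,
      Measure.compProd_const]
  have h1 := ae_of_ae_map hX.aemeasurable
    (condDistrib_ae_eq_of_measure_eq_compProd X hN.aemeasurable hprod)
  have h2 := condExp_prod_ae_eq_integral_condDistrib hX hN.aemeasurable hG.stronglyMeasurable hGi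
  filter_upwards [h1, h2] with ω h1 h2
  rw [h2, h1, Kernel.const_apply]

/-- **Derivative of the conditional divergence** (Theorem 3): for `P_X`-almost every `x`,
`d/dsnr D(P_{Y|X=x} ‖ P_Y) = (1/2) E[(X−X')² | X=x] − (1/(2√snr)) E[X'·N | X=x]`, where the
retrochannel output `X'` is, conditionally on `Y`, independent of `(X, N)` and distributed
according to the posterior `P_{X|Y}`.  (Conditioning on `X = x` is expressed through
conditional expectation given the σ-algebra generated by `X`.) -/
theorem hasDerivAt_condDivergence
    {Ω : Type*} [MeasurableSpace Ω] [StandardBorelSpace Ω] [Nonempty Ω]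
    (μ : Measure Ω) [IsProbabilityMeasure μ]
    (X N X' : Ω → ℝ) (hX : Measurable X) (hN : Measurable N) (hX' : Measurable X')
    (hXN : IndepFun X N μ)
    (hN_law : μ.map N = gaussianReal 0 1)
    (hX2 : Integrable (fun ω => X ω ^ 2) μ)
    (snr : ℝ) (hsnr : 0 < snr)
    -- conditionally on `Y`, the retrochannel output `X'` is independent of `(X, N)`
    (hCI : CondIndepFun (MeasurableSpace.comap (chOut X N snr) inferInstance)
      (measurable_iff_comap_le.mp ((measurable_const.mul hX).add hN))
      X' (fun ω => (X ω, N ω)) μ)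
    -- conditionally on `Y`, the retrochannel output `X'` has the posterior law of `X` given `Y`
    (hpost : ∀ᵐ y ∂(μ.map (chOut X N snr)),
      condDistrib X' (chOut X N snr) μ y = condDistrib X (chOut X N snr) μ y) :
    ∀ᵐ ω ∂μ,
      HasDerivAt
        (fun s : ℝ =>
          (klDiv (gaussianReal (Real.sqrt s * X ω) 1) (μ.map (chOut X N s))).toReal)
        ((1 / 2) * (μ[fun ω' => (X ω' - X' ω') ^ 2 |
              MeasurableSpace.comap X inferInstance]) ω
          - (1 / (2 * Real.sqrt snr)) * (μ[fun ω' => X' ω' * N ω' |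
              MeasurableSpace.comap X inferInstance]) ω)
        snr := by
  have hPp : IsProbabilityMeasure (μ.map X) := Measure.isProbabilityMeasure_map hX.aemeasurable
  have hY : Measurable (chOut X N snr) := by unfold chOut; fun_prop
  have hP2 : Integrable (fun t : ℝ => t ^ 2) (μ.map X) := by
    rw [integrable_map_measure (by fun_prop) hX.aemeasurable]; exact hX2
  have ha : 0 < √snr := Real.sqrt_pos.mpr hsnr
  -- the law of the retrochannel output
  have hlawX' : μ.map X' = μ.map X := by
    have h1 : μ.map (fun ω => (chOut X N snr ω, X' ω)) =
        μ.map (fun ω => (chOut X N snr ω, X ω)) := by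
      rw [← compProd_map_condDistrib hX'.aemeasurable, ← compProd_map_condDistrib hX.aemeasurable]
      exact Measure.compProd_congr hpost
    have h2 := congrArg (fun m => Measure.map Prod.snd m) h1
    rw [Measure.map_map measurable_snd (hY.prodMk hX'),
      Measure.map_map measurable_snd (hY.prodMk hX)] at h2
    exact h2
  have hX'2 : Integrable (fun ω => X' ω ^ 2) μ := by
    have : Integrable (fun t : ℝ => t ^ 2) (μ.map X') := by rw [hlawX']; exact hP2
    rw [integrable_map_measure (by fun_prop) hX'.aemeasurable] at this
    exact this
  have hN2 : Integrable (fun ω => N ω ^ 2) μ := by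
    have : Integrable (fun t : ℝ => t ^ 2) (μ.map N) := by rw [hN_law]; exact integrable_gauss_sq
    rw [integrable_map_measure (by fun_prop) hN.aemeasurable] at this
    exact this
  have mX : MemLp X 2 μ := (memLp_two_iff_integrable_sq hX.aestronglyMeasurable).mpr hX2
  have mX' : MemLp X' 2 μ := (memLp_two_iff_integrable_sq hX'.aestronglyMeasurable).mpr hX'2
  have mN : MemLp N 2 μ := (memLp_two_iff_integrable_sq hN.aestronglyMeasurable).mpr hN2
  have iXN : Integrable (fun ω => X ω * N ω) μ := mX.integrable_mul mN
  have iX'N : Integrable (fun ω => X' ω * N ω) μ := mX'.integrable_mul mN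
  have iD : Integrable (fun ω => (X ω - X' ω) ^ 2) μ := (mX.sub mX').integrable_sq
  set a := √snr with ha_def
  set P := μ.map X with hP_def
  set f : Ω → ℝ := fun ω => (a * X ω + N ω - a * X' ω) * (X ω - X' ω) with hf_def
  have hf_eq : f = (fun ω => X ω * N ω) - (fun ω => X' ω * N ω)
      + a • (fun ω => (X ω - X' ω) ^ 2) := by
    ext ω
    simp only [hf_def, Pi.add_apply, Pi.sub_apply, Pi.smul_apply, smul_eq_mul]
    ring
  have hf_int : Integrable f μ := by
    rw [hf_eq]; exact (iXN.sub iX'N).add (iD.smul a)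
  -- conditional expectation given `(Y, (X, N))`
  set K : Ω → ℝ × ℝ × ℝ := fun ω => (chOut X N snr ω, (X ω, N ω)) with hK_def
  have hK : Measurable K := hY.prodMk (hX.prodMk hN)
  have hcd : ∀ᵐ ω ∂μ, condDistrib X' K μ (K ω) = postK P a (chOut X N snr ω) := by
    have h1 := (condIndepFun_iff_condDistrib_prod_ae_eq_prodMkRight hX' (hX.prodMk hN) hY).mp
      hCI.symm
    have h1' := ae_of_ae_map hK.aemeasurable h1
    have h2 := ae_of_ae_map hY.aemeasurable hpost
    have h3 := ae_of_ae_map hY.aemeasurable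
      (condDistrib_eq_postK μ hX hN hXN hN_law hP2 snr)
    filter_upwards [h1', h2, h3] with ω h1 h2 h3
    rw [h1, Kernel.prodMkRight_apply, h2, h3]
  have hce1 : μ[f | MeasurableSpace.comap K inferInstance] =ᵐ[μ]
      fun ω => dnum P (X ω) a (N ω) / evid P a (a * X ω + N ω) := by
    have h1 := condExp_prod_ae_eq_integral_condDistrib (μ := μ) (X := K) (Y := X')
      (f := fun p : (ℝ × ℝ × ℝ) × ℝ => (a * p.1.2.1 + p.1.2.2 - a * p.2) * (p.1.2.1 - p.2))
      hK hX'.aemeasurable (Measurable.stronglyMeasurable (by fun_prop)) hf_int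
    filter_upwards [h1, hcd] with ω h1 h2
    refine h1.trans ?_
    rw [h2, integral_postK P hP2]
    rfl
  have hle : MeasurableSpace.comap X inferInstance ≤ MeasurableSpace.comap K inferInstance := by
    have : Measurable[MeasurableSpace.comap K inferInstance] X :=
      (measurable_fst.comp measurable_snd).comp (comap_measurable K)
    exact this.comap_le
  have hGi : Integrable (fun ω => dnum P (X ω) a (N ω) / evid P a (a * X ω + N ω)) μ :=
    integrable_condExp.congr hce1
  have hce2 := condExp_indep μ hX hN hXN hN_law _ (measurable_ratio P a) hGi
  have hce3 : μ[f | MeasurableSpace.comap X inferInstance] =ᵐ[μ]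
      fun ω => ∫ z, dnum P (X ω) a z / evid P a (a * X ω + z) ∂(gaussianReal 0 1) :=
    (condExp_condExp_of_le hle hK.comap_le).symm.trans
      ((condExp_congr_ae hce1).trans hce2)
  have hXN0 := condExp_indep μ hX hN hXN hN_law (fun p => p.1 * p.2) (by fun_prop) iXN
  have hlin : μ[f | MeasurableSpace.comap X inferInstance] =ᵐ[μ]
      μ[fun ω => X ω * N ω | MeasurableSpace.comap X inferInstance]
      - μ[fun ω => X' ω * N ω | MeasurableSpace.comap X inferInstance]
      + a • μ[fun ω => (X ω - X' ω) ^ 2 | MeasurableSpace.comap X inferInstance] := by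
    rw [hf_eq]
    refine (condExp_add (iXN.sub iX'N) (iD.smul a) _).trans ?_
    exact (condExp_sub iXN iX'N _).add (condExp_smul a _ _)
  filter_upwards [hce3, hXN0, hlin] with ω h3 h0 hl
  have hder := (hasDerivAt_D P hP2 (X ω) ha).comp snr (Real.hasDerivAt_sqrt hsnr.ne')
  have hfun : (fun s : ℝ =>
      (klDiv (gaussianReal (Real.sqrt s * X ω) 1) (μ.map (chOut X N s))).toReal) =
      (fun a => ∫ z, (-z ^ 2 / 2 - Real.log (evid P a (a * X ω + z))) ∂(gaussianReal 0 1))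
        ∘ Real.sqrt := by
    ext s
    exact toReal_klDiv_eq μ hX hN hXN hN_law hP2 s (X ω)
  rw [hfun]
  refine hder.congr_deriv ?_
  rw [← h3, hl]
  simp only [Pi.add_apply, Pi.sub_apply, Pi.smul_apply, smul_eq_mul]
  have h00 : ∫ z, X ω * z ∂(gaussianReal 0 1) = 0 := by
    rw [integral_const_mul, integral_id_gaussianReal, mul_zero]
  simp only [h00] at h0
  rw [h0, ← ha_def]
  field_simp
  ring
end
end

section
/- For every input distribution P_X with E[‖X‖^2] < ∞ and all snr_1, …, snr_K > 0, the partial derivative of the mutual information of the multiuser channel with respect to the k-th user's SNR is ∂/∂snr_k I(X; Y) = (1/2) Σ_{i=1}^{K} √(snr_i/snr_k) · [HᵀH]_{k i} · E[Cov(X_k, X_i | Y)], where Cov(X_k, X_i | Y) = E[X_k X_i | Y] − E[X_k | Y] · E[X_i | Y]. -/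
open MeasureTheory ProbabilityTheory Real Filter
open scoped ENNReal NNReal Topology

noncomputable section

/-- Output `Y = H S X + N` of the multiuser Gaussian channel, where
`S = diag(√snr₁, …, √snr_K)`. -/
def chOutMulti {Ω : Type*} {L K : ℕ} (H : Matrix (Fin L) (Fin K) ℝ) (X : Ω → Fin K → ℝ)
    (N : Ω → Fin L → ℝ) (snr : Fin K → ℝ) : Ω → Fin L → ℝ :=
  fun ω l => (∑ i, H l i * (Real.sqrt (snr i) * X ω i)) + N ω l

/-- Unnormalised Gaussian kernel. -/
def wk {L : ℕ} (z y : Fin L → ℝ) : ℝ := Real.exp (-((∑ l, (y l - z l) ^ 2) / 2))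

/-- Unnormalised output density. -/
def pd {Ω : Type*} [MeasurableSpace Ω] (μ : Measure Ω) {L : ℕ} (Z : Ω → Fin L → ℝ)
    (y : Fin L → ℝ) : ℝ := ∫ ω, wk (Z ω) y ∂μ

/-- Directional derivative of `-log pd`. -/
def Dn {Ω : Type*} [MeasurableSpace Ω] (μ : Measure Ω) {L : ℕ} (Z : Ω → Fin L → ℝ)
    (y v : Fin L → ℝ) : ℝ :=
  (∫ ω, (∑ l, (y l - Z ω l) * v l) * wk (Z ω) y ∂μ) / pd μ Z y

lemma wk_pos {L : ℕ} (z y : Fin L → ℝ) : 0 < wk z y := Real.exp_pos _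

lemma wk_le_one {L : ℕ} (z y : Fin L → ℝ) : wk z y ≤ 1 := by
  unfold wk
  apply Real.exp_le_one_iff.2
  have : 0 ≤ ∑ l, (y l - z l) ^ 2 := Finset.sum_nonneg fun _ _ => sq_nonneg _
  linarith

lemma wk_cont {L : ℕ} : Continuous (fun p : (Fin L → ℝ) × (Fin L → ℝ) => wk p.1 p.2) := by
  unfold wk; fun_prop

@[fun_prop]
lemma wk_meas {α : Type*} [MeasurableSpace α] {L : ℕ} {f g : α → Fin L → ℝ}
    (hf : Measurable f) (hg : Measurable g) : Measurable (fun a => wk (f a) (g a)) := by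
  unfold wk; fun_prop

section A
variable {Ω : Type*} [MeasurableSpace Ω] {μ : Measure Ω} [IsProbabilityMeasure μ] {L : ℕ}

lemma wk_int {Z : Ω → Fin L → ℝ} (hZ : Measurable Z) (y : Fin L → ℝ) :
    Integrable (fun ω => wk (Z ω) y) μ := by
  refine Integrable.of_bound (wk_meas hZ measurable_const).aestronglyMeasurable 1 ?_
  filter_upwards with ω
  rw [Real.norm_eq_abs, abs_of_pos (wk_pos _ _)]; exact wk_le_one _ _

lemma pd_pos {Z : Ω → Fin L → ℝ} (hZ : Measurable Z) (y : Fin L → ℝ) : 0 < pd μ Z y := by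
  have := wk_int (μ := μ) hZ y
  unfold pd wk at *
  exact integral_exp_pos this

lemma pd_le_one {Z : Ω → Fin L → ℝ} (hZ : Measurable Z) (y : Fin L → ℝ) : pd μ Z y ≤ 1 := by
  calc pd μ Z y ≤ ∫ _, (1:ℝ) ∂μ := integral_mono (wk_int hZ y) (integrable_const _)
        fun ω => wk_le_one _ _
    _ = 1 := by simp

lemma sub_sq_int {Z : Ω → Fin L → ℝ} (hZ : Measurable Z)
    (hZ2 : Integrable (fun ω => ∑ l, Z ω l ^ 2) μ) (y : Fin L → ℝ) :
    Integrable (fun ω => ∑ l, (y l - Z ω l) ^ 2) μ ∧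
    (∫ ω, (∑ l, (y l - Z ω l) ^ 2) ∂μ) ≤ 2 * (∑ l, y l ^ 2 + ∫ ω, ∑ l, Z ω l ^ 2 ∂μ) := by
  have hb : ∀ ω, ∑ l, (y l - Z ω l) ^ 2 ≤ 2 * (∑ l, y l ^ 2 + ∑ l, Z ω l ^ 2) := by
    intro ω
    rw [← Finset.sum_add_distrib, Finset.mul_sum]
    exact Finset.sum_le_sum fun l _ => by nlinarith [sq_nonneg (y l + Z ω l)]
  have hi : Integrable (fun ω => 2 * (∑ l, y l ^ 2 + ∑ l, Z ω l ^ 2)) μ :=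
    ((integrable_const _).add hZ2).const_mul 2
  have h1 : Integrable (fun ω => ∑ l, (y l - Z ω l) ^ 2) μ := by
    refine hi.mono' (by fun_prop) ?_
    filter_upwards with ω
    rw [Real.norm_eq_abs, abs_of_nonneg (Finset.sum_nonneg fun _ _ => sq_nonneg _)]
    exact hb ω
  refine ⟨h1, (integral_mono h1 hi hb).trans ?_⟩
  rw [integral_const_mul, integral_add (integrable_const _) hZ2]
  simp

lemma neglog_pd_nonneg {Z : Ω → Fin L → ℝ} (hZ : Measurable Z) (y : Fin L → ℝ) :
    0 ≤ - Real.log (pd μ Z y) := by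
  have := Real.log_nonpos (pd_pos (μ := μ) hZ y).le (pd_le_one hZ y)
  linarith

lemma neglog_pd_le {Z : Ω → Fin L → ℝ} (hZ : Measurable Z)
    (hZ2 : Integrable (fun ω => ∑ l, Z ω l ^ 2) μ) (y : Fin L → ℝ) :
    - Real.log (pd μ Z y) ≤ ∑ l, y l ^ 2 + ∫ ω, ∑ l, Z ω l ^ 2 ∂μ := by
  obtain ⟨h1, h2⟩ := sub_sq_int hZ hZ2 y
  set m : ℝ := (∫ ω, (∑ l, (y l - Z ω l) ^ 2) ∂μ) / 2 with hm
  have h3 : Real.exp (-m) ≤ pd μ Z y := by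
    have : ∀ ω, Real.exp (-m) * (1 + m - (∑ l, (y l - Z ω l) ^ 2) / 2) ≤ wk (Z ω) y := by
      intro ω
      unfold wk
      set g := (∑ l, (y l - Z ω l) ^ 2) / 2
      have e : Real.exp (-g) = Real.exp (-m) * Real.exp (m - g) := by
        rw [← Real.exp_add]; ring_nf
      rw [e]
      have := Real.add_one_le_exp (m - g)
      exact mul_le_mul_of_nonneg_left (by linarith) (Real.exp_pos _).le
    have hi : Integrable (fun ω => (1 + m - (∑ l, (y l - Z ω l) ^ 2) / 2)) μ :=
      (integrable_const _).sub (h1.div_const 2)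
    have h4 := integral_mono (hi.const_mul (Real.exp (-m))) (wk_int hZ y) this
    rw [integral_const_mul, integral_sub (integrable_const _) (h1.div_const 2),
      integral_div] at h4
    simpa [← hm, pd] using h4
  have h5 := Real.log_le_log (Real.exp_pos _) h3
  rw [Real.log_exp] at h5
  linarith

/-- Chebyshev association. -/
lemma sq_wk_le {Z : Ω → Fin L → ℝ} (hZ : Measurable Z)
    (hZ2 : Integrable (fun ω => ∑ l, Z ω l ^ 2) μ) (y : Fin L → ℝ) :
    Integrable (fun ω => (∑ l, (y l - Z ω l) ^ 2) * wk (Z ω) y) μ ∧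
    (∫ ω, (∑ l, (y l - Z ω l) ^ 2) * wk (Z ω) y ∂μ) ≤
      2 * (∑ l, y l ^ 2 + ∫ ω, ∑ l, Z ω l ^ 2 ∂μ) * pd μ Z y := by
  obtain ⟨h1, h2⟩ := sub_sq_int hZ hZ2 y
  set m : ℝ := ∫ ω, (∑ l, (y l - Z ω l) ^ 2) ∂μ with hm
  have hi : Integrable (fun ω => (∑ l, (y l - Z ω l) ^ 2) * wk (Z ω) y) μ := by
    refine h1.mono' ?_ ?_
    · exact (Measurable.mul (by fun_prop) (wk_meas hZ measurable_const)).aestronglyMeasurable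
    filter_upwards with ω
    have h0 : 0 ≤ ∑ l, (y l - Z ω l) ^ 2 := Finset.sum_nonneg fun _ _ => sq_nonneg _
    rw [Real.norm_eq_abs, abs_of_nonneg (mul_nonneg h0 (wk_pos _ _).le)]
    exact mul_le_of_le_one_right h0 (wk_le_one _ _)
  refine ⟨hi, ?_⟩
  have hp : ∀ ω, (∑ l, (y l - Z ω l) ^ 2) * wk (Z ω) y ≤
      m * wk (Z ω) y + ((∑ l, (y l - Z ω l) ^ 2) - m) * Real.exp (-(m / 2)) := by
    intro ω
    unfold wk
    set g := (∑ l, (y l - Z ω l) ^ 2)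
    have : (g - m) * (Real.exp (-(g/2)) - Real.exp (-(m/2))) ≤ 0 := by
      rcases le_total g m with h | h
      · exact mul_nonpos_of_nonpos_of_nonneg (by linarith)
          (sub_nonneg.2 (Real.exp_le_exp.2 (by linarith)))
      · exact mul_nonpos_of_nonneg_of_nonpos (by linarith)
          (sub_nonpos.2 (Real.exp_le_exp.2 (by linarith)))
    linarith
  have hi2 : Integrable (fun ω => m * wk (Z ω) y) μ := (wk_int hZ y).const_mul m
  have hi4 : Integrable (fun ω => ((∑ l, (y l - Z ω l) ^ 2) - m)) μ := h1.sub (integrable_const _)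
  have hi3 := hi4.mul_const (Real.exp (-(m / 2)))
  have h5 := integral_mono hi (hi2.add hi3) hp
  have h6 : ∫ ω, (m * wk (Z ω) y + ((∑ l, (y l - Z ω l) ^ 2) - m) * Real.exp (-(m / 2))) ∂μ
      = m * pd μ Z y := by
    rw [integral_add hi2 hi3, integral_mul_const, integral_const_mul,
      integral_sub h1 (integrable_const _)]
    simp [← hm, pd]
  refine (h5.trans_eq h6).trans ?_
  exact mul_le_mul_of_nonneg_right h2 (pd_pos hZ y).le

lemma abs_dot_le (b v : Fin L → ℝ) :
    |∑ l, b l * v l| ≤ (∑ l, b l ^ 2 + ∑ l, v l ^ 2) / 2 := by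
  refine (Finset.abs_sum_le_sum_abs _ _).trans ?_
  rw [← Finset.sum_add_distrib, Finset.sum_div]
  refine Finset.sum_le_sum fun l _ => ?_
  rw [abs_le]
  constructor <;> nlinarith [sq_nonneg (b l + v l), sq_nonneg (b l - v l)]

lemma dot_wk_bound (z y v : Fin L → ℝ) :
    |(∑ l, (y l - z l) * v l) * wk z y| ≤ 1 + (∑ l, v l ^ 2) / 2 := by
  rw [abs_mul, abs_of_pos (wk_pos _ _)]
  have h1 := abs_dot_le (fun l => y l - z l) v
  have h2 : (∑ l, (y l - z l) ^ 2) / 2 * wk z y ≤ 1 := by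
    unfold wk
    set g := (∑ l, (y l - z l) ^ 2) / 2
    rw [Real.exp_neg, ← div_eq_mul_inv, div_le_one (Real.exp_pos _)]
    linarith [Real.add_one_le_exp g]
  have h3 : (∑ l, v l ^ 2) / 2 * wk z y ≤ (∑ l, v l ^ 2) / 2 :=
    mul_le_of_le_one_right (by positivity) (wk_le_one _ _)
  have h4 := mul_le_mul_of_nonneg_right h1 (wk_pos z y).le
  nlinarith

lemma dot_wk_meas {Z : Ω → Fin L → ℝ} (hZ : Measurable Z) (y v : Fin L → ℝ) :
    Measurable (fun ω => (∑ l, (y l - Z ω l) * v l) * wk (Z ω) y) :=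
  Measurable.mul (by fun_prop) (wk_meas hZ measurable_const)

lemma dot_wk_int {Z : Ω → Fin L → ℝ} (hZ : Measurable Z) (y v : Fin L → ℝ) :
    Integrable (fun ω => (∑ l, (y l - Z ω l) * v l) * wk (Z ω) y) μ := by
  refine Integrable.of_bound (dot_wk_meas hZ y v).aestronglyMeasurable
    (1 + (∑ l, v l ^ 2) / 2) ?_
  filter_upwards with ω
  exact dot_wk_bound _ _ _

lemma Dn_bound {Z : Ω → Fin L → ℝ} (hZ : Measurable Z)
    (hZ2 : Integrable (fun ω => ∑ l, Z ω l ^ 2) μ) (y v : Fin L → ℝ) :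
    |Dn μ Z y v| ≤ ∑ l, y l ^ 2 + (∫ ω, ∑ l, Z ω l ^ 2 ∂μ) + (∑ l, v l ^ 2) / 2 := by
  unfold Dn
  have hp := pd_pos (μ := μ) hZ y
  rw [abs_div, abs_of_pos hp, div_le_iff₀ hp]
  obtain ⟨h1, h2⟩ := sq_wk_le hZ hZ2 y
  have h3 := (h1.div_const 2)
  have h4 := (wk_int (μ := μ) hZ y).const_mul ((∑ l, v l ^ 2) / 2)
  have h5 : |∫ ω, (∑ l, (y l - Z ω l) * v l) * wk (Z ω) y ∂μ| ≤
      ∫ ω, ((∑ l, (y l - Z ω l) ^ 2) * wk (Z ω) y / 2 + (∑ l, v l ^ 2) / 2 * wk (Z ω) y) ∂μ := by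
    refine (abs_integral_le_integral_abs).trans
      (integral_mono (dot_wk_int hZ y v).abs (h3.add h4) fun ω => ?_)
    rw [abs_mul, abs_of_pos (wk_pos _ _)]
    have h1 := abs_dot_le (fun l => y l - Z ω l) v
    have h4 := mul_le_mul_of_nonneg_right h1 (wk_pos (Z ω) y).le
    linarith
  rw [integral_add h3 h4, integral_div, integral_const_mul] at h5
  change _ ≤ _ + _ * pd μ Z y at h5
  linarith

lemma hasDerivAt_wk (z a v : Fin L → ℝ) (r : ℝ) :
    HasDerivAt (fun r : ℝ => wk z (fun l => a l + r * v l))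
      (-((∑ l, ((a l + r * v l) - z l) * v l) * wk z (fun l => a l + r * v l))) r := by
  unfold wk
  have h : HasDerivAt (fun r : ℝ => -((∑ l, (a l + r * v l - z l) ^ 2) / 2))
      (-((∑ l, (2 * ((a l + r * v l) - z l) * v l)) / 2)) r := by
    refine ((HasDerivAt.fun_sum fun l _ => ?_).div_const 2).neg
    have h := ((((hasDerivAt_id r).mul_const (v l)).const_add (a l)).sub_const (z l)).fun_pow 2
    simpa using h
  convert! h.exp using 1
  have : (∑ l, (2 * ((a l + r * v l) - z l) * v l)) / 2 = ∑ l, ((a l + r * v l) - z l) * v l := by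
    rw [Finset.sum_div]; exact Finset.sum_congr rfl fun l _ => by ring
  rw [this]; ring

lemma hasDerivAt_neglog_pd {Z : Ω → Fin L → ℝ} (hZ : Measurable Z) (a v : Fin L → ℝ) (r : ℝ) :
    HasDerivAt (fun r : ℝ => - Real.log (pd μ Z (fun l => a l + r * v l)))
      (Dn μ Z (fun l => a l + r * v l) v) r := by
  have h : HasDerivAt (fun r : ℝ => pd μ Z (fun l => a l + r * v l))
      (∫ ω, -((∑ l, ((a l + r * v l) - Z ω l) * v l) * wk (Z ω) (fun l => a l + r * v l)) ∂μ) r := by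
    refine (hasDerivAt_integral_of_dominated_loc_of_deriv_le (s := Set.univ)
      (F := fun r ω => wk (Z ω) (fun l => a l + r * v l))
      (F' := fun r ω => -((∑ l, ((a l + r * v l) - Z ω l) * v l)
        * wk (Z ω) (fun l => a l + r * v l)))
      (bound := fun _ => 1 + (∑ l, v l ^ 2) / 2) Filter.univ_mem ?_ ?_ ?_ ?_ ?_ ?_).2
    · exact Eventually.of_forall fun r => (wk_int hZ _).aestronglyMeasurable
    · exact wk_int hZ _
    · exact (dot_wk_int hZ _ _).neg.aestronglyMeasurable
    · filter_upwards with ω r _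
      rw [norm_neg]
      exact dot_wk_bound _ _ _
    · exact integrable_const _
    · filter_upwards with ω r _
      exact hasDerivAt_wk _ _ _ _
  have h2 := (h.log (pd_pos hZ _).ne').neg
  rw [integral_neg, neg_div, neg_neg] at h2
  exact h2

/-- joint continuity -/
lemma Dn_cont {U V : Ω → Fin L → ℝ} (hU : Measurable U) (hV : Measurable V)
    (a v : Fin L → ℝ) :
    Continuous (fun p : ℝ × ℝ =>
      Dn μ (fun ω l => U ω l + p.1 * V ω l) (fun l => a l + p.2 * v l) v) := by
  have hm : ∀ q : ℝ, Measurable (fun ω l => U ω l + q * V ω l) := by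
    intro q; fun_prop
  unfold Dn
  refine Continuous.div ?_ ?_ fun p => (pd_pos (hm _) _).ne'
  · refine continuous_of_dominated (bound := fun _ => 1 + (∑ l, v l ^ 2) / 2) ?_ ?_
      (integrable_const _) ?_
    · exact fun p => (dot_wk_meas (hm _) _ _).aestronglyMeasurable
    · intro p
      filter_upwards with ω
      exact dot_wk_bound _ _ _
    · filter_upwards with ω
      unfold wk; fun_prop
  · unfold pd
    refine continuous_of_dominated (bound := fun _ => 1) ?_ ?_
      (integrable_const _) ?_
    · exact fun p => (wk_int (hm _) _).aestronglyMeasurable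
    · intro p
      filter_upwards with ω
      rw [Real.norm_eq_abs, abs_of_pos (wk_pos _ _)]; exact wk_le_one _ _
    · filter_upwards with ω
      unfold wk; fun_prop

lemma pd_meas {Z : Ω → Fin L → ℝ} (hZ : Measurable Z) : Measurable (pd μ Z) := by
  unfold pd
  have : Measurable (fun p : (Fin L → ℝ) × Ω => wk (Z p.2) p.1) :=
    wk_meas (hZ.comp measurable_snd) measurable_fst
  exact (this.stronglyMeasurable.integral_prod_right').measurable

lemma Dn_meas {Z : Ω → Fin L → ℝ} (hZ : Measurable Z) :
    Measurable (fun p : (Fin L → ℝ) × (Fin L → ℝ) => Dn μ Z p.1 p.2) := by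
  unfold Dn
  refine Measurable.div ?_ ((pd_meas hZ).comp measurable_fst)
  have : Measurable (fun p : ((Fin L → ℝ) × (Fin L → ℝ)) × Ω =>
      (∑ l, (p.1.1 l - Z p.2 l) * p.1.2 l) * wk (Z p.2) p.1.1) := by
    refine Measurable.mul ?_
      (wk_meas (hZ.comp measurable_snd) (measurable_fst.comp measurable_fst))
    fun_prop
  exact (this.stronglyMeasurable.integral_prod_right').measurable

end A

/-- Envelope lemma. -/
lemma envelope (ψ G : ℝ → ℝ → ℝ) (h1 : ∀ q r, HasDerivAt (ψ q) (G q r) r)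
    (hmin : ∀ s q, ψ s s ≤ ψ q s) (s : ℝ) (hG : ContinuousAt (fun p : ℝ × ℝ => G p.1 p.2) (s, s)) :
    HasDerivAt (fun s => ψ s s) (G s s) s := by
  rw [hasDerivAt_iff_isLittleO, Asymptotics.isLittleO_iff]
  intro c hc
  rw [Metric.continuousAt_iff] at hG
  obtain ⟨δ, hδ, hG⟩ := hG c hc
  filter_upwards [Metric.ball_mem_nhds s hδ] with x hx
  have key : ∀ q ∈ Metric.ball s δ, |ψ q x - ψ q s - (x - s) * G s s| ≤ c * |x - s| := by
    intro q hq
    have := (convex_ball s δ).norm_image_sub_le_of_norm_hasDerivWithin_le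
      (f := fun r => ψ q r - r * G s s) (f' := fun r => G q r - G s s) (C := c)
      (x := s) (y := x) ?_ ?_ (Metric.mem_ball_self hδ) hx
    · simp only [Real.norm_eq_abs] at this
      convert! this using 2; ring
    · intro r hr
      have := (h1 q r).fun_sub ((hasDerivAt_id r).mul_const (G s s))
      simpa using this.hasDerivWithinAt
    · intro r hr
      have h := hG (x := (q, r)) (by
        rw [Prod.dist_eq]; exact max_lt hq hr)
      exact h.le
  have k1 := abs_le.1 (key s (Metric.mem_ball_self hδ))
  have k2 := abs_le.1 (key x hx)
  have m1 := hmin x s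
  have m2 := hmin s x
  simp only [smul_eq_mul, Real.norm_eq_abs]
  rw [abs_le]
  constructor <;> linarith [k1.1, k1.2, k2.1, k2.2]

/-- Normalising constant. -/
def cN (L : ℕ) : ℝ := ((√(2 * π))⁻¹) ^ L

lemma cN_pos (L : ℕ) : 0 < cN L := by unfold cN; positivity

lemma gaussPi (L : ℕ) : (Measure.pi fun _ : Fin L => gaussianReal 0 1) =
    (volume : Measure (Fin L → ℝ)).withDensity (fun n => ENNReal.ofReal (cN L * wk 0 n)) := by
  have hw : ∀ n : Fin L → ℝ, cN L * wk 0 n = ∏ l, gaussianPDFReal 0 1 (n l) := by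
    intro n
    unfold cN wk gaussianPDFReal
    rw [Finset.prod_mul_distrib, ← Real.exp_sum]
    simp [Finset.sum_div, neg_div]
  refine Measure.pi_eq fun s hs => ?_
  have hms : MeasurableSet (Set.univ.pi s) := MeasurableSet.univ_pi hs
  have hind : ∀ n : Fin L → ℝ, (Set.univ.pi s).indicator (fun n => cN L * wk 0 n) n =
      ∏ l, (s l).indicator (gaussianPDFReal 0 1) (n l) := by
    intro n
    by_cases h : n ∈ Set.univ.pi s
    · rw [Set.indicator_of_mem h, hw]
      exact Finset.prod_congr rfl fun l _ => by rw [Set.indicator_of_mem (h l trivial)]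
    · rw [Set.indicator_of_notMem h]
      simp only [Set.mem_univ_pi, not_forall] at h
      obtain ⟨l, hl⟩ := h
      exact (Finset.prod_eq_zero (Finset.mem_univ l) (Set.indicator_of_notMem hl _)).symm
  have hIntg : Integrable (fun n : Fin L → ℝ => cN L * wk 0 n) := by
    simp_rw [hw]
    exact Integrable.fintype_prod (f := fun _ => gaussianPDFReal 0 1)
      fun _ => integrable_gaussianPDFReal _ _
  rw [withDensity_apply _ hms, ← ofReal_integral_eq_lintegral_ofReal hIntg.integrableOn
    (Eventually.of_forall fun n => (mul_pos (cN_pos L) (wk_pos _ _)).le),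
    ← integral_indicator hms]
  simp_rw [hind]
  rw [integral_fintype_prod_volume_eq_prod (fun l => (s l).indicator (gaussianPDFReal 0 1)),
    ENNReal.ofReal_prod_of_nonneg]
  · refine Finset.prod_congr rfl fun l _ => ?_
    rw [gaussianReal_apply_eq_integral _ one_ne_zero, integral_indicator (hs l)]
  · intro l _
    exact integral_nonneg fun x => Set.indicator_nonneg (fun _ _ => gaussianPDFReal_nonneg _ _ _) _

section B
variable {Ω : Type*} [MeasurableSpace Ω] {μ : Measure Ω} [IsProbabilityMeasure μ] {L : ℕ}
  {α : Type*} [MeasurableSpace α] {X : Ω → α} {N : Ω → Fin L → ℝ} {g : α → Fin L → ℝ}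

lemma joint_law (hX : Measurable X) (hN : Measurable N) (hg : Measurable g)
    (hXN : IndepFun X N μ)
    (hN_law : μ.map N = Measure.pi fun _ : Fin L => gaussianReal 0 1) :
    μ.map (fun ω => (X ω, fun l => g (X ω) l + N ω l)) =
      ((μ.map X).prod volume).withDensity
        (fun p => ENNReal.ofReal (cN L * wk (g p.1) p.2)) := by
  have hT : Measurable (fun p : α × (Fin L → ℝ) => (p.1, fun l => g p.1 l + p.2 l)) := by
    fun_prop
  have hP : IsProbabilityMeasure (μ.map X) := Measure.isProbabilityMeasure_map hX.aemeasurable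
  have e1 : μ.map (fun ω => (X ω, fun l => g (X ω) l + N ω l)) =
      ((μ.map X).prod (μ.map N)).map (fun p => (p.1, fun l => g p.1 l + p.2 l)) := by
    rw [← (indepFun_iff_map_prod_eq_prod_map_map hX.aemeasurable hN.aemeasurable).1 hXN,
      Measure.map_map hT (hX.prodMk hN)]
    rfl
  have hwm : Measurable (fun p : α × (Fin L → ℝ) => ENNReal.ofReal (cN L * wk (g p.1) p.2)) :=
    ((wk_meas (hg.comp measurable_fst) measurable_snd).const_mul _).ennreal_ofReal
  have hw0 : Measurable (fun n : Fin L → ℝ => ENNReal.ofReal (cN L * wk 0 n)) :=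
    ((wk_meas measurable_const measurable_id).const_mul _).ennreal_ofReal
  rw [e1, hN_law, gaussPi]
  refine Measure.ext_of_lintegral _ fun f hf => ?_
  have hfT : Measurable (fun p : α × (Fin L → ℝ) => f (p.1, fun l => g p.1 l + p.2 l)) :=
    hf.comp hT
  rw [lintegral_map hf hT, prod_withDensity_right hw0,
    lintegral_withDensity_eq_lintegral_mul _ (by fun_prop) hfT,
    lintegral_withDensity_eq_lintegral_mul _ hwm hf,
    lintegral_prod _ (Measurable.aemeasurable (by fun_prop)),
    lintegral_prod _ (Measurable.aemeasurable (by fun_prop))]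
  refine lintegral_congr fun x => ?_
  symm
  rw [← lintegral_add_left_eq_self _ (g x)]
  refine lintegral_congr fun n => ?_
  simp only [Pi.mul_apply]
  congr 2
  unfold wk; simp

/-- the density of the output -/
lemma out_law (hX : Measurable X) (hN : Measurable N) (hg : Measurable g)
    (hXN : IndepFun X N μ)
    (hN_law : μ.map N = Measure.pi fun _ : Fin L => gaussianReal 0 1) :
    μ.map (fun ω l => g (X ω) l + N ω l) =
      (volume : Measure (Fin L → ℝ)).withDensity
        (fun y => ENNReal.ofReal (cN L * pd μ (fun ω => g (X ω)) y)) := by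
  have hP : IsProbabilityMeasure (μ.map X) := Measure.isProbabilityMeasure_map hX.aemeasurable
  have hY : Measurable (fun ω l => g (X ω) l + N ω l) := by fun_prop
  have hwm : Measurable (fun p : α × (Fin L → ℝ) => ENNReal.ofReal (cN L * wk (g p.1) p.2)) :=
    ((wk_meas (hg.comp measurable_fst) measurable_snd).const_mul _).ennreal_ofReal
  have e : μ.map (fun ω l => g (X ω) l + N ω l) =
      (μ.map (fun ω => (X ω, fun l => g (X ω) l + N ω l))).map Prod.snd := by
    rw [Measure.map_map measurable_snd (hX.prodMk hY)]; rfl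
  have hZ : Measurable (fun ω => g (X ω)) := hg.comp hX
  rw [e, joint_law hX hN hg hXN hN_law]
  refine Measure.ext_of_lintegral _ fun f hf => ?_
  have hpm : Measurable (fun y => ENNReal.ofReal (cN L * pd μ (fun ω => g (X ω)) y)) :=
    ((pd_meas hZ).const_mul _).ennreal_ofReal
  have hf2 : Measurable (fun p : α × (Fin L → ℝ) => f p.2) := hf.comp measurable_snd
  rw [lintegral_map hf measurable_snd,
    lintegral_withDensity_eq_lintegral_mul _ hwm hf2,
    lintegral_withDensity_eq_lintegral_mul _ hpm hf,
    lintegral_prod_symm _ (Measurable.aemeasurable (by fun_prop))]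
  refine lintegral_congr fun y => ?_
  simp only [Pi.mul_apply]
  rw [lintegral_mul_const _ (by fun_prop), lintegral_map (by fun_prop) hX]
  congr 1
  rw [← ofReal_integral_eq_lintegral_ofReal ((wk_int hZ y).const_mul _)
    (Eventually.of_forall fun n => (mul_pos (cN_pos L) (wk_pos _ _)).le), integral_const_mul]
  rfl

/-- joint law as density w.r.t. the product of marginals -/
lemma joint_law' (hX : Measurable X) (hN : Measurable N) (hg : Measurable g)
    (hXN : IndepFun X N μ)
    (hN_law : μ.map N = Measure.pi fun _ : Fin L => gaussianReal 0 1) :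
    μ.map (fun ω => (X ω, fun l => g (X ω) l + N ω l)) =
      ((μ.map X).prod (μ.map (fun ω l => g (X ω) l + N ω l))).withDensity
        (fun p => ENNReal.ofReal (wk (g p.1) p.2 / pd μ (fun ω => g (X ω)) p.2)) := by
  have hP : IsProbabilityMeasure (μ.map X) := Measure.isProbabilityMeasure_map hX.aemeasurable
  have hZ : Measurable (fun ω => g (X ω)) := hg.comp hX
  have hpm := pd_meas (μ := μ) hZ
  have hwm := wk_meas (hg.comp measurable_fst) (measurable_snd (α := α) (β := Fin L → ℝ))
  have hq : Measurable (fun p : α × (Fin L → ℝ) =>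
      ENNReal.ofReal (wk (g p.1) p.2 / pd μ (fun ω => g (X ω)) p.2)) :=
    (hwm.div (hpm.comp measurable_snd)).ennreal_ofReal
  rw [joint_law hX hN hg hXN hN_law, out_law hX hN hg hXN hN_law,
    prod_withDensity_right (by fun_prop), ← withDensity_mul _ (by fun_prop) hq]
  congr 1
  funext p
  simp only [Pi.mul_apply]
  have := pd_pos (μ := μ) hZ p.2
  rw [← ENNReal.ofReal_mul (mul_pos (cN_pos L) this).le]
  congr 1
  field_simp

lemma gibbs_ratio {g' : α → Fin L → ℝ} (hX : Measurable X) (hN : Measurable N) (hg : Measurable g)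
    (hg' : Measurable g') (hXN : IndepFun X N μ)
    (hN_law : μ.map N = Measure.pi fun _ : Fin L => gaussianReal 0 1) :
    Integrable (fun ω => pd μ (fun ω => g' (X ω)) (fun l => g (X ω) l + N ω l) /
      pd μ (fun ω => g (X ω)) (fun l => g (X ω) l + N ω l)) μ ∧
    ∫ ω, pd μ (fun ω => g' (X ω)) (fun l => g (X ω) l + N ω l) /
      pd μ (fun ω => g (X ω)) (fun l => g (X ω) l + N ω l) ∂μ = 1 := by
  have hZ : Measurable (fun ω => g (X ω)) := hg.comp hX
  have hZ' : Measurable (fun ω => g' (X ω)) := hg'.comp hX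
  have hY : Measurable (fun ω l => g (X ω) l + N ω l) := by fun_prop
  have hY' : Measurable (fun ω l => g' (X ω) l + N ω l) := by fun_prop
  have m1 := pd_meas (μ := μ) hZ
  have m2 := pd_meas (μ := μ) hZ'
  have hl : ∫⁻ ω, ENNReal.ofReal (pd μ (fun ω => g' (X ω)) (fun l => g (X ω) l + N ω l) /
      pd μ (fun ω => g (X ω)) (fun l => g (X ω) l + N ω l)) ∂μ = 1 := by
    have hq : Measurable (fun y => ENNReal.ofReal (pd μ (fun ω => g' (X ω)) y /
      pd μ (fun ω => g (X ω)) y)) := (m2.div m1).ennreal_ofReal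
    have h1 := lintegral_map (μ := μ) (f := fun y => ENNReal.ofReal (pd μ (fun ω => g' (X ω)) y /
      pd μ (fun ω => g (X ω)) y)) (m2.div m1).ennreal_ofReal hY
    rw [← h1, out_law hX hN hg hXN hN_law,
      lintegral_withDensity_eq_lintegral_mul _ (by fun_prop) hq]
    have h2 : (μ.map (fun ω l => g' (X ω) l + N ω l)) Set.univ = 1 := by
      rw [Measure.map_apply hY' MeasurableSet.univ]; simp
    rw [out_law hX hN hg' hXN hN_law, withDensity_apply _ MeasurableSet.univ,
      Measure.restrict_univ] at h2
    rw [← h2]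
    refine lintegral_congr fun y => ?_
    simp only [Pi.mul_apply]
    have := pd_pos (μ := μ) hZ y
    rw [← ENNReal.ofReal_mul (mul_pos (cN_pos L) this).le]
    congr 1
    field_simp
  have hnn : ∀ ω, 0 ≤ pd μ (fun ω => g' (X ω)) (fun l => g (X ω) l + N ω l) /
      pd μ (fun ω => g (X ω)) (fun l => g (X ω) l + N ω l) :=
    fun ω => (div_pos (pd_pos hZ' _) (pd_pos hZ _)).le
  have hm : Measurable (fun ω => pd μ (fun ω => g' (X ω)) (fun l => g (X ω) l + N ω l) /
      pd μ (fun ω => g (X ω)) (fun l => g (X ω) l + N ω l)) :=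
    (m2.comp hY).div (m1.comp hY)
  refine ⟨(lintegral_ofReal_ne_top_iff_integrable hm.aestronglyMeasurable
    (Eventually.of_forall hnn)).1 (by rw [hl]; simp), ?_⟩
  rw [integral_eq_lintegral_of_nonneg_ae (Eventually.of_forall hnn) hm.aestronglyMeasurable, hl]
  simp

/-- Bayes formula for the conditional expectation -/
lemma condExp_bayes (hX : Measurable X) (hN : Measurable N) (hg : Measurable g)
    (hXN : IndepFun X N μ)
    (hN_law : μ.map N = Measure.pi fun _ : Fin L => gaussianReal 0 1)
    {f : α → ℝ} (hf : Measurable f) (hfi : Integrable (fun ω => f (X ω)) μ) :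
    (fun ω => (∫ ω', f (X ω') * wk (g (X ω')) (fun l => g (X ω) l + N ω l) ∂μ) /
      pd μ (fun ω => g (X ω)) (fun l => g (X ω) l + N ω l)) =ᵐ[μ]
    μ[fun ω => f (X ω) | MeasurableSpace.comap (fun ω l => g (X ω) l + N ω l) inferInstance] := by
  have hP : IsProbabilityMeasure (μ.map X) := Measure.isProbabilityMeasure_map hX.aemeasurable
  have hZ : Measurable (fun ω => g (X ω)) := hg.comp hX
  have hY : Measurable (fun ω l => g (X ω) l + N ω l) := by fun_prop
  have m1 := pd_meas (μ := μ) hZ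
  set Y : Ω → Fin L → ℝ := fun ω l => g (X ω) l + N ω l with hYdef
  set num : (Fin L → ℝ) → ℝ := fun y => ∫ ω', f (X ω') * wk (g (X ω')) y ∂μ with hnum
  have mnum : Measurable num := by
    have : Measurable (fun p : (Fin L → ℝ) × Ω => f (X p.2) * wk (g (X p.2)) p.1) :=
      ((hf.comp hX).comp measurable_snd).mul (wk_meas (hZ.comp measurable_snd) measurable_fst)
    exact (this.stronglyMeasurable.integral_prod_right').measurable
  have hwm := wk_meas (hg.comp measurable_fst) (measurable_snd (α := α) (β := Fin L → ℝ))
  have hdm : Measurable (fun p : α × (Fin L → ℝ) => ENNReal.ofReal (cN L * wk (g p.1) p.2)) :=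
    (hwm.const_mul _).ennreal_ofReal
  have hpm : Measurable (fun y => ENNReal.ofReal (cN L * pd μ (fun ω => g (X ω)) y)) :=
    (m1.const_mul _).ennreal_ofReal
  -- integral against joint law
  have hnumP : ∀ y, num y = ∫ x, f x * wk (g x) y ∂(μ.map X) := by
    intro y
    have : Measurable (fun x => f x * wk (g x) y) := hf.mul (wk_meas hg measurable_const)
    rw [integral_map hX.aemeasurable this.aestronglyMeasurable]
  have J : Integrable (fun p : α × (Fin L → ℝ) => cN L * wk (g p.1) p.2 * f p.1)
      ((μ.map X).prod volume) := by
    have h1 : Integrable (fun p : α × (Fin L → ℝ) => f p.1) (μ.map (fun ω => (X ω, Y ω))) :=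
      (integrable_map_measure (hf.comp measurable_fst).aestronglyMeasurable
        (hX.prodMk hY).aemeasurable).2 hfi
    rw [hYdef, joint_law hX hN hg hXN hN_law, integrable_withDensity_iff_integrable_smul' hdm
      (Eventually.of_forall fun _ => ENNReal.ofReal_lt_top)] at h1
    refine h1.congr (Eventually.of_forall fun p => ?_)
    simp [ENNReal.toReal_ofReal (mul_pos (cN_pos L) (wk_pos _ _)).le]
  have Jy : ∀ y, ∫ x, cN L * wk (g x) y * f x ∂(μ.map X) = cN L * num y := by
    intro y
    rw [hnumP, ← integral_const_mul]
    congr 1; funext x; ring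
  have hIntg : Integrable (fun ω => num (Y ω) / pd μ (fun ω => g (X ω)) (Y ω)) μ := by
    have h1 : Integrable (fun y => num y / pd μ (fun ω => g (X ω)) y) (μ.map Y) := by
      rw [out_law hX hN hg hXN hN_law, integrable_withDensity_iff_integrable_smul' hpm
        (Eventually.of_forall fun _ => ENNReal.ofReal_lt_top)]
      have h2 := J.integral_prod_right
      refine h2.congr (Eventually.of_forall fun y => ?_)
      have := pd_pos (μ := μ) hZ y
      simp only [smul_eq_mul]
      rw [ENNReal.toReal_ofReal (mul_pos (cN_pos L) this).le, Jy]
      field_simp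
    exact (integrable_map_measure (mnum.div m1).aestronglyMeasurable hY.aemeasurable).1 h1
  refine ae_eq_condExp_of_forall_setIntegral_eq hY.comap_le hfi (fun s _ _ => hIntg.integrableOn)
    ?_ ?_
  · rintro s ⟨B, hB, rfl⟩ -
    have l1 : ∫ ω in Y ⁻¹' B, num (Y ω) / pd μ (fun ω => g (X ω)) (Y ω) ∂μ =
        ∫ y in B, cN L * num y := by
      rw [← setIntegral_map (f := fun y => num y / pd μ (fun ω => g (X ω)) y) hB
        (mnum.div m1).aestronglyMeasurable hY.aemeasurable, out_law hX hN hg hXN hN_law,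
        restrict_withDensity hB, integral_withDensity_eq_integral_toReal_smul hpm
        (Eventually.of_forall fun _ => ENNReal.ofReal_lt_top)]
      refine integral_congr_ae (Eventually.of_forall fun y => ?_)
      have := pd_pos (μ := μ) hZ y
      simp only [smul_eq_mul]
      rw [ENNReal.toReal_ofReal (mul_pos (cN_pos L) this).le]
      field_simp
    have l2 : ∫ ω in Y ⁻¹' B, f (X ω) ∂μ = ∫ y in B, cN L * num y := by
      have e : Y ⁻¹' B = (fun ω => (X ω, Y ω)) ⁻¹' (Set.univ ×ˢ B) := by ext; simp
      have hB' : MeasurableSet ((Set.univ : Set α) ×ˢ B) := MeasurableSet.univ.prod hB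
      rw [e, ← setIntegral_map (f := fun p : α × (Fin L → ℝ) => f p.1) hB'
        (hf.comp measurable_fst).aestronglyMeasurable (hX.prodMk hY).aemeasurable,
        joint_law hX hN hg hXN hN_law, restrict_withDensity hB',
        integral_withDensity_eq_integral_toReal_smul hdm
        (Eventually.of_forall fun _ => ENNReal.ofReal_lt_top), ← Measure.prod_restrict,
        Measure.restrict_univ]
      simp only [ENNReal.toReal_ofReal (mul_pos (cN_pos L) (wk_pos _ _)).le, smul_eq_mul]
      rw [integral_prod_symm]
      · exact integral_congr_ae (Eventually.of_forall fun y => Jy y)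
      · have := J.mono_measure (Measure.restrict_le_self (s := (Set.univ : Set α) ×ˢ B))
        rwa [← Measure.prod_restrict, Measure.restrict_univ] at this
    rw [l1, l2]
  · have : Measurable[MeasurableSpace.comap Y inferInstance]
      (fun ω => num (Y ω) / pd μ (fun ω => g (X ω)) (Y ω)) :=
      (mnum.div m1).comp (comap_measurable Y)
    exact this.stronglyMeasurable.aestronglyMeasurable

end B

section C
variable {Ω : Type*} [MeasurableSpace Ω] {μ : Measure Ω} [IsProbabilityMeasure μ] {L : ℕ}
  {α : Type*} [MeasurableSpace α] {X : Ω → α} {N : Ω → Fin L → ℝ} {g : α → Fin L → ℝ}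

lemma sq_add_le (a b : Fin L → ℝ) (r R : ℝ) (hr : |r| ≤ R) :
    ∑ l, (a l + r * b l) ^ 2 ≤ 2 * ∑ l, a l ^ 2 + 2 * R ^ 2 * ∑ l, b l ^ 2 := by
  rw [Finset.mul_sum, Finset.mul_sum, ← Finset.sum_add_distrib]
  refine Finset.sum_le_sum fun l _ => ?_
  have h : r ^ 2 ≤ R ^ 2 := sq_le_sq' (by linarith [abs_le.1 hr]) (abs_le.1 hr).2
  nlinarith [sq_nonneg (a l - r * b l), mul_le_mul_of_nonneg_right h (sq_nonneg (b l))]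

lemma sq_add_int {A B : Ω → Fin L → ℝ} (hA : Measurable A) (hB : Measurable B)
    (hA2 : Integrable (fun ω => ∑ l, A ω l ^ 2) μ) (hB2 : Integrable (fun ω => ∑ l, B ω l ^ 2) μ)
    (r : ℝ) : Integrable (fun ω => ∑ l, (A ω l + r * B ω l) ^ 2) μ := by
  refine ((hA2.const_mul 2).add (hB2.const_mul (2 * |r| ^ 2))).mono' (by fun_prop) ?_
  filter_upwards with ω
  rw [Real.norm_eq_abs, abs_of_nonneg (Finset.sum_nonneg fun _ _ => sq_nonneg _)]
  exact sq_add_le _ _ _ _ le_rfl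

lemma N_memLp (hN : Measurable N)
    (hN_law : μ.map N = Measure.pi fun _ : Fin L => gaussianReal 0 1) (l : Fin L) :
    MemLp (fun ω => N ω l) 2 μ ∧ ∫ ω, N ω l ∂μ = 0 := by
  have hl : μ.map (fun ω => N ω l) = gaussianReal 0 1 := by
    have h := (measurePreserving_eval (fun _ : Fin L => gaussianReal 0 1) l).map_eq
    rw [← hN_law, Measure.map_map (measurable_pi_apply l) hN] at h
    exact h
  have hNl : Measurable (fun ω => N ω l) := by fun_prop
  constructor
  · have h := memLp_id_gaussianReal' (μ := 0) (v := 1) 2 (by simp)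
    rw [← hl] at h
    exact (memLp_map_measure_iff aestronglyMeasurable_id hNl.aemeasurable).1 h
  · have h := integral_id_gaussianReal (μ := 0) (v := 1)
    rw [← hl, integral_map hNl.aemeasurable measurable_id'.aestronglyMeasurable] at h
    exact h

lemma N_sq_int (hN : Measurable N)
    (hN_law : μ.map N = Measure.pi fun _ : Fin L => gaussianReal 0 1) :
    Integrable (fun ω => ∑ l, N ω l ^ 2) μ :=
  integrable_finsetSum _ fun l _ => (N_memLp hN hN_law l).1.integrable_sq

lemma neglog_int {Z Y : Ω → Fin L → ℝ} (hZ : Measurable Z) (hY : Measurable Y)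
    (hZ2 : Integrable (fun ω => ∑ l, Z ω l ^ 2) μ) (hY2 : Integrable (fun ω => ∑ l, Y ω l ^ 2) μ) :
    Integrable (fun ω => - Real.log (pd μ Z (Y ω))) μ := by
  refine (hY2.add (integrable_const (∫ ω, ∑ l, Z ω l ^ 2 ∂μ))).mono' ?_ ?_
  · exact ((Real.measurable_log.comp ((pd_meas hZ).comp hY)).neg).aestronglyMeasurable
  · filter_upwards with ω
    rw [Real.norm_eq_abs, abs_of_nonneg (neglog_pd_nonneg hZ _)]
    exact neglog_pd_le hZ hZ2 _

lemma mutualInfo_eq_s7 (hX : Measurable X) (hN : Measurable N) (hg : Measurable g)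
    (hXN : IndepFun X N μ)
    (hN_law : μ.map N = Measure.pi fun _ : Fin L => gaussianReal 0 1)
    (hg2 : Integrable (fun ω => ∑ l, g (X ω) l ^ 2) μ) :
    (mutualInfo μ X (fun ω l => g (X ω) l + N ω l)).toReal =
      (∫ ω, -((∑ l, N ω l ^ 2) / 2) ∂μ) +
      ∫ ω, - Real.log (pd μ (fun ω => g (X ω)) (fun l => g (X ω) l + N ω l)) ∂μ := by
  have hZ : Measurable (fun ω => g (X ω)) := hg.comp hX
  have hY : Measurable (fun ω l => g (X ω) l + N ω l) := by fun_prop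
  have hN2 := N_sq_int hN hN_law
  have hY2 : Integrable (fun ω => ∑ l, (g (X ω) l + N ω l) ^ 2) μ := by
    simpa using sq_add_int hZ hN hg2 hN2 1
  have i1 : Integrable (fun ω => -((∑ l, N ω l ^ 2) / 2)) μ := (hN2.div_const 2).neg
  have i2 := neglog_int hZ hY hg2 hY2
  have hP : IsProbabilityMeasure (μ.map X) := Measure.isProbabilityMeasure_map hX.aemeasurable
  have hPY : IsProbabilityMeasure (μ.map (fun ω l => g (X ω) l + N ω l)) :=
    Measure.isProbabilityMeasure_map hY.aemeasurable
  have hPJ : IsProbabilityMeasure (μ.map (fun ω => (X ω, fun l => g (X ω) l + N ω l))) :=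
    Measure.isProbabilityMeasure_map (hX.prodMk hY).aemeasurable
  have hJ := joint_law' hX hN hg hXN hN_law
  have hpm := pd_meas (μ := μ) hZ
  have hq : Measurable (fun p : α × (Fin L → ℝ) =>
      ENNReal.ofReal (wk (g p.1) p.2 / pd μ (fun ω => g (X ω)) p.2)) := by fun_prop
  have hac : μ.map (fun ω => (X ω, fun l => g (X ω) l + N ω l)) ≪
      (μ.map X).prod (μ.map (fun ω l => g (X ω) l + N ω l)) := by
    rw [hJ]; exact withDensity_absolutelyContinuous _ _
  have hrn := Measure.rnDeriv_withDensity
    ((μ.map X).prod (μ.map (fun ω l => g (X ω) l + N ω l))) hq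
  rw [← hJ] at hrn
  have hllr : llr (μ.map (fun ω => (X ω, fun l => g (X ω) l + N ω l)))
      ((μ.map X).prod (μ.map (fun ω l => g (X ω) l + N ω l)))
      =ᵐ[μ.map (fun ω => (X ω, fun l => g (X ω) l + N ω l))]
      fun p => -((∑ l, (p.2 l - g p.1 l) ^ 2) / 2)
        + - Real.log (pd μ (fun ω => g (X ω)) p.2) := by
    filter_upwards [hac.ae_le hrn] with p hp
    have h0 := pd_pos (μ := μ) hZ p.2
    rw [llr, hp, ENNReal.toReal_ofReal (div_pos (wk_pos _ _) h0).le,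
      Real.log_div (wk_pos _ _).ne' h0.ne', wk, Real.log_exp]
    ring
  have hm : Measurable (fun p : α × (Fin L → ℝ) => -((∑ l, (p.2 l - g p.1 l) ^ 2) / 2)
        + - Real.log (pd μ (fun ω => g (X ω)) p.2)) := by
    have : Measurable (fun p : α × (Fin L → ℝ) => Real.log (pd μ (fun ω => g (X ω)) p.2)) :=
      Real.measurable_log.comp (hpm.comp measurable_snd)
    fun_prop
  have e1 : ∀ ω, (-((∑ l, ((g (X ω) l + N ω l) - g (X ω) l) ^ 2) / 2)
        + - Real.log (pd μ (fun ω => g (X ω)) (fun l => g (X ω) l + N ω l))) =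
      -((∑ l, N ω l ^ 2) / 2)
        + - Real.log (pd μ (fun ω => g (X ω)) (fun l => g (X ω) l + N ω l)) := by
    intro ω; simp
  have hIntg : Integrable (llr (μ.map (fun ω => (X ω, fun l => g (X ω) l + N ω l)))
      ((μ.map X).prod (μ.map (fun ω l => g (X ω) l + N ω l))))
      (μ.map (fun ω => (X ω, fun l => g (X ω) l + N ω l))) := by
    rw [integrable_congr hllr, integrable_map_measure hm.aestronglyMeasurable
      (hX.prodMk hY).aemeasurable]
    refine (i1.add i2).congr (Eventually.of_forall fun ω => ?_)
    exact (e1 ω).symm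
  have hnn := InformationTheory.integral_llr_add_sub_measure_univ_nonneg hac hIntg
  simp only [probReal_univ, add_sub_cancel_right] at hnn
  unfold mutualInfo klDiv
  rw [if_pos ⟨hac, hIntg⟩, ENNReal.toReal_ofReal hnn, integral_congr_ae hllr,
    integral_map (hX.prodMk hY).aemeasurable hm.aestronglyMeasurable]
  simp only [e1]
  exact integral_add i1 i2

set_option maxHeartbeats 2000000 in
/-- Derivative of the mutual information along a line of gains. -/
lemma deriv_line {u v : α → Fin L → ℝ} (hX : Measurable X) (hN : Measurable N)
    (hu : Measurable u) (hv : Measurable v) (hXN : IndepFun X N μ)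
    (hN_law : μ.map N = Measure.pi fun _ : Fin L => gaussianReal 0 1)
    (hu2 : Integrable (fun ω => ∑ l, u (X ω) l ^ 2) μ)
    (hv2 : Integrable (fun ω => ∑ l, v (X ω) l ^ 2) μ) (s : ℝ) :
    HasDerivAt (fun s => (mutualInfo μ X
        (fun ω l => (u (X ω) l + s * v (X ω) l) + N ω l)).toReal)
      (∫ ω, Dn μ (fun ω l => u (X ω) l + s * v (X ω) l)
        (fun l => (u (X ω) l + N ω l) + s * v (X ω) l) (v (X ω)) ∂μ) s := by
  have hgm : ∀ q : ℝ, Measurable (fun x l => u x l + q * v x l) := fun q => by fun_prop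
  have hU : Measurable (fun ω => u (X ω)) := hu.comp hX
  have hV : Measurable (fun ω => v (X ω)) := hv.comp hX
  have hZ : ∀ q : ℝ, Measurable (fun ω l => u (X ω) l + q * v (X ω) l) := fun q => by fun_prop
  have hZ2 : ∀ q : ℝ, Integrable (fun ω => ∑ l, (u (X ω) l + q * v (X ω) l) ^ 2) μ :=
    fun q => sq_add_int hU hV hu2 hv2 q
  have hN2 := N_sq_int hN hN_law
  have hA : Measurable (fun ω l => u (X ω) l + N ω l) := by fun_prop
  have hA2 : Integrable (fun ω => ∑ l, (u (X ω) l + N ω l) ^ 2) μ := by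
    simpa using sq_add_int hU hN hu2 hN2 1
  have hY : ∀ r : ℝ, Measurable (fun ω l => (u (X ω) l + N ω l) + r * v (X ω) l) :=
    fun r => by fun_prop
  have hY2 : ∀ r : ℝ, Integrable (fun ω => ∑ l, ((u (X ω) l + N ω l) + r * v (X ω) l) ^ 2) μ :=
    fun r => sq_add_int hA hV hA2 hv2 r
  have hYe : ∀ (r : ℝ) ω, (fun l => (u (X ω) l + r * v (X ω) l) + N ω l) =
      (fun l => (u (X ω) l + N ω l) + r * v (X ω) l) := by
    intro r ω; funext l; ring
  have hDm : ∀ q r : ℝ, Measurable (fun ω => Dn μ (fun ω l => u (X ω) l + q * v (X ω) l)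
        (fun l => (u (X ω) l + N ω l) + r * v (X ω) l) (v (X ω))) := fun q r =>
    (Dn_meas (hZ q)).comp ((hY r).prodMk hV)
  set ψ : ℝ → ℝ → ℝ := fun q r => ∫ ω, - Real.log (pd μ (fun ω l => u (X ω) l + q * v (X ω) l)
    (fun l => (u (X ω) l + N ω l) + r * v (X ω) l)) ∂μ with hψ
  set G : ℝ → ℝ → ℝ := fun q r => ∫ ω, Dn μ (fun ω l => u (X ω) l + q * v (X ω) l)
        (fun l => (u (X ω) l + N ω l) + r * v (X ω) l) (v (X ω)) ∂μ with hG
  have hI : ∀ s, (mutualInfo μ X (fun ω l => (u (X ω) l + s * v (X ω) l) + N ω l)).toReal =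
      (∫ ω, -((∑ l, N ω l ^ 2) / 2) ∂μ) + ψ s s := by
    intro s
    rw [mutualInfo_eq_s7 (g := fun x l => u x l + s * v x l) hX hN (hgm s) hXN hN_law (hZ2 s)]
    simp only [hYe, hψ]
  simp only [hI]
  refine HasDerivAt.const_add _ ?_
  refine envelope ψ G ?_ ?_ s ?_
  · intro q r
    refine (hasDerivAt_integral_of_dominated_loc_of_deriv_le (s := Metric.ball r 1)
      (bound := fun ω => (2 * ∑ l, (u (X ω) l + N ω l) ^ 2
          + 2 * (|r| + 1) ^ 2 * ∑ l, v (X ω) l ^ 2)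
        + (∫ ω, ∑ l, (u (X ω) l + q * v (X ω) l) ^ 2 ∂μ) + (∑ l, v (X ω) l ^ 2) / 2)
      (F' := fun r ω => Dn μ (fun ω l => u (X ω) l + q * v (X ω) l)
        (fun l => (u (X ω) l + N ω l) + r * v (X ω) l) (v (X ω)))
      (Metric.ball_mem_nhds r one_pos) ?_ ?_ ?_ ?_ ?_ ?_).2
    · exact Eventually.of_forall fun r =>
        (neglog_int (hZ q) (hY r) (hZ2 q) (hY2 r)).aestronglyMeasurable
    · exact neglog_int (hZ q) (hY r) (hZ2 q) (hY2 r)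
    · exact (hDm q r).aestronglyMeasurable
    · filter_upwards with ω x hx
      have h1 := Dn_bound (hZ q) (hZ2 q) (fun l => (u (X ω) l + N ω l) + x * v (X ω) l) (v (X ω))
      have hx' : |x| ≤ |r| + 1 := by
        rw [Metric.mem_ball, Real.dist_eq] at hx
        have := abs_add_le (x - r) r
        rw [sub_add_cancel] at this
        linarith
      have h2 := sq_add_le (fun l => u (X ω) l + N ω l) (v (X ω)) x _ hx'
      rw [Real.norm_eq_abs]
      linarith
    · exact (((hA2.const_mul 2).add (hv2.const_mul _)).add (integrable_const _)).add
        (hv2.div_const 2)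
    · filter_upwards with ω x _
      exact hasDerivAt_neglog_pd (hZ q) _ _ _
  · intro s q
    obtain ⟨r1, r2⟩ := gibbs_ratio (g := fun x l => u x l + s * v x l)
      (g' := fun x l => u x l + q * v x l) hX hN (hgm s) (hgm q) hXN hN_law
    simp only [hYe] at r1 r2
    have j1 := neglog_int (hZ s) (hY s) (hZ2 s) (hY2 s)
    have j2 := neglog_int (hZ q) (hY s) (hZ2 q) (hY2 s)
    have h := integral_mono (j1.sub j2) (r1.sub (integrable_const 1)) (fun ω => by
      have p1 := pd_pos (μ := μ) (hZ s) (fun l => (u (X ω) l + N ω l) + s * v (X ω) l)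
      have p2 := pd_pos (μ := μ) (hZ q) (fun l => (u (X ω) l + N ω l) + s * v (X ω) l)
      have := Real.log_le_sub_one_of_pos (div_pos p2 p1)
      rw [Real.log_div p2.ne' p1.ne'] at this
      simp only [Pi.sub_apply]
      linarith)
    simp only [Pi.sub_apply] at h
    rw [integral_sub j1 j2, integral_sub r1 (integrable_const 1), r2] at h
    simp only [integral_const, probReal_univ, smul_eq_mul, mul_one, sub_self] at h
    simp only [hψ]
    linarith
  · refine continuousAt_of_dominated
      (bound := fun ω => (2 * ∑ l, (u (X ω) l + N ω l) ^ 2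
          + 2 * (|s| + 1) ^ 2 * ∑ l, v (X ω) l ^ 2)
        + (2 * (∫ ω, ∑ l, u (X ω) l ^ 2 ∂μ)
          + 2 * (|s| + 1) ^ 2 * ∫ ω, ∑ l, v (X ω) l ^ 2 ∂μ) + (∑ l, v (X ω) l ^ 2) / 2)
      ?_ ?_ ?_ ?_
    · exact Eventually.of_forall fun p => (hDm p.1 p.2).aestronglyMeasurable
    · filter_upwards [Metric.ball_mem_nhds (s, s) one_pos] with p hp
      filter_upwards with ω
      have hb : ∀ x : ℝ, dist x s < 1 → |x| ≤ |s| + 1 := by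
        intro x hx
        rw [Real.dist_eq] at hx
        have := abs_add_le (x - s) s
        rw [sub_add_cancel] at this
        linarith
      rw [Metric.mem_ball, Prod.dist_eq, max_lt_iff] at hp
      have h1 := Dn_bound (hZ p.1) (hZ2 p.1)
        (fun l => (u (X ω) l + N ω l) + p.2 * v (X ω) l) (v (X ω))
      have h2 := sq_add_le (fun l => u (X ω) l + N ω l) (v (X ω)) p.2 _ (hb _ hp.2)
      have h3 : (∫ ω, ∑ l, (u (X ω) l + p.1 * v (X ω) l) ^ 2 ∂μ) ≤
          2 * (∫ ω, ∑ l, u (X ω) l ^ 2 ∂μ)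
          + 2 * (|s| + 1) ^ 2 * ∫ ω, ∑ l, v (X ω) l ^ 2 ∂μ := by
        have := integral_mono (hZ2 p.1) ((hu2.const_mul 2).add (hv2.const_mul (2 * (|s| + 1) ^ 2)))
          fun ω => sq_add_le (u (X ω)) (v (X ω)) p.1 _ (hb _ hp.1)
        simp only [Pi.add_apply] at this
        rwa [integral_add (hu2.const_mul 2) (hv2.const_mul _), integral_const_mul,
          integral_const_mul] at this
      rw [Real.norm_eq_abs]
      linarith
    · exact (((hA2.const_mul 2).add (hv2.const_mul _)).add (integrable_const _)).add
        (hv2.div_const 2)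
    · filter_upwards with ω
      exact (Dn_cont hU hV (fun l => u (X ω) l + N ω l) (v (X ω))).continuousAt

end C

section D
variable {Ω : Type*} [MeasurableSpace Ω] {μ : Measure Ω} [IsProbabilityMeasure μ] {L K : ℕ}

lemma mul_wk_int {Z : Ω → Fin L → ℝ} (hZ : Measurable Z) {A : Ω → ℝ} (hA : Integrable A μ)
    (y : Fin L → ℝ) : Integrable (fun ω => A ω * wk (Z ω) y) μ := by
  refine hA.mul_bdd (c := 1) (wk_meas hZ measurable_const).aestronglyMeasurable (ae_of_all _ fun ω => ?_)
  rw [Real.norm_eq_abs, abs_of_pos (wk_pos _ _)]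
  exact wk_le_one _ _

lemma Dn_expand {a : Fin L → Fin K → ℝ} {X : Ω → Fin K → ℝ} (hX : Measurable X)
    (hXi : ∀ i, Integrable (fun ω => X ω i) μ) (y v : Fin L → ℝ) :
    Dn μ (fun ω l => ∑ i, a l i * X ω i) y v =
      ∑ l, v l * (y l - ∑ i, a l i * ((∫ ω, X ω i * wk (fun l => ∑ i, a l i * X ω i) y ∂μ) /
        pd μ (fun ω l => ∑ i, a l i * X ω i) y)) := by
  have hZ : Measurable (fun ω l => ∑ i, a l i * X ω i) := by fun_prop
  have hp := pd_pos (μ := μ) hZ y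
  have h1 : ∀ i, Integrable (fun ω => X ω i * wk (fun l => ∑ i, a l i * X ω i) y) μ :=
    fun i => mul_wk_int hZ (hXi i) y
  have h0 := wk_int (μ := μ) hZ y
  have key : (∫ ω, (∑ l, (y l - ∑ i, a l i * X ω i) * v l) *
      wk (fun l => ∑ i, a l i * X ω i) y ∂μ) =
      ∑ l, v l * (y l * pd μ (fun ω l => ∑ i, a l i * X ω i) y -
        ∑ i, a l i * ∫ ω, X ω i * wk (fun l => ∑ i, a l i * X ω i) y ∂μ) := by
    have e : ∀ ω, (∑ l, (y l - ∑ i, a l i * X ω i) * v l) *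
        wk (fun l => ∑ i, a l i * X ω i) y =
        ∑ l, v l * (y l * wk (fun l => ∑ i, a l i * X ω i) y -
          ∑ i, a l i * (X ω i * wk (fun l => ∑ i, a l i * X ω i) y)) := by
      intro ω
      rw [Finset.sum_mul]
      refine Finset.sum_congr rfl fun l _ => ?_
      simp only [← mul_assoc, ← Finset.sum_mul]
      ring
    simp_rw [e]
    have hs : ∀ l, Integrable (fun ω => ∑ i, a l i *
        (X ω i * wk (fun l => ∑ i, a l i * X ω i) y)) μ :=
      fun l => integrable_finsetSum _ fun i _ => (h1 i).const_mul _
    have hs2 : ∀ l, Integrable (fun ω => v l * (y l * wk (fun l => ∑ i, a l i * X ω i) y -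
        ∑ i, a l i * (X ω i * wk (fun l => ∑ i, a l i * X ω i) y))) μ :=
      fun l => ((h0.const_mul _).sub (hs l)).const_mul _
    rw [integral_finsetSum _ fun l _ => hs2 l]
    refine Finset.sum_congr rfl fun l _ => ?_
    rw [integral_const_mul, integral_sub (h0.const_mul _) (hs l), integral_const_mul,
      integral_finsetSum _ fun i _ => (h1 i).const_mul _]
    simp_rw [integral_const_mul]
    rfl
  unfold Dn
  rw [key, Finset.sum_div]
  refine Finset.sum_congr rfl fun l _ => ?_
  rw [mul_div_assoc, sub_div, mul_div_assoc, div_self hp.ne', mul_one, Finset.sum_div]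
  simp_rw [mul_div_assoc]

end D

lemma cov_eq {Ω : Type*} {m : MeasurableSpace Ω} {m0 : MeasurableSpace Ω} {μ : Measure Ω}
    [IsProbabilityMeasure μ] (hm : m ≤ m0) {A B : Ω → ℝ} (hA : MemLp A 2 μ) (hB : MemLp B 2 μ) :
    ∫ ω, ((μ[fun ω => A ω * B ω | m]) ω - (μ[A | m]) ω * (μ[B | m]) ω) ∂μ =
      (∫ ω, A ω * B ω ∂μ) - ∫ ω, A ω * (μ[B | m]) ω ∂μ := by
  have hA' : MemLp (μ[A | m]) 2 μ := hA.condExp (by norm_num)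
  have hB' : MemLp (μ[B | m]) 2 μ := hB.condExp (by norm_num)
  have h1 : Integrable (fun ω => (μ[A | m]) ω * (μ[B | m]) ω) μ := hA'.integrable_mul hB'
  rw [integral_sub integrable_condExp h1, integral_condExp hm]
  congr 1
  have h2 : Integrable (A * μ[B | m]) μ := hA.integrable_mul hB'
  have h3 := condExp_mul_of_stronglyMeasurable_right (μ := μ) (m := m)
    stronglyMeasurable_condExp h2 (hA.integrable (by norm_num))
  calc ∫ ω, (μ[A | m]) ω * (μ[B | m]) ω ∂μ = ∫ ω, (μ[A * μ[B | m] | m]) ω ∂μ :=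
        integral_congr_ae (h3.symm)
    _ = _ := integral_condExp hm

lemma int_Dn {Ω : Type*} {m : MeasurableSpace Ω} {m0 : MeasurableSpace Ω} {μ : Measure Ω}
    [IsProbabilityMeasure μ] (hmle : m ≤ m0) {L K : ℕ} {a : Fin L → Fin K → ℝ}
    {X : Ω → Fin K → ℝ} {N : Ω → Fin L → ℝ}
    (hX : Measurable X) (hN : Measurable N) (hXN : IndepFun X N μ)
    (hN_law : μ.map N = Measure.pi fun _ : Fin L => gaussianReal 0 1)
    (hXm : ∀ i, MemLp (fun ω => X ω i) 2 μ) (b : Fin L → ℝ) (k : Fin K)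
    (hB : ∀ i, (fun ω => (∫ ω', X ω' i * wk (fun l => ∑ i, a l i * X ω' i)
        (fun l => (∑ i, a l i * X ω i) + N ω l) ∂μ) /
      pd μ (fun ω l => ∑ i, a l i * X ω i) (fun l => (∑ i, a l i * X ω i) + N ω l)) =ᵐ[μ]
      μ[fun ω => X ω i | m]) :
    (∫ ω, Dn μ (fun ω l => ∑ i, a l i * X ω i)
        (fun l => (∑ i, a l i * X ω i) + N ω l) (fun l => b l * X ω k) ∂μ) =
      ∑ l, ∑ i, b l * a l i * ∫ ω, ((μ[fun ω' => X ω' k * X ω' i | m]) ω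
        - (μ[fun ω' => X ω' k | m]) ω * (μ[fun ω' => X ω' i | m]) ω) ∂μ := by
  have hXi : ∀ i, Integrable (fun ω => X ω i) μ := fun i => (hXm i).integrable (by norm_num)
  have hXh : ∀ i, MemLp (μ[fun ω => X ω i | m]) 2 μ := fun i => (hXm i).condExp (by norm_num)
  have hIntg : (∫ ω, Dn μ (fun ω l => ∑ i, a l i * X ω i)
        (fun l => (∑ i, a l i * X ω i) + N ω l) (fun l => b l * X ω k) ∂μ) =
      ∫ ω, ∑ l, (b l * (X ω k * N ω l) + ∑ i, b l * a l i *
        (X ω k * X ω i - X ω k * (μ[fun ω => X ω i | m]) ω)) ∂μ := by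
    refine integral_congr_ae ?_
    filter_upwards [ae_all_iff.2 hB] with ω hω
    rw [Dn_expand hX hXi]
    refine Finset.sum_congr rfl fun l _ => ?_
    simp only [hω]
    rw [add_comm (∑ i, a l i * X ω i) (N ω l), add_sub_assoc, ← Finset.sum_sub_distrib, mul_add, Finset.mul_sum]
    congr 1
    · ring
    · refine Finset.sum_congr rfl fun i _ => ?_
      ring
  rw [hIntg]
  have hN2 := fun l => N_memLp hN hN_law l
  have i1 : ∀ l, Integrable (fun ω => X ω k * N ω l) μ :=
    fun l => (hXm k).integrable_mul (hN2 l).1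
  have i2 : ∀ i, Integrable (fun ω => X ω k * X ω i) μ := fun i => (hXm k).integrable_mul (hXm i)
  have i3 : ∀ i, Integrable (fun ω => X ω k * (μ[fun ω => X ω i | m]) ω) μ :=
    fun i => (hXm k).integrable_mul (hXh i)
  have z1 : ∀ l, ∫ ω, X ω k * N ω l ∂μ = 0 := by
    intro l
    have hi : IndepFun (fun ω => X ω k) (fun ω => N ω l) μ :=
      hXN.comp (measurable_pi_apply k) (measurable_pi_apply l)
    have := hi.integral_fun_mul_eq_mul_integral (by fun_prop) (by fun_prop)
    rw [this, (hN2 l).2, mul_zero]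
  have i6 : ∀ l i, Integrable (fun ω => b l * a l i *
        (X ω k * X ω i - X ω k * (μ[fun ω => X ω i | m]) ω)) μ := fun l i =>
    ((i2 i).sub (i3 i)).const_mul _
  have i4 : ∀ l, Integrable (fun ω => ∑ i, b l * a l i *
        (X ω k * X ω i - X ω k * (μ[fun ω => X ω i | m]) ω)) μ := fun l =>
    integrable_finsetSum _ fun i _ => ((i2 i).sub (i3 i)).const_mul _
  have i5 : ∀ l, Integrable (fun ω => b l * (X ω k * N ω l) + ∑ i, b l * a l i *
        (X ω k * X ω i - X ω k * (μ[fun ω => X ω i | m]) ω)) μ := fun l =>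
    ((i1 l).const_mul _).add (i4 l)
  rw [integral_finsetSum _ fun l _ => i5 l]
  have e3 : ∀ l, ∫ ω, (b l * (X ω k * N ω l) + ∑ i, b l * a l i *
        (X ω k * X ω i - X ω k * (μ[fun ω => X ω i | m]) ω)) ∂μ =
      ∑ i, b l * a l i * ∫ ω, ((μ[fun ω' => X ω' k * X ω' i | m]) ω
        - (μ[fun ω' => X ω' k | m]) ω * (μ[fun ω' => X ω' i | m]) ω) ∂μ := by
    intro l
    rw [integral_add ((i1 l).const_mul _) (i4 l), integral_const_mul, z1, mul_zero, zero_add,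
      integral_finsetSum _ fun i _ => i6 l i]
    refine Finset.sum_congr rfl fun i _ => ?_
    rw [integral_const_mul, integral_sub (i2 i) (i3 i), cov_eq hmle (hXm k) (hXm i)]
  exact Finset.sum_congr rfl fun l _ => e3 l

lemma bayes_lin {Ω : Type*} [MeasurableSpace Ω] {μ : Measure Ω} [IsProbabilityMeasure μ]
    {L K : ℕ} {a : Fin L → Fin K → ℝ} {X : Ω → Fin K → ℝ} {N : Ω → Fin L → ℝ}
    (hX : Measurable X) (hN : Measurable N) (hXN : IndepFun X N μ)
    (hN_law : μ.map N = Measure.pi fun _ : Fin L => gaussianReal 0 1)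
    (hXi : ∀ i, Integrable (fun ω => X ω i) μ) (i : Fin K) :
    (fun ω => (∫ ω', X ω' i * wk (fun l => ∑ i, a l i * X ω' i)
        (fun l => (∑ i, a l i * X ω i) + N ω l) ∂μ) /
      pd μ (fun ω l => ∑ i, a l i * X ω i) (fun l => (∑ i, a l i * X ω i) + N ω l)) =ᵐ[μ]
      μ[fun ω => X ω i |
        MeasurableSpace.comap (fun ω l => (∑ i, a l i * X ω i) + N ω l) inferInstance] := by
  have hgm : Measurable (fun (x : Fin K → ℝ) (l : Fin L) => ∑ i, a l i * x i) := by fun_prop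
  have h := condExp_bayes hX hN hgm hXN hN_law (measurable_pi_apply i) (hXi i)
  exact h

/-- **Multiuser I-MMSE relation** (Theorem 4): the partial derivative of the mutual information
with respect to the `k`-th user's SNR equals
`(1/2) Σᵢ √(snrᵢ/snr_k) [HᵀH]_{k i} E[Cov(X_k, X_i | Y)]`. -/
theorem hasDerivAt_mutualInfo_multiuser
    {Ω : Type*} [MeasurableSpace Ω] (μ : Measure Ω) [IsProbabilityMeasure μ]
    {L K : ℕ} (H : Matrix (Fin L) (Fin K) ℝ)
    (X : Ω → Fin K → ℝ) (N : Ω → Fin L → ℝ)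
    (hX : Measurable X) (hN : Measurable N)
    (hXN : IndepFun X N μ)
    (hN_law : μ.map N = Measure.pi fun _ : Fin L => gaussianReal 0 1)
    (hX2 : Integrable (fun ω => ∑ k, X ω k ^ 2) μ)
    (snr : Fin K → ℝ) (hsnr : ∀ i, 0 < snr i) (k : Fin K) :
    HasDerivAt
      (fun t : ℝ =>
        (mutualInfo μ X (chOutMulti H X N (Function.update snr k t))).toReal)
      ((1 / 2) * ∑ i, Real.sqrt (snr i / snr k) * (H.transpose * H) k i *
        ∫ ω, ((μ[fun ω' => X ω' k * X ω' i |
                  MeasurableSpace.comap (chOutMulti H X N snr) inferInstance]) ω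
              - (μ[fun ω' => X ω' k |
                  MeasurableSpace.comap (chOutMulti H X N snr) inferInstance]) ω
              * (μ[fun ω' => X ω' i |
                  MeasurableSpace.comap (chOutMulti H X N snr) inferInstance]) ω) ∂μ)
      (snr k) := by
  have hXm : ∀ i, MemLp (fun ω => X ω i) 2 μ := by
    intro i
    rw [memLp_two_iff_integrable_sq (by fun_prop)]
    refine hX2.mono' (by fun_prop) (ae_of_all _ fun ω => ?_)
    rw [Real.norm_eq_abs, abs_of_nonneg (sq_nonneg _)]
    exact Finset.single_le_sum (f := fun i => X ω i ^ 2) (fun _ _ => sq_nonneg _)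
      (Finset.mem_univ i)
  have hXi : ∀ i, Integrable (fun ω => X ω i) μ := fun i => (hXm i).integrable (by norm_num)
  -- the two pieces of the signal
  set u : (Fin K → ℝ) → Fin L → ℝ :=
    fun x l => ∑ i, H l i * (√(Function.update snr k 0 i) * x i) with hu
  set v : (Fin K → ℝ) → Fin L → ℝ := fun x l => H l k * x k with hv
  set a : Fin L → Fin K → ℝ := fun l i => H l i * √(snr i) with ha
  have hum : Measurable u := by fun_prop
  have hvm : Measurable v := by fun_prop
  have huv : ∀ t x l, ∑ i, H l i * (√(Function.update snr k t i) * x i) =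
      u x l + √t * v x l := by
    intro t x l
    have : √t * v x l = ∑ i, if i = k then √t * (H l k * x k) else 0 := by simp [hv]
    rw [this, hu, ← Finset.sum_add_distrib]
    refine Finset.sum_congr rfl fun i _ => ?_
    by_cases h : i = k
    · subst h; simp; ring
    · simp [h]
  have hch : ∀ t, chOutMulti H X N (Function.update snr k t) =
      fun ω l => (u (X ω) l + √t * v (X ω) l) + N ω l := by
    intro t
    funext ω l
    simp only [chOutMulti]
    rw [huv]
  have hg : ∀ x l, u x l + √(snr k) * v x l = ∑ i, a l i * x i := by
    intro x l
    rw [← huv, Function.update_eq_self]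
    simp only [ha, mul_assoc]
  have hY : chOutMulti H X N snr = fun ω l => (∑ i, a l i * X ω i) + N ω l := by
    have := hch (snr k)
    rw [Function.update_eq_self] at this
    rw [this]
    simp only [hg]
  have hu2 : Integrable (fun ω => ∑ l, u (X ω) l ^ 2) μ := by
    refine integrable_finsetSum _ fun l _ => MemLp.integrable_sq ?_
    exact memLp_finsetSum _ fun i _ => ((hXm i).const_mul _).const_mul _
  have hv2 : Integrable (fun ω => ∑ l, v (X ω) l ^ 2) μ :=
    integrable_finsetSum _ fun l _ => MemLp.integrable_sq ((hXm k).const_mul _)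
  have hD := deriv_line hX hN hum hvm hXN hN_law hu2 hv2 (√(snr k))
  have hD2 := hD.comp (snr k) (Real.hasDerivAt_sqrt (hsnr k).ne')
  simp only [hch]
  refine hD2.congr_deriv ?_
  clear hD hD2 hch huv hu2 hv2
  rw [hY]
  have hYm : Measurable (fun ω l => (∑ i, a l i * X ω i) + N ω l) := by fun_prop
  have hB := bayes_lin (a := a) hX hN hXN hN_law hXi
  have hIntg := int_Dn hYm.comap_le hX hN hXN hN_law hXm (fun l => H l k) k hB
  have e1 : ∀ ω, (fun l => (u (X ω) l + N ω l) + √(snr k) * v (X ω) l) =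
      fun l => (∑ i, a l i * X ω i) + N ω l := by
    intro ω
    funext l
    rw [← hg]; ring
  simp only [e1, hg]
  rw [hIntg, Finset.sum_comm, Finset.sum_mul, Finset.mul_sum]
  refine Finset.sum_congr rfl fun i _ => ?_
  rw [← Finset.sum_mul, Matrix.mul_apply, Real.sqrt_div (hsnr i).le]
  have hk : √(snr k) ≠ 0 := (Real.sqrt_pos.2 (hsnr k)).ne'
  have e4 : ∑ l, H l k * a l i = (∑ l, H.transpose k l * H l i) * √(snr i) := by
    rw [Finset.sum_mul]
    refine Finset.sum_congr rfl fun l _ => ?_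
    simp only [ha, Matrix.transpose_apply]; ring
  rw [e4]
  field_simp
end
end
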